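/- arXiv:2006.07085 — 2 statements merged into one kernel-verified Lean document; each statement's English description precedes it below -/
import Mathlib

section
/- Consider the planar system (P): v' = μv − ωw + f(v,w), w' = ωv + μw + g(v,w), and assume σ_# = 0 and σ₂ ≠ 0. Then there exist ε, δ, C > 0 such that for every μ with 0 < |μ| < ε: (i) if μ·ω·σ₂ > 0, the system (P) has a nonconstant periodic solution (v,w) : ℝ → ℝ² with 0 < sup_t √(v(t)² + w(t)²) < δ, whose amplitude satisfies |sup_t √(v(t)² + w(t)²) − √(2πωμ/σ₂)| ≤ C·|μ|, i.e., the leading-order amplitude is r₀ = √(2πωμ/σ₂) + O(μ); any two nonconstant periodic solutions with supremum norm less than δ coincide up to a time translation; (ii) if μ·ω·σ₂ < 0, the system (P) has no nonconstant periodic solution with supremum norm less than δ. In particular, this degenerate Hopf bifurcation is subcritical if ωσ₂ < 0 and supercritical if ωσ₂ > 0, with amplitude scaling like μ^{1/2} instead of μ. -/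
open Real Set

/-- A (global) solution of the autonomous planar ODE `u' = F(u)`. -/
def IsSolution2 (F : ℝ × ℝ → ℝ × ℝ) (u : ℝ → ℝ × ℝ) : Prop :=
  ∀ t, HasDerivAt u (F (u t)) t

/-- A nonconstant periodic solution of `u' = F(u)`. -/
def IsPeriodicSolution2 (F : ℝ × ℝ → ℝ × ℝ) (u : ℝ → ℝ × ℝ) : Prop :=
  IsSolution2 F u ∧ (∃ T > 0, ∀ t, u (t + T) = u t) ∧ ¬ (∀ t, u t = u 0)

/-- The amplitude `sup_t √(v(t)² + w(t)²)` of a planar curve. -/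
noncomputable def ampl2 (u : ℝ → ℝ × ℝ) : ℝ :=
  ⨆ t : ℝ, Real.sqrt ((u t).1 ^ 2 + (u t).2 ^ 2)


namespace DegHopf

/-- Standing assumptions on the angular functions. -/
structure Ang (A B : ℝ → ℝ) (M σ : ℝ) : Prop where
  cA : Continuous A
  cB : Continuous B
  pA : Function.Periodic A (2 * π)
  pB : Function.Periodic B (2 * π)
  Mpos : 0 < M
  bA : ∀ θ, |A θ| ≤ M
  bB : ∀ θ, |B θ| ≤ M
  iA : ∫ θ in (0:ℝ)..(2 * π), A θ = 0
  iAB : ∫ θ in (0:ℝ)..(2 * π), A θ * B θ = σ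
  σne : σ ≠ 0

/-- The scalar field for `y = 1 / r` as a function of the angle. -/
noncomputable def Hf (A B : ℝ → ℝ) (μ θ y : ℝ) : ℝ := -(μ * y ^ 2 + A θ * y) / (y + B θ)

variable {A B : ℝ → ℝ} {M σ : ℝ}

lemma Ang.cAB (h : Ang A B M σ) : Continuous (fun θ => A θ * B θ) := h.cA.mul h.cB

lemma pointwise_est {a b μ R Y y : ℝ} (hM : 0 < M) (ha : |a| ≤ M) (hb : |b| ≤ M) (hR : 0 ≤ R)
    (hY : 2 * (R + 2 * M) ≤ Y) (hy : |y - Y| ≤ R) :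
    |Y * ((-μ * y ^ 2 + a * b) / (y + b)) - (a * b - μ * Y ^ 2)| ≤
      |μ| * (R + 2 * M) * Y + 2 * M ^ 2 * (R + M) / Y := by
  have h1 := abs_le.1 hy
  have h2 := abs_le.1 hb
  have hyb : Y / 2 ≤ y + b := by linarith
  have hYp : 0 < Y := by linarith
  have hybp : 0 < y + b := by linarith
  have e : Y * ((-μ * y ^ 2 + a * b) / (y + b)) - (a * b - μ * Y ^ 2) =
      -(μ * Y * ((y - Y) - b * (y / (y + b)))) + (a * b) * ((Y - y - b) / (y + b)) := by
    field_simp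
    ring
  rw [e]
  have hq : |y / (y + b)| ≤ 2 := by
    rw [abs_div, abs_of_pos hybp, div_le_iff₀ hybp, abs_le]
    constructor <;> linarith
  have hw : |(Y - y - b) / (y + b)| ≤ (R + M) / (Y / 2) := by
    rw [abs_div, abs_of_pos hybp]
    apply div_le_div₀ (by linarith) _ (by linarith) hyb
    rw [abs_le]; constructor <;> linarith
  have hab : |a * b| ≤ M ^ 2 := by
    rw [abs_mul, pow_two]; exact mul_le_mul ha hb (abs_nonneg _) hM.le
  refine (abs_add_le _ _).trans (add_le_add ?_ ?_)
  · rw [abs_neg, abs_mul, abs_mul, abs_of_pos hYp]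
    have : |y - Y - b * (y / (y + b))| ≤ R + 2 * M := by
      refine (abs_sub _ _).trans ?_
      rw [abs_mul]
      have := mul_le_mul hb hq (abs_nonneg _) hM.le
      linarith
    have := mul_le_mul_of_nonneg_left this (mul_nonneg (abs_nonneg μ) hYp.le)
    linarith
  · rw [abs_mul]
    refine (mul_le_mul hab hw (abs_nonneg _) (by positivity)).trans (le_of_eq ?_)
    field_simp

lemma int_est (h : Ang A B M σ) {μ R Y : ℝ} {y : ℝ → ℝ} (hR : 0 ≤ R)
    (hY : 2 * (R + 2 * M) ≤ Y) (hc : ContinuousOn y (Icc 0 (2 * π)))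
    (hy : ∀ θ ∈ Icc 0 (2 * π), |y θ - Y| ≤ R) :
    |Y * (∫ θ in (0:ℝ)..(2 * π), (-μ * y θ ^ 2 + A θ * B θ) / (y θ + B θ))
        - (σ - 2 * π * μ * Y ^ 2)| ≤
      2 * π * (|μ| * (R + 2 * M) * Y + 2 * M ^ 2 * (R + M) / Y) := by
  have hpi := Real.pi_pos
  have hM := h.Mpos
  have hne : ∀ θ ∈ Icc 0 (2 * π), y θ + B θ ≠ 0 := by
    intro θ hθ
    have h1 := abs_le.1 (hy θ hθ)
    have h2 := abs_le.1 (h.bB θ)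
    have : 0 < y θ + B θ := by linarith
    exact this.ne'
  have hco : ContinuousOn (fun θ => (-μ * y θ ^ 2 + A θ * B θ) / (y θ + B θ)) (Icc 0 (2 * π)) :=
    ContinuousOn.div (((continuousOn_const.mul (hc.pow 2))).add
      h.cAB.continuousOn) (hc.add h.cB.continuousOn) hne
  have hI1 : IntervalIntegrable (fun θ => (-μ * y θ ^ 2 + A θ * B θ) / (y θ + B θ))
      MeasureTheory.volume 0 (2 * π) := by
    apply ContinuousOn.intervalIntegrable
    rwa [uIcc_of_le (by positivity)]
  have hI2 : IntervalIntegrable (fun θ => A θ * B θ - μ * Y ^ 2)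
      MeasureTheory.volume 0 (2 * π) :=
    (h.cAB.sub continuous_const).intervalIntegrable _ _
  have e1 : ∫ θ in (0:ℝ)..(2 * π), (A θ * B θ - μ * Y ^ 2) = σ - 2 * π * μ * Y ^ 2 := by
    rw [intervalIntegral.integral_sub (h.cAB.intervalIntegrable _ _)
      (continuous_const.intervalIntegrable _ _), h.iAB, intervalIntegral.integral_const]
    simp; ring
  rw [← e1, ← intervalIntegral.integral_const_mul,
    ← intervalIntegral.integral_sub (hI1.const_mul _) hI2]
  have := intervalIntegral.norm_integral_le_of_norm_le_const (a := 0) (b := 2 * π)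
    (f := fun θ => Y * ((-μ * y θ ^ 2 + A θ * B θ) / (y θ + B θ)) - (A θ * B θ - μ * Y ^ 2))
    (C := |μ| * (R + 2 * M) * Y + 2 * M ^ 2 * (R + M) / Y) (by
      intro θ hθ
      rw [uIoc_of_le (by positivity)] at hθ
      exact pointwise_est hM (h.bA θ) (h.bB θ) hR hY (hy θ (Ioc_subset_Icc_self hθ)))
  rw [Real.norm_eq_abs, sub_zero, abs_of_pos (by positivity : (0:ℝ) < 2 * π)] at this
  linarith

lemma int_identity (h : Ang A B M σ) {μ : ℝ} {y : ℝ → ℝ}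
    (hc : ContinuousOn y (Icc 0 (2 * π)))
    (hne : ∀ θ ∈ Icc 0 (2 * π), y θ + B θ ≠ 0)
    (hd : ∀ θ ∈ Ioo 0 (2 * π), HasDerivAt y (Hf A B μ θ (y θ)) θ) :
    ∫ θ in (0:ℝ)..(2 * π), (-μ * y θ ^ 2 + A θ * B θ) / (y θ + B θ) = y (2 * π) - y 0 := by
  have hpi := Real.pi_pos
  have hco : ContinuousOn (fun θ => Hf A B μ θ (y θ)) (Icc 0 (2 * π)) := by
    unfold Hf
    exact ContinuousOn.div ((continuousOn_const.mul (hc.pow 2)).add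
      (h.cA.continuousOn.mul hc)).neg (hc.add h.cB.continuousOn) hne
  have hI : IntervalIntegrable (fun θ => Hf A B μ θ (y θ)) MeasureTheory.volume 0 (2 * π) := by
    apply ContinuousOn.intervalIntegrable
    rwa [uIcc_of_le (by positivity)]
  have := intervalIntegral.integral_eq_sub_of_hasDerivAt_of_le (by positivity) hc hd hI
  rw [← this]
  have e : ∫ θ in (0:ℝ)..(2 * π), (Hf A B μ θ (y θ) + A θ) =
      ∫ θ in (0:ℝ)..(2 * π), Hf A B μ θ (y θ) := by
    rw [intervalIntegral.integral_add hI (h.cA.intervalIntegrable _ _), h.iA, add_zero]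
  rw [← e]
  apply intervalIntegral.integral_congr
  intro θ hθ
  rw [uIcc_of_le (by positivity)] at hθ
  have := hne θ hθ
  simp only [Hf]
  field_simp
  ring

lemma Hf_bound {μ θ y : ℝ} (h : Ang A B M σ) (hy : 2 * M ≤ y) (hμ : |μ| * y ≤ M) :
    |Hf A B μ θ y| ≤ 4 * M := by
  have hM := h.Mpos
  have h2 := abs_le.1 (h.bB θ)
  have hyp : 0 < y := by linarith
  have hyb : y / 2 ≤ y + B θ := by linarith
  have hybp : 0 < y + B θ := by linarith
  unfold Hf
  rw [abs_div, abs_of_pos hybp, div_le_iff₀ hybp, abs_neg]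
  have : |μ * y ^ 2 + A θ * y| ≤ M * y + M * y := by
    refine (abs_add_le _ _).trans (add_le_add ?_ ?_)
    · rw [abs_mul, abs_of_pos (by positivity : 0 < y ^ 2)]
      nlinarith
    · rw [abs_mul, abs_of_pos hyp]
      exact mul_le_mul_of_nonneg_right (h.bA θ) hyp.le
  nlinarith

/-- Periodic solutions of the scalar equation lying above `N`. -/
structure PSol (A B : ℝ → ℝ) (μ N : ℝ) (y : ℝ → ℝ) : Prop where
  der : ∀ θ, HasDerivAt y (Hf A B μ θ (y θ)) θ
  per : Function.Periodic y (2 * π)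
  low : ∀ θ, N ≤ y θ

lemma PSol.cont {μ N : ℝ} {y : ℝ → ℝ} (hy : PSol A B μ N y) : Continuous y :=
  continuous_iff_continuousAt.2 fun θ => (hy.der θ).continuousAt

lemma PSol.osc (h : Ang A B M σ) {μ N : ℝ} {y : ℝ → ℝ} (hN : 2 * M ≤ N) (hy : PSol A B μ N y) :
    ∀ θ, |y θ - y 0| ≤ 8 * π * M := by
  have hpi := Real.pi_pos
  have hM := h.Mpos
  have hpi2 : (0:ℝ) < 2 * π := by positivity
  obtain ⟨θm, -, hm⟩ := isCompact_Icc.exists_isMaxOn (nonempty_Icc.2 hpi2.le)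
    hy.cont.continuousOn
  have hmax : ∀ θ, y θ ≤ y θm := by
    intro θ
    obtain ⟨x, hx, e⟩ := hy.per.exists_mem_Ico₀ hpi2 θ
    rw [e]; exact hm (Ico_subset_Icc_self hx)
  have hz := IsLocalMax.hasDerivAt_eq_zero (Filter.Eventually.of_forall hmax) (hy.der θm)
  have hlow := hy.low θm
  have hB := abs_le.1 (h.bB θm)
  have hyp : 0 < y θm := by linarith
  have hμm : |μ| * y θm ≤ M := by
    have : μ * y θm = - A θm := by
      unfold Hf at hz
      rw [div_eq_zero_iff] at hz
      rcases hz with hz | hz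
      · have : y θm * (μ * y θm + A θm) = 0 := by linarith
        rcases mul_eq_zero.1 this with h' | h' <;> linarith
      · linarith
    calc |μ| * y θm = |μ * y θm| := by rw [abs_mul, abs_of_pos hyp]
      _ = |A θm| := by rw [this, abs_neg]
      _ ≤ M := h.bA θm
  have hb : ∀ θ, |Hf A B μ θ (y θ)| ≤ 4 * M := fun θ =>
    Hf_bound h (hN.trans (hy.low θ))
      ((mul_le_mul_of_nonneg_left (hmax θ) (abs_nonneg _)).trans hμm)
  intro θ
  obtain ⟨x, hx, e⟩ := hy.per.exists_mem_Ico₀ hpi2 θ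
  rw [e]
  have := norm_image_sub_le_of_norm_deriv_le_segment' (a := 0) (b := 2 * π) (f := y) (C := 4 * M)
    (fun θ _ => (hy.der θ).hasDerivWithinAt) (fun θ _ => hb θ) x (Ico_subset_Icc_self hx)
  rw [Real.norm_eq_abs] at this
  have h3 := hx.2
  nlinarith

lemma per_est (h : Ang A B M σ) : ∃ N K : ℝ, 0 < K ∧ 2 * (8 * π * M + 2 * M) ≤ N ∧ 1 ≤ N ∧
    ∀ μ y, PSol A B μ N y → |σ - 2 * π * μ * y 0 ^ 2| ≤ K / y 0 ∧
      |σ - 2 * π * μ * y 0 ^ 2| ≤ |σ| / 2 := by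
  have hpi := Real.pi_pos
  have hM := h.Mpos
  have hσ : 0 < |σ| := abs_pos.2 h.σne
  obtain ⟨R, hR⟩ : ∃ R, R = 8 * π * M := ⟨_, rfl⟩
  have hRp : 0 < R := by rw [hR]; positivity
  obtain ⟨k1, hk1⟩ : ∃ k1, k1 = R + 2 * M := ⟨_, rfl⟩
  obtain ⟨k2, hk2⟩ : ∃ k2, k2 = 4 * π * M ^ 2 * (R + M) := ⟨_, rfl⟩
  have hk1p : 0 < k1 := by rw [hk1]; positivity
  have hk2p : 0 < k2 := by rw [hk2]; positivity
  obtain ⟨K, hK⟩ : ∃ K, K = 2 * k1 * (|σ| + k2) + k2 := ⟨_, rfl⟩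
  have hKp : 0 < K := by rw [hK]; positivity
  refine ⟨max (2 * k1) (max 1 (2 * K / |σ|)), K, hKp, ?_, ?_, ?_⟩
  · rw [← hR, ← hk1]; exact le_max_left _ _
  · exact (le_max_left _ _).trans (le_max_right _ _)
  intro μ y hy
  have hN1 : 2 * k1 ≤ max (2 * k1) (max 1 (2 * K / |σ|)) := le_max_left _ _
  have hN2 : 1 ≤ max (2 * k1) (max 1 (2 * K / |σ|)) :=
    (le_max_left _ _).trans (le_max_right _ _)
  have hN3 : 2 * K / |σ| ≤ max (2 * k1) (max 1 (2 * K / |σ|)) :=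
    (le_max_right _ _).trans (le_max_right _ _)
  generalize max (2 * k1) (max 1 (2 * K / |σ|)) = N at *
  have hosc := hy.osc h (by linarith)
  have hl := hy.low
  have hne : ∀ θ, y θ + B θ ≠ 0 := by
    intro θ
    have h1 := hl θ
    have h2 := abs_le.1 (h.bB θ)
    have : 0 < y θ + B θ := by linarith
    exact this.ne'
  have hid := int_identity h hy.cont.continuousOn (fun θ _ => hne θ) (fun θ _ => hy.der θ)
  have hper : y (2 * π) = y 0 := by simpa using hy.per 0
  have hest := int_est h (μ := μ) hRp.le (Y := y 0) (by linarith [hl 0]) hy.cont.continuousOn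
    (fun θ _ => hR ▸ hosc θ)
  rw [hid, hper, sub_self, mul_zero, zero_sub, abs_neg] at hest
  have hY := hl 0
  generalize y 0 = Y at *
  have hYp : 0 < Y := by linarith
  have e : 2 * π * (|μ| * (R + 2 * M) * Y + 2 * M ^ 2 * (R + M) / Y) =
      2 * π * |μ| * k1 * Y + k2 / Y := by rw [hk1, hk2]; ring
  rw [e] at hest
  have hk2Y : k2 / Y ≤ k2 := div_le_self hk2p.le (by linarith)
  have hs1 : 2 * π * |μ| * Y ^ 2 ≤ |σ| + |σ - 2 * π * μ * Y ^ 2| := by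
    have : |2 * π * μ * Y ^ 2| = 2 * π * |μ| * Y ^ 2 := by
      rw [abs_mul, abs_mul, abs_of_pos (by positivity : 0 < Y ^ 2),
        abs_of_pos (by positivity : 0 < 2 * π)]
    rw [← this]
    have := abs_sub σ (σ - 2 * π * μ * Y ^ 2)
    simpa using this
  have hs2 : 2 * π * |μ| * k1 * Y ≤ π * |μ| * Y ^ 2 := by
    have : 0 ≤ π * |μ| * Y := by positivity
    nlinarith
  have hs3 : π * |μ| * Y ^ 2 ≤ |σ| + k2 := by linarith
  have hs4 : 2 * π * |μ| * k1 * Y ≤ 2 * k1 * (|σ| + k2) / Y := by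
    rw [le_div_iff₀ hYp]
    nlinarith
  have hfin : |σ - 2 * π * μ * Y ^ 2| ≤ K / Y := by
    rw [hK, add_div]; linarith
  refine ⟨hfin, hfin.trans ?_⟩
  rw [div_le_iff₀ hYp]
  have : 2 * K / |σ| ≤ Y := by linarith
  rw [div_le_iff₀ hσ] at this
  linarith

lemma lin_ode {D Q : ℝ → ℝ} (hQ : Continuous Q) (hD : ∀ θ, HasDerivAt D (Q θ * D θ) θ) (θ : ℝ) :
    D θ = D 0 * Real.exp (∫ s in (0:ℝ)..θ, Q s) := by
  have hI : ∀ θ, HasDerivAt (fun θ => ∫ s in (0:ℝ)..θ, Q s) (Q θ) θ := fun θ =>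
    intervalIntegral.integral_hasDerivAt_right (hQ.intervalIntegrable _ _)
      hQ.aestronglyMeasurable.stronglyMeasurableAtFilter hQ.continuousAt
  have hd : ∀ θ, HasDerivAt (fun θ => D θ * Real.exp (-∫ s in (0:ℝ)..θ, Q s)) 0 θ := by
    intro θ
    have := (hD θ).mul (hI θ).neg.exp
    refine this.congr_deriv ?_
    simp only [Pi.neg_apply]
    ring
  have := is_const_of_deriv_eq_zero (fun θ => (hd θ).differentiableAt) (fun θ => (hd θ).deriv) θ 0
  simp only [intervalIntegral.integral_same, neg_zero, Real.exp_zero, mul_one] at this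
  rw [← this, mul_assoc, ← Real.exp_add]
  simp

/-- Divided difference of the scalar field. -/
noncomputable def Qf (A B : ℝ → ℝ) (μ : ℝ) (y₁ y₂ : ℝ → ℝ) (θ : ℝ) : ℝ :=
  -μ - (A θ * B θ - μ * B θ ^ 2) / ((y₁ θ + B θ) * (y₂ θ + B θ))

lemma Qf_eq {μ : ℝ} {y₁ y₂ : ℝ → ℝ} {θ : ℝ} (h1 : y₁ θ + B θ ≠ 0) (h2 : y₂ θ + B θ ≠ 0) :
    Hf A B μ θ (y₂ θ) - Hf A B μ θ (y₁ θ) = Qf A B μ y₁ y₂ θ * (y₂ θ - y₁ θ) := by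
  unfold Hf Qf
  field_simp
  ring

lemma Qf_cont (h : Ang A B M σ) {μ : ℝ} {y₁ y₂ : ℝ → ℝ} (c1 : Continuous y₁) (c2 : Continuous y₂)
    (h1 : ∀ θ, y₁ θ + B θ ≠ 0) (h2 : ∀ θ, y₂ θ + B θ ≠ 0) : Continuous (Qf A B μ y₁ y₂) := by
  unfold Qf
  have := h.cA
  have := h.cB
  exact continuous_const.sub (Continuous.div (by fun_prop) (by fun_prop)
    (fun θ => mul_ne_zero (h1 θ) (h2 θ)))

lemma diff_eq (h : Ang A B M σ) {μ N : ℝ} (hN : 2 * M ≤ N) {y₁ y₂ : ℝ → ℝ}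
    (d1 : ∀ θ, HasDerivAt y₁ (Hf A B μ θ (y₁ θ)) θ) (d2 : ∀ θ, HasDerivAt y₂ (Hf A B μ θ (y₂ θ)) θ)
    (l1 : ∀ θ, N ≤ y₁ θ) (l2 : ∀ θ, N ≤ y₂ θ) :
    Continuous (Qf A B μ y₁ y₂) ∧ ∀ θ,
    y₂ θ - y₁ θ = (y₂ 0 - y₁ 0) * Real.exp (∫ s in (0:ℝ)..θ, Qf A B μ y₁ y₂ s) := by
  have hM := h.Mpos
  have hne : ∀ y : ℝ → ℝ, (∀ θ, N ≤ y θ) → ∀ θ, y θ + B θ ≠ 0 := by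
    intro y hl θ
    have h1 := hl θ
    have h2 := abs_le.1 (h.bB θ)
    have : 0 < y θ + B θ := by linarith
    exact this.ne'
  have hc := Qf_cont h (μ := μ) (continuous_iff_continuousAt.2 fun θ => (d1 θ).continuousAt)
    (continuous_iff_continuousAt.2 fun θ => (d2 θ).continuousAt) (hne _ l1) (hne _ l2)
  refine ⟨hc, lin_ode hc (D := fun θ => y₂ θ - y₁ θ) ?_⟩
  intro θ
  have := (d2 θ).sub (d1 θ)
  rwa [Qf_eq (hne _ l1 θ) (hne _ l2 θ)] at this

lemma pointwise_Q {a b μ R N Y₁ Y₂ y₁ y₂ : ℝ} (hM : 0 < M) (ha : |a| ≤ M) (hb : |b| ≤ M)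
    (hR : 0 ≤ R) (hN : 2 * (R + 2 * M) ≤ N) (hY1 : N ≤ Y₁) (hY2 : N ≤ Y₂)
    (hy1 : |y₁ - Y₁| ≤ R) (hy2 : |y₂ - Y₂| ≤ R) :
    |Y₁ * Y₂ * (-μ - (a * b - μ * b ^ 2) / ((y₁ + b) * (y₂ + b))) - (-μ * (Y₁ * Y₂) - a * b)| ≤
      3 * (2 * (R + M) / N) * M ^ 2 + 4 * |μ| * M ^ 2 := by
  have key : ∀ Y y : ℝ, N ≤ Y → |y - Y| ≤ R → 0 < y + b ∧ |Y / (y + b) - 1| ≤ 2 * (R + M) / N := by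
    intro Y y hY hy
    have h1 := abs_le.1 hy
    have h2 := abs_le.1 hb
    have hyb : N / 2 ≤ y + b := by linarith
    have hp : 0 < y + b := by linarith
    refine ⟨hp, ?_⟩
    have : Y / (y + b) - 1 = (Y - y - b) / (y + b) := by field_simp; ring
    rw [this, abs_div, abs_of_pos hp]
    have : 2 * (R + M) / N = (R + M) / (N / 2) := by field_simp
    rw [this]
    apply div_le_div₀ (by linarith) _ (by linarith) hyb
    rw [abs_le]; constructor <;> linarith
  obtain ⟨p1, q1⟩ := key Y₁ y₁ hY1 hy1
  obtain ⟨p2, q2⟩ := key Y₂ y₂ hY2 hy2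
  have hNp : 0 < N := by linarith
  have hη : 2 * (R + M) / N ≤ 1 := by rw [div_le_one hNp]; linarith
  have hη0 : 0 ≤ 2 * (R + M) / N := by positivity
  generalize 2 * (R + M) / N = η at *
  have e : Y₁ * Y₂ * (-μ - (a * b - μ * b ^ 2) / ((y₁ + b) * (y₂ + b))) - (-μ * (Y₁ * Y₂) - a * b)
      = -((a * b) * ((Y₁ / (y₁ + b) - 1) * (Y₂ / (y₂ + b) - 1) + (Y₁ / (y₁ + b) - 1)
        + (Y₂ / (y₂ + b) - 1))) + μ * b ^ 2 * ((Y₁ / (y₁ + b) - 1 + 1) * (Y₂ / (y₂ + b) - 1 + 1)) := by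
    field_simp
    ring
  rw [e]
  generalize Y₁ / (y₁ + b) - 1 = x₁ at *
  generalize Y₂ / (y₂ + b) - 1 = x₂ at *
  have hab : |a * b| ≤ M ^ 2 := by
    rw [abs_mul, pow_two]; exact mul_le_mul ha hb (abs_nonneg _) hM.le
  have hbb : b ^ 2 ≤ M ^ 2 := by rw [← sq_abs b]; gcongr
  refine (abs_add_le _ _).trans (add_le_add ?_ ?_)
  · rw [abs_neg, abs_mul]
    have h1 : |x₁ * x₂ + x₁ + x₂| ≤ 3 * η := by
      refine (abs_add_le _ _).trans ?_
      have := abs_add_le (x₁ * x₂) x₁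
      have h3 : |x₁ * x₂| ≤ η := by
        rw [abs_mul]
        calc |x₁| * |x₂| ≤ η * 1 := mul_le_mul q1 (q2.trans hη) (abs_nonneg _) hη0
          _ = η := mul_one _
      linarith
    have := mul_le_mul hab h1 (abs_nonneg _) (by positivity)
    linarith
  · rw [abs_mul, abs_mul, abs_of_nonneg (sq_nonneg b)]
    have h1 : |(x₁ + 1) * (x₂ + 1)| ≤ 2 * 2 := by
      rw [abs_mul]
      have a1 := abs_le.1 q1
      have a2 := abs_le.1 q2
      apply mul_le_mul _ _ (abs_nonneg _) (by norm_num)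
      · rw [abs_le]; constructor <;> linarith
      · rw [abs_le]; constructor <;> linarith
    have h2 := mul_le_mul (mul_le_mul_of_nonneg_left hbb (abs_nonneg μ)) h1 (abs_nonneg _)
      (by positivity)
    linarith

lemma same_sign {μ Y : ℝ} (hσ : σ ≠ 0) (hY : 0 < Y)
    (hs : |σ - 2 * π * μ * Y ^ 2| ≤ |σ| / 2) : 0 < μ * σ := by
  have hpi := Real.pi_pos
  have hp : 0 < 2 * π * Y ^ 2 := by positivity
  have hs' := abs_le.1 hs
  rcases lt_or_gt_of_ne hσ with h0 | h0
  · rw [abs_of_neg h0] at hs'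
    have : μ < 0 := by
      by_contra hc
      have : 0 ≤ μ * (2 * π * Y ^ 2) := mul_nonneg (not_lt.1 hc) hp.le
      nlinarith
    exact mul_pos_of_neg_of_neg this h0
  · rw [abs_of_pos h0] at hs'
    have : 0 < μ := by
      by_contra hc
      have : μ * (2 * π * Y ^ 2) ≤ 0 := mul_nonpos_of_nonpos_of_nonneg (not_lt.1 hc) hp.le
      nlinarith
    exact mul_pos this h0

/-- Uniqueness and a priori estimates for large periodic solutions of the scalar equation. -/
lemma per_unique (h : Ang A B M σ) : ∃ N K : ℝ, 0 < K ∧ 2 * (8 * π * M + 2 * M) ≤ N ∧ 1 ≤ N ∧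
    (∀ μ y, PSol A B μ N y → |σ - 2 * π * μ * y 0 ^ 2| ≤ K / y 0 ∧
      |σ - 2 * π * μ * y 0 ^ 2| ≤ |σ| / 2) ∧
    ∀ μ y₁ y₂, PSol A B μ N y₁ → PSol A B μ N y₂ → y₁ = y₂ := by
  obtain ⟨N₀, K, hK, hN0, hN1, hest⟩ := per_est h
  have hpi := Real.pi_pos
  have hM := h.Mpos
  have hσ : 0 < |σ| := abs_pos.2 h.σne
  obtain ⟨R, hR⟩ : ∃ R, R = 8 * π * M := ⟨_, rfl⟩
  have hRp : 0 < R := by rw [hR]; positivity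
  obtain ⟨N, hN⟩ : ∃ N, N = max N₀ (12 * π * (R + M) * M ^ 2 / |σ| + 1) := ⟨_, rfl⟩
  have hNa : N₀ ≤ N := hN ▸ le_max_left _ _
  have hNb : 12 * π * (R + M) * M ^ 2 / |σ| + 1 ≤ N := hN ▸ le_max_right _ _
  have hmono : ∀ {μ y}, PSol A B μ N y → PSol A B μ N₀ y := fun hy =>
    ⟨hy.der, hy.per, fun θ => hNa.trans (hy.low θ)⟩
  refine ⟨N, K, hK, hN0.trans hNa, hN1.trans hNa, fun μ y hy => hest μ y (hmono hy), ?_⟩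
  intro μ y₁ y₂ hy1 hy2
  have hN2 : 2 * (R + 2 * M) ≤ N := by rw [hR]; linarith
  obtain ⟨hQc, hdiff⟩ := diff_eq h (by linarith) hy1.der hy2.der hy1.low hy2.low
  have hd := hdiff (2 * π)
  have hp1 : y₁ (2 * π) = y₁ 0 := by simpa using hy1.per 0
  have hp2 : y₂ (2 * π) = y₂ 0 := by simpa using hy2.per 0
  rw [hp1, hp2] at hd
  by_cases h0 : y₂ 0 - y₁ 0 = 0
  · funext θ
    have := hdiff θ
    rw [h0, zero_mul] at this
    linarith
  exfalso
  have hI : ∫ s in (0:ℝ)..(2 * π), Qf A B μ y₁ y₂ s = 0 := by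
    have : Real.exp (∫ s in (0:ℝ)..(2 * π), Qf A B μ y₁ y₂ s) = 1 :=
      mul_left_cancel₀ h0 (by rw [← hd, mul_one])
    exact (Real.exp_eq_one_iff _).1 this
  have hYa := hy1.low 0
  have hYb := hy2.low 0
  have hsig := same_sign h.σne (by linarith) (hest μ y₁ (hmono hy1)).2
  have hb := intervalIntegral.norm_integral_le_of_norm_le_const (a := 0) (b := 2 * π)
    (f := fun θ => y₁ 0 * y₂ 0 * Qf A B μ y₁ y₂ θ - (-μ * (y₁ 0 * y₂ 0) - A θ * B θ))
    (C := 3 * (2 * (R + M) / N) * M ^ 2 + 4 * |μ| * M ^ 2) (by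
      intro θ _
      exact pointwise_Q hM (h.bA θ) (h.bB θ) hRp.le hN2 hYa hYb
        (hR ▸ hy1.osc h (by linarith) θ) (hR ▸ hy2.osc h (by linarith) θ))
  have hcc : Continuous (fun θ => -μ * (y₁ 0 * y₂ 0) - A θ * B θ) := continuous_const.sub h.cAB
  rw [intervalIntegral.integral_sub ((hQc.intervalIntegrable _ _).const_mul _)
    (hcc.intervalIntegrable _ _),
    intervalIntegral.integral_const_mul, hI,
    intervalIntegral.integral_sub (continuous_const.intervalIntegrable _ _)
    (h.cAB.intervalIntegrable _ _), h.iAB, intervalIntegral.integral_const,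
    Real.norm_eq_abs, sub_zero, abs_of_pos (by positivity : (0:ℝ) < 2 * π), smul_eq_mul] at hb
  generalize y₁ 0 = Y₁ at *
  generalize y₂ 0 = Y₂ at *
  have hYY : N ^ 2 ≤ Y₁ * Y₂ := by
    rw [pow_two]; exact mul_le_mul hYa hYb (by linarith) (by linarith)
  have hYYp : 0 < Y₁ * Y₂ := lt_of_lt_of_le (by nlinarith) hYY
  have e : |Y₁ * Y₂ * 0 - (2 * π * (-μ * (Y₁ * Y₂)) - σ)| = 2 * π * |μ| * (Y₁ * Y₂) + |σ| := by
    have : Y₁ * Y₂ * 0 - (2 * π * (-μ * (Y₁ * Y₂)) - σ) = 2 * π * (Y₁ * Y₂) * μ + σ := by ring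
    rw [this]
    have hpp : 0 < 2 * π * (Y₁ * Y₂) := by positivity
    rcases pos_and_pos_or_neg_and_neg_of_mul_pos hsig with ⟨a, b⟩ | ⟨a, b⟩
    · rw [abs_of_pos (by positivity), abs_of_pos a, abs_of_pos b]; ring
    · rw [abs_of_neg, abs_of_neg a, abs_of_neg b]
      · ring
      · have := mul_neg_of_pos_of_neg hpp a
        linarith
  rw [e] at hb
  have hNp : 0 < N := by linarith
  have h1 : 2 * π * (3 * (2 * (R + M) / N) * M ^ 2) < |σ| := by
    have : 2 * π * (3 * (2 * (R + M) / N) * M ^ 2) = 12 * π * (R + M) * M ^ 2 / N := by ring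
    rw [this, div_lt_iff₀ hNp]
    have : 12 * π * (R + M) * M ^ 2 / |σ| < N := by linarith
    rw [div_lt_iff₀ hσ] at this
    linarith
  have h2 : 2 * π * (4 * |μ| * M ^ 2) ≤ 2 * π * |μ| * (Y₁ * Y₂) := by
    have : 4 * M ^ 2 ≤ Y₁ * Y₂ := le_trans (by nlinarith) hYY
    have := mul_le_mul_of_nonneg_left this (by positivity : 0 ≤ 2 * π * |μ|)
    linarith
  nlinarith

lemma extend_per (h : Ang A B M σ) {μ N : ℝ} {y : ℝ → ℝ} (hN : 2 * M ≤ N)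
    (hd : ∀ θ ∈ Icc 0 (2 * π), HasDerivWithinAt y (Hf A B μ θ (y θ)) (Icc 0 (2 * π)) θ)
    (hl : ∀ θ ∈ Icc 0 (2 * π), N ≤ y θ) (hp : y (2 * π) = y 0) :
    ∃ z, PSol A B μ N z := by
  have hpi := Real.pi_pos
  have hM := h.Mpos
  have hpi2 : (0:ℝ) < 2 * π := by positivity
  have : Fact ((0:ℝ) < 2 * π) := ⟨hpi2⟩
  have hc : ContinuousOn y (Icc 0 (2 * π)) := fun θ hθ => (hd θ hθ).continuousWithinAt
  have hne : ∀ θ ∈ Icc 0 (2 * π), y θ + B θ ≠ 0 := by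
    intro θ hθ
    have h1 := hl θ hθ
    have h2 := abs_le.1 (h.bB θ)
    have : 0 < y θ + B θ := by linarith
    exact this.ne'
  have hco : ContinuousOn (fun θ => Hf A B μ θ (y θ)) (Icc 0 (2 * π)) := by
    unfold Hf
    exact ContinuousOn.div ((continuousOn_const.mul (hc.pow 2)).add
      (h.cA.continuousOn.mul hc)).neg (hc.add h.cB.continuousOn) hne
  have hA0 : A (2 * π) = A 0 := by simpa using h.pA 0
  have hB0 : B (2 * π) = B 0 := by simpa using h.pB 0
  have hg0 : Hf A B μ 0 (y 0) = Hf A B μ (2 * π) (y (2 * π)) := by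
    unfold Hf; rw [hA0, hB0, hp]
  set gl := AddCircle.liftIco (2 * π) 0 (fun θ => Hf A B μ θ (y θ)) with hgl
  have hglc : Continuous gl := AddCircle.liftIco_zero_continuous hg0 hco
  obtain ⟨g, hg⟩ : ∃ g : ℝ → ℝ, g = fun θ : ℝ => gl (θ : AddCircle (2 * π)) := ⟨_, rfl⟩
  have hgc : Continuous g := by rw [hg]; exact hglc.comp (AddCircle.continuous_mk' _)
  have hgp : Function.Periodic g (2 * π) := by
    intro θ; rw [hg]; simp
  have hgeq : ∀ θ ∈ Ico 0 (2 * π), g θ = Hf A B μ θ (y θ) := by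
    intro θ hθ
    rw [hg]
    exact AddCircle.liftIco_zero_coe_apply hθ
  have hgeq' : ∀ θ ∈ Icc 0 (2 * π), g θ = Hf A B μ θ (y θ) := by
    intro θ hθ
    rcases eq_or_lt_of_le hθ.2 with e | e
    · rw [e, ← hg0, ← hgeq 0 ⟨le_rfl, hpi2⟩]
      simpa using hgp 0
    · exact hgeq θ ⟨hθ.1, e⟩
  have hzeq : ∀ x ∈ Icc 0 (2 * π), y 0 + ∫ s in (0:ℝ)..x, g s = y x := by
    intro x hx
    have hsub : Icc 0 x ⊆ Icc 0 (2 * π) := Icc_subset_Icc_right hx.2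
    have := intervalIntegral.integral_eq_sub_of_hasDerivAt_of_le (f := y) (f' := g) hx.1
      (hc.mono hsub) (by
        intro θ hθ
        have hθ' : θ ∈ Icc 0 (2 * π) := hsub (Ioo_subset_Icc_self hθ)
        rw [hgeq' θ hθ']
        exact (hd θ hθ').hasDerivAt (Icc_mem_nhds hθ.1 (hθ.2.trans_le hx.2)))
      (hgc.intervalIntegrable _ _)
    rw [this]; ring
  have hzper : Function.Periodic (fun x => y 0 + ∫ s in (0:ℝ)..x, g s) (2 * π) := by
    intro x
    have h0 := hzeq (2 * π) ⟨hpi2.le, le_rfl⟩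
    rw [hp] at h0
    have h1 : ∫ s in (0:ℝ)..(2 * π), g s = 0 := by linarith
    have := hgp.intervalIntegral_add_eq_add 0 x (fun a b => hgc.intervalIntegrable a b)
    simp only
    rw [this, zero_add, h1, add_zero]
  refine ⟨fun x => y 0 + ∫ s in (0:ℝ)..x, g s, ?_, hzper, ?_⟩
  · intro θ
    have hder : HasDerivAt (fun x => y 0 + ∫ s in (0:ℝ)..x, g s) (g θ) θ :=
      (intervalIntegral.integral_hasDerivAt_right (hgc.intervalIntegrable _ _)
      hgc.aestronglyMeasurable.stronglyMeasurableAtFilter hgc.continuousAt).const_add _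
    refine hder.congr_deriv ?_
    have hpp : Function.Periodic (fun θ => g θ -
        Hf A B μ θ ((fun x => y 0 + ∫ s in (0:ℝ)..x, g s) θ)) (2 * π) := by
      intro θ
      unfold Hf
      simp only
      have e := hzper θ
      simp only at e
      rw [e, hgp, h.pA, h.pB]
    obtain ⟨x, hx, e⟩ := hpp.exists_mem_Ico₀ hpi2 θ
    simp only at e
    rw [hzeq x (Ico_subset_Icc_self hx), hgeq x hx, sub_self] at e
    linarith
  · intro θ
    obtain ⟨x, hx, e⟩ := hzper.exists_mem_Ico₀ hpi2 θ
    rw [e]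
    rw [hzeq x (Ico_subset_Icc_self hx)]
    exact hl x (Ico_subset_Icc_self hx)

lemma Hf_lip (h : Ang A B M σ) {μ θ y₁ y₂ : ℝ} (h1 : 2 * M ≤ y₁) (h2 : 2 * M ≤ y₂) :
    |Hf A B μ θ y₂ - Hf A B μ θ y₁| ≤ (2 * |μ| + 1) * |y₂ - y₁| := by
  have hM := h.Mpos
  have hb := abs_le.1 (h.bB θ)
  have p1 : M ≤ y₁ + B θ := by linarith
  have p2 : M ≤ y₂ + B θ := by linarith
  have := Qf_eq (A := A) (B := B) (μ := μ) (y₁ := fun _ => y₁) (y₂ := fun _ => y₂) (θ := θ)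
    (hM.trans_le p1).ne' (hM.trans_le p2).ne'
  rw [this, abs_mul]
  apply mul_le_mul_of_nonneg_right _ (abs_nonneg _)
  unfold Qf
  refine (abs_sub _ _).trans ?_
  have hab : |A θ * B θ| ≤ M ^ 2 := by
    rw [abs_mul, pow_two]; exact mul_le_mul (h.bA θ) (h.bB θ) (abs_nonneg _) hM.le
  have hbb : |μ * B θ ^ 2| ≤ |μ| * M ^ 2 := by
    rw [abs_mul, abs_of_nonneg (sq_nonneg (B θ)), ← sq_abs (B θ)]
    have := h.bB θ
    gcongr
  have hden : M ^ 2 ≤ (y₁ + B θ) * (y₂ + B θ) := by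
    rw [pow_two]; exact mul_le_mul p1 p2 hM.le (by linarith)
  have hM2 : 0 < M ^ 2 := by positivity
  have : |(A θ * B θ - μ * B θ ^ 2) / ((y₁ + B θ) * (y₂ + B θ))| ≤ 1 + |μ| := by
    rw [abs_div, abs_of_pos (hM2.trans_le hden), div_le_iff₀ (hM2.trans_le hden)]
    have h3 := abs_sub (A θ * B θ) (μ * B θ ^ 2)
    have h4 := mul_le_mul_of_nonneg_left hden (by positivity : 0 ≤ 1 + |μ|)
    linarith
  rw [abs_neg]
  linarith

/-- Existence of a large periodic solution of the scalar equation. -/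
lemma exists_per (h : Ang A B M σ) (N : ℝ) : ∃ ε > 0, ∀ μ, 0 < μ * σ → |μ| < ε →
    ∃ y, PSol A B μ N y := by
  have hpi := Real.pi_pos
  have hM := h.Mpos
  have hpi2 : (0:ℝ) < 2 * π := by positivity
  have hσ : 0 < |σ| := abs_pos.2 h.σne
  obtain ⟨R, hR⟩ : ∃ R, R = 8 * π * M := ⟨_, rfl⟩
  have hRp : 0 < R := by rw [hR]; positivity
  obtain ⟨k1, hk1⟩ : ∃ k1, k1 = R + 2 * M := ⟨_, rfl⟩
  obtain ⟨k2, hk2⟩ : ∃ k2, k2 = 4 * π * M ^ 2 * (R + M) := ⟨_, rfl⟩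
  have hk1p : 0 < k1 := by rw [hk1]; positivity
  have hk2p : 0 < k2 := by rw [hk2]; positivity
  obtain ⟨Z, hZ⟩ : ∃ Z, Z = 4 * |N| + 4 * k1 + |σ| / (π * M) + (3 * k1 * |σ| + 4 * k2) / |σ| :=
    ⟨_, rfl⟩
  have hZ1 : 4 * N ≤ Z := by
    have := le_abs_self N
    have : 0 ≤ |σ| / (π * M) := by positivity
    have : 0 ≤ (3 * k1 * |σ| + 4 * k2) / |σ| := by positivity
    linarith
  have hZ2 : 4 * k1 ≤ Z := by
    have := abs_nonneg N
    have : 0 ≤ |σ| / (π * M) := by positivity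
    have : 0 ≤ (3 * k1 * |σ| + 4 * k2) / |σ| := by positivity
    linarith
  have hZ3 : |σ| / (π * M) ≤ Z := by
    have := abs_nonneg N
    have : 0 ≤ (3 * k1 * |σ| + 4 * k2) / |σ| := by positivity
    linarith
  have hZ4 : (3 * k1 * |σ| + 4 * k2) / |σ| ≤ Z := by
    have := abs_nonneg N
    have : 0 ≤ |σ| / (π * M) := by positivity
    linarith
  have hZp : 0 < Z := by linarith
  refine ⟨|σ| / (2 * π * Z ^ 2), by positivity, ?_⟩
  intro μ hμσ hμ
  have hμ0 : μ ≠ 0 := by rintro rfl; simp at hμσ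
  have hμp : 0 < |μ| := abs_pos.2 hμ0
  obtain ⟨Y, hY⟩ : ∃ Y, Y = Real.sqrt (σ / (2 * π * μ)) := ⟨_, rfl⟩
  have hq : 0 < σ / (2 * π * μ) := by
    have : σ / (2 * π * μ) = (μ * σ) / (2 * π * μ ^ 2) := by field_simp
    rw [this]; positivity
  have hYsq : Y ^ 2 = σ / (2 * π * μ) := by rw [hY]; exact Real.sq_sqrt hq.le
  have hYp : 0 < Y := by rw [hY]; exact Real.sqrt_pos.2 hq
  have hid1 : 2 * π * μ * Y ^ 2 = σ := by rw [hYsq]; field_simp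
  have hid2 : 2 * π * |μ| * Y ^ 2 = |σ| := by
    rw [← hid1, abs_mul, abs_mul, abs_of_pos hpi2, abs_of_pos (by positivity : 0 < Y ^ 2)]
  have hYZ : Z ≤ Y := by
    rw [lt_div_iff₀ (by positivity)] at hμ
    by_contra hc
    have : Y ^ 2 < Z ^ 2 := by
      have := not_le.1 hc
      gcongr
    have := mul_lt_mul_of_pos_left this (by positivity : 0 < 2 * π * |μ|)
    linarith
  have hμY : |μ| * (2 * Y) ≤ M := by
    have h1 : |σ| / (π * M) ≤ Y := hZ3.trans hYZ
    rw [div_le_iff₀ (by positivity), ← hid2] at h1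
    have : (π * Y) * (|μ| * (2 * Y)) ≤ (π * Y) * M := by linarith
    exact le_of_mul_le_mul_left this (by positivity)
  -- the truncated field
  obtain ⟨cl, hcl⟩ : ∃ cl : ℝ → ℝ, cl = fun y => max (Y / 4) (min y (2 * Y)) := ⟨_, rfl⟩
  have hcl1 : ∀ y, Y / 4 ≤ cl y := fun y => by rw [hcl]; exact le_max_left _ _
  have hcl2 : ∀ y, cl y ≤ 2 * Y := fun y => by
    rw [hcl]; exact max_le (by linarith) (min_le_right _ _)
  have hcl3 : ∀ y, Y / 4 ≤ y → y ≤ 2 * Y → cl y = y := fun y h1 h2 => by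
    rw [hcl]; simp only; rw [min_eq_left h2, max_eq_right h1]
  have hcl4 : ∀ x y, |cl x - cl y| ≤ |x - y| := fun x y => by
    rw [hcl]
    simp only
    refine (abs_max_sub_max_le_max _ _ _ _).trans ?_
    rw [sub_self, abs_zero]
    refine max_le (abs_nonneg _) ?_
    refine (abs_min_sub_min_le_max _ _ _ _).trans ?_
    rw [sub_self, abs_zero]
    exact max_le le_rfl (abs_nonneg _)
  have hlow : ∀ y, 2 * M ≤ cl y := fun y => by
    have := hcl1 y
    linarith
  have hHb : ∀ θ y, |Hf A B μ θ (cl y)| ≤ 4 * M := fun θ y =>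
    Hf_bound h (hlow y) ((mul_le_mul_of_nonneg_left (hcl2 y) (abs_nonneg _)).trans hμY)
  have hPL : IsPicardLindelof (fun θ y => Hf A B μ θ (cl y)) (tmin := 0) (tmax := 2 * π)
      (⟨0, le_rfl, hpi2.le⟩ : Icc (0:ℝ) (2 * π)) Y (Real.toNNReal (Y / 2 + R))
      (Real.toNNReal (Y / 2)) (Real.toNNReal (4 * M)) (Real.toNNReal (2 * |μ| + 1)) := by
    constructor
    · intro t _
      apply LipschitzOnWith.of_dist_le_mul
      intro x _ y _
      rw [Real.coe_toNNReal _ (by positivity), Real.dist_eq, Real.dist_eq]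
      refine (Hf_lip h (hlow _) (hlow _)).trans ?_
      exact mul_le_mul_of_nonneg_left (hcl4 _ _) (by positivity)
    · intro x _
      unfold Hf
      have := h.cA
      have := h.cB
      apply Continuous.continuousOn
      refine Continuous.div (by fun_prop) (by fun_prop) ?_
      intro θ
      have h1 := hlow x
      have h2 := abs_le.1 (h.bB θ)
      have : 0 < cl x + B θ := by linarith
      exact this.ne'
    · intro t _ x _
      rw [Real.coe_toNNReal _ (by positivity)]
      exact hHb t x
    · rw [Real.coe_toNNReal _ (by positivity), Real.coe_toNNReal _ (by positivity),
        Real.coe_toNNReal _ (by positivity)]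
      simp only [sub_zero, sub_self]
      rw [max_eq_left hpi2.le, hR]
      linarith
  obtain ⟨α, hα, L', hL'⟩ := hPL.exists_forall_mem_closedBall_eq_hasDerivWithinAt_lipschitzOnWith
  have hball : ∀ x, x ∈ Icc (Y / 2) (3 * Y / 2) →
      x ∈ Metric.closedBall Y (Real.toNNReal (Y / 2)) := by
    intro x hx
    rw [Metric.mem_closedBall, Real.dist_eq, Real.coe_toNNReal _ (by positivity), abs_le]
    constructor <;> linarith [hx.1, hx.2]
  have hbd : ∀ x ∈ Icc (Y / 2) (3 * Y / 2), ∀ θ ∈ Icc 0 (2 * π), |α x θ - x| ≤ R := by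
    intro x hx θ hθ
    obtain ⟨h0, hd⟩ := hα x (hball x hx)
    have := norm_image_sub_le_of_norm_deriv_le_segment' (a := 0) (b := 2 * π) (f := α x)
      (C := 4 * M) hd (fun θ _ => hHb θ _) θ hθ
    simp only at h0
    rw [Real.norm_eq_abs, h0] at this
    have h3 := hθ.2
    rw [hR]
    nlinarith
  have hrange : ∀ x ∈ Icc (Y / 2) (3 * Y / 2), ∀ θ ∈ Icc 0 (2 * π),
      Y / 4 ≤ α x θ ∧ α x θ ≤ 2 * Y := by
    intro x hx θ hθ
    have h1 := abs_le.1 (hbd x hx θ hθ)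
    constructor <;> linarith [hx.1, hx.2]
  have hder : ∀ x ∈ Icc (Y / 2) (3 * Y / 2), ∀ θ ∈ Icc 0 (2 * π),
      HasDerivWithinAt (α x) (Hf A B μ θ (α x θ)) (Icc 0 (2 * π)) θ := by
    intro x hx θ hθ
    have := (hα x (hball x hx)).2 θ hθ
    have hr := hrange x hx θ hθ
    rwa [hcl3 _ hr.1 hr.2] at this
  have hest : ∀ x ∈ Icc (Y / 2) (3 * Y / 2),
      |x * (α x (2 * π) - x) - (σ - 2 * π * μ * x ^ 2)| ≤ |σ| / 2 := by
    intro x hx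
    have hc : ContinuousOn (α x) (Icc 0 (2 * π)) := fun θ hθ =>
      (hder x hx θ hθ).continuousWithinAt
    have hne : ∀ θ ∈ Icc 0 (2 * π), α x θ + B θ ≠ 0 := by
      intro θ hθ
      have h1 := (hrange x hx θ hθ).1
      have h2 := abs_le.1 (h.bB θ)
      have : 0 < α x θ + B θ := by linarith
      exact this.ne'
    have hid := int_identity h hc hne (fun θ hθ =>
      (hder x hx θ (Ioo_subset_Icc_self hθ)).hasDerivAt (Icc_mem_nhds hθ.1 hθ.2))
    have hes := int_est h (μ := μ) hRp.le (Y := x) (by linarith [hx.1]) hc (hbd x hx)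
    have h0 : α x 0 = x := (hα x (hball x hx)).1
    rw [hid, h0] at hes
    refine hes.trans ?_
    have hxp : 0 < x := by linarith [hx.1]
    have e : 2 * π * (|μ| * (R + 2 * M) * x + 2 * M ^ 2 * (R + M) / x) =
      2 * π * |μ| * k1 * x + k2 / x := by rw [hk1, hk2]; ring
    rw [e]
    have a1 : 2 * π * |μ| * k1 * x ≤ 3 * k1 * |σ| / (2 * Y) := by
      rw [le_div_iff₀ (by positivity), ← hid2]
      have := mul_le_mul_of_nonneg_left hx.2 (by positivity : 0 ≤ 2 * π * |μ| * k1 * (2 * Y))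
      linarith
    have a2 : k2 / x ≤ 4 * k2 / (2 * Y) := by
      rw [div_le_div_iff₀ hxp (by positivity)]
      nlinarith [hx.1]
    have a3 : 3 * k1 * |σ| / (2 * Y) + 4 * k2 / (2 * Y) ≤ |σ| / 2 := by
      rw [← add_div, div_le_iff₀ (by positivity)]
      have := hZ4.trans hYZ
      rw [div_le_iff₀ hσ] at this
      linarith
    linarith
  have hcontP : ContinuousOn (fun x => σ * (α x (2 * π) - x)) (Icc (Y / 2) (3 * Y / 2)) := by
    have := (hL' (2 * π) ⟨hpi2.le, le_rfl⟩).continuousOn.mono hball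
    exact continuousOn_const.mul (this.sub continuousOn_id)
  have hσσ : |σ| * |σ| = σ * σ := abs_mul_abs_self σ
  have hkey : ∀ x ∈ Icc (Y / 2) (3 * Y / 2),
      |x * (σ * (α x (2 * π) - x)) - σ * (σ - 2 * π * μ * x ^ 2)| ≤ σ * σ / 2 := by
    intro x hx
    have := mul_le_mul_of_nonneg_left (hest x hx) (abs_nonneg σ)
    rw [← abs_mul] at this
    have e : σ * (x * (α x (2 * π) - x) - (σ - 2 * π * μ * x ^ 2)) =
      x * (σ * (α x (2 * π) - x)) - σ * (σ - 2 * π * μ * x ^ 2) := by ring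
    rw [e] at this
    linarith
  have hσ2 : 0 < σ * σ := hσσ ▸ mul_pos hσ hσ
  have hleft : 0 ≤ σ * (α (Y / 2) (2 * π) - Y / 2) := by
    have hk := abs_le.1 (hkey (Y / 2) ⟨le_rfl, by linarith⟩)
    have e : σ - 2 * π * μ * (Y / 2) ^ 2 = 3 / 4 * σ := by linear_combination (-1/4) * hid1
    rw [e] at hk
    have : 0 ≤ Y / 2 * (σ * (α (Y / 2) (2 * π) - Y / 2)) := by linarith [hk.1]
    exact nonneg_of_mul_nonneg_right this (by positivity)
  have hright : σ * (α (3 * Y / 2) (2 * π) - 3 * Y / 2) ≤ 0 := by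
    have hk := abs_le.1 (hkey (3 * Y / 2) ⟨by linarith, le_rfl⟩)
    have e : σ - 2 * π * μ * (3 * Y / 2) ^ 2 = -(5 / 4) * σ := by
      linear_combination (-9/4) * hid1
    rw [e] at hk
    have : 3 * Y / 2 * (σ * (α (3 * Y / 2) (2 * π) - 3 * Y / 2)) ≤ 0 := by linarith [hk.2]
    by_contra hc
    have := mul_pos (by positivity : 0 < 3 * Y / 2) (not_le.1 hc)
    linarith
  obtain ⟨x, hx, hx0⟩ := intermediate_value_Icc' (by linarith) hcontP ⟨hright, hleft⟩
  simp only at hx0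
  have hfix : α x (2 * π) = x := by
    have := (mul_eq_zero.1 hx0).resolve_left h.σne
    linarith
  have h0 : α x 0 = x := (hα x (hball x hx)).1
  obtain ⟨z, hz⟩ := extend_per h (N := Y / 4) (by linarith) (hder x hx)
    (fun θ hθ => (hrange x hx θ hθ).1) (by rw [hfix, h0])
  exact ⟨z, hz.der, hz.per, fun θ => le_trans (by linarith) (hz.low θ)⟩

lemma exists_inverse {τ g : ℝ → ℝ} {c : ℝ} (hc : 0 < c) (hg : ∀ x, c ≤ g x)
    (hd : ∀ x, HasDerivAt τ (g x) x) :
    ∃ θ : ℝ → ℝ, (∀ t, τ (θ t) = t) ∧ (∀ x, θ (τ x) = x) ∧ ∀ t, HasDerivAt θ (g (θ t))⁻¹ t := by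
  have hcont : Continuous τ := continuous_iff_continuousAt.2 fun x => (hd x).continuousAt
  have hsm : StrictMono τ := strictMono_of_deriv_pos fun x => by
    rw [(hd x).deriv]; exact hc.trans_le (hg x)
  have hmono : Monotone (fun x => τ x - c * x) := by
    have hd' : ∀ x, HasDerivAt (fun x => τ x - c * x) (g x - c) x := fun x => by
      exact ((hd x).sub ((hasDerivAt_id x).const_mul c)).congr_deriv (by ring)
    apply monotone_of_deriv_nonneg (fun x => (hd' x).differentiableAt)
    intro x
    rw [(hd' x).deriv]; linarith [hg x]
  have hsurj : Function.Surjective τ := by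
    apply hcont.surjective
    · apply Filter.tendsto_atTop_mono' _ _
        (Filter.tendsto_atTop_add_const_left _ (τ 0) (Filter.tendsto_id.const_mul_atTop hc))
      filter_upwards [Filter.eventually_ge_atTop 0] with x hx
      have := hmono hx
      simp only at this
      simp only [id]
      linarith
    · apply Filter.tendsto_atBot_mono' _ _
        (Filter.tendsto_atBot_add_const_left _ (τ 0) (Filter.tendsto_id.const_mul_atBot hc))
      filter_upwards [Filter.eventually_le_atBot 0] with x hx
      have := hmono hx
      simp only at this
      simp only [id]
      linarith
  let e := hsm.orderIsoOfSurjective τ hsurj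
  have h1 : ∀ t, τ (e.symm t) = t := fun t => e.apply_symm_apply t
  have h2 : ∀ x, e.symm (τ x) = x := fun x => e.symm_apply_apply x
  refine ⟨e.symm, h1, h2, fun t => ?_⟩
  exact HasDerivAt.of_local_left_inverse e.symm.continuous.continuousAt (hd _)
    (hc.trans_le (hg _)).ne' (Filter.Eventually.of_forall h1)

/-- The planar field in polar form. -/
structure Pol (A B : ℝ → ℝ) (G : ℝ → ℝ × ℝ → ℝ × ℝ) : Prop where
  cG : ∀ μ, Continuous (G μ)
  pol : ∀ μ r θ, 0 < r → G μ (r * cos θ, r * sin θ) =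
    (μ * (r * cos θ) - r * sin θ + r ^ 2 * (A θ * cos θ - B θ * sin θ),
     r * cos θ + μ * (r * sin θ) + r ^ 2 * (A θ * sin θ + B θ * cos θ))

/-- A planar curve parametrised by a scalar profile `y = 1 / r` and a phase. -/
structure Rep (B : ℝ → ℝ) (y θ : ℝ → ℝ) (u : ℝ → ℝ × ℝ) : Prop where
  rep : ∀ t, u t = ((y (θ t))⁻¹ * cos (θ t), (y (θ t))⁻¹ * sin (θ t))
  dθ : ∀ t, HasDerivAt θ (1 + B (θ t) / y (θ t)) t
  surj : Function.Surjective θ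

lemma build {G : ℝ → ℝ × ℝ → ℝ × ℝ} (h : Ang A B M σ) (hG : Pol A B G) {μ N : ℝ} {y : ℝ → ℝ}
    (hN : 2 * M ≤ N) (hy : PSol A B μ N y) :
    ∃ u θ, IsPeriodicSolution2 (G μ) u ∧ Rep B y θ u := by
  have hM := h.Mpos
  have hpi := Real.pi_pos
  have hyp : ∀ θ, 0 < y θ := fun θ => by linarith [hy.low θ]
  have hyb : ∀ θ, 0 < y θ + B θ := fun θ => by
    linarith [hy.low θ, (abs_le.1 (h.bB θ)).1]
  have hcg : Continuous (fun θ => y θ / (y θ + B θ)) :=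
    hy.cont.div (hy.cont.add h.cB) (fun θ => (hyb θ).ne')
  have hτ : ∀ x, HasDerivAt (fun x => ∫ s in (0:ℝ)..x, y s / (y s + B s)) (y x / (y x + B x)) x :=
    fun x => intervalIntegral.integral_hasDerivAt_right (hcg.intervalIntegrable _ _)
      hcg.aestronglyMeasurable.stronglyMeasurableAtFilter hcg.continuousAt
  have hlow : ∀ x, (1 / 2 : ℝ) ≤ y x / (y x + B x) := fun x => by
    rw [div_le_div_iff₀ (by norm_num) (hyb x)]
    linarith [hy.low x, (abs_le.1 (h.bB x)).2]
  obtain ⟨θ, h1, h2, h3⟩ := exists_inverse (by norm_num) hlow hτ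
  have hdθ : ∀ t, HasDerivAt θ (1 + B (θ t) / y (θ t)) t := fun t => by
    refine (h3 t).congr_deriv ?_
    have := hyp (θ t)
    have := hyb (θ t)
    field_simp
  have hdy : ∀ t, HasDerivAt (fun t => (y (θ t))⁻¹)
      (-(Hf A B μ (θ t) (y (θ t)) * (1 + B (θ t) / y (θ t))) / (y (θ t)) ^ 2) t := fun t =>
    ((hy.der (θ t)).comp t (hdθ t)).inv (hyp _).ne'
  refine ⟨fun t => ((y (θ t))⁻¹ * cos (θ t), (y (θ t))⁻¹ * sin (θ t)), θ, ⟨?_, ?_, ?_⟩,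
    fun t => rfl, hdθ, fun x => ⟨_, h2 x⟩⟩
  · intro t
    simp only
    rw [hG.pol μ _ _ (inv_pos.2 (hyp _))]
    have d1 := (hdy t).mul ((hdθ t).cos)
    have d2 := (hdy t).mul ((hdθ t).sin)
    refine HasDerivAt.prodMk (d1.congr_deriv ?_) (d2.congr_deriv ?_)
    · have := (hyp (θ t)).ne'
      have := (hyb (θ t)).ne'
      unfold Hf
      field_simp
      ring
    · have := (hyp (θ t)).ne'
      have := (hyb (θ t)).ne'
      unfold Hf
      field_simp
      ring
  · have hgp : Function.Periodic (fun θ => y θ / (y θ + B θ)) (2 * π) := fun x => by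
      simp only [hy.per x, h.pB x]
    have hadd : ∀ x, ∫ s in (0:ℝ)..(x + 2 * π), y s / (y s + B s) =
        (∫ s in (0:ℝ)..x, y s / (y s + B s)) + ∫ s in (0:ℝ)..(2 * π), y s / (y s + B s) := by
      intro x
      have := hgp.intervalIntegral_add_eq_add 0 x (fun a b => hcg.intervalIntegrable a b)
      simpa using this
    refine ⟨∫ s in (0:ℝ)..(2 * π), y s / (y s + B s), ?_, ?_⟩
    · apply intervalIntegral.intervalIntegral_pos_of_pos (hcg.intervalIntegrable _ _)
      · intro x; exact div_pos (hyp x) (hyb x)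
      · positivity
    · intro t
      have : θ (t + ∫ s in (0:ℝ)..(2 * π), y s / (y s + B s)) = θ t + 2 * π := by
        have e := hadd (θ t)
        rw [h1 t] at e
        rw [← e]
        exact h2 _
      simp only
      rw [this, hy.per, cos_add_two_pi, sin_add_two_pi]
  · intro hcst
    obtain ⟨t0, ht0⟩ : ∃ t, θ t = 0 := ⟨_, h2 0⟩
    obtain ⟨t1, ht1⟩ : ∃ t, θ t = π := ⟨_, h2 π⟩
    have e := (hcst t0).trans (hcst t1).symm
    simp only [ht0, ht1, Prod.mk.injEq, cos_zero, cos_pi] at e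
    have a := inv_pos.2 (hyp 0)
    have b := inv_pos.2 (hyp π)
    linarith [e.1]

lemma norm_le_ampl {F : ℝ × ℝ → ℝ × ℝ} {u : ℝ → ℝ × ℝ} (hu : IsPeriodicSolution2 F u) (t : ℝ) :
    Real.sqrt ((u t).1 ^ 2 + (u t).2 ^ 2) ≤ ampl2 u := by
  have hc : Continuous u := continuous_iff_continuousAt.2 fun t => (hu.1 t).continuousAt
  obtain ⟨T, hT, hper⟩ := hu.2.1
  have hc' : Continuous (fun t => Real.sqrt ((u t).1 ^ 2 + (u t).2 ^ 2)) := by fun_prop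
  have hp' : Function.Periodic (fun t => Real.sqrt ((u t).1 ^ 2 + (u t).2 ^ 2)) T := fun t => by
    simp only [hper t]
  exact le_ciSup (hp'.compact_of_continuous hT.ne' hc').bddAbove t

lemma Rep.norm_eq {y θ : ℝ → ℝ} {u : ℝ → ℝ × ℝ} (hr : Rep B y θ u) (hy : ∀ x, 0 < y x) (t : ℝ) :
    Real.sqrt ((u t).1 ^ 2 + (u t).2 ^ 2) = (y (θ t))⁻¹ := by
  rw [hr.rep t]
  simp only
  have : ((y (θ t))⁻¹ * cos (θ t)) ^ 2 + ((y (θ t))⁻¹ * sin (θ t)) ^ 2 = ((y (θ t))⁻¹) ^ 2 := by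
    linear_combination ((y (θ t))⁻¹) ^ 2 * sin_sq_add_cos_sq (θ t)
  rw [this, Real.sqrt_sq (inv_pos.2 (hy _)).le]

lemma Rep.unique (h : Ang A B M σ) {μ N : ℝ} {y : ℝ → ℝ} (hN : 2 * M ≤ N) (hy : PSol A B μ N y)
    {θ₁ θ₂ : ℝ → ℝ} {u₁ u₂ : ℝ → ℝ × ℝ} (r1 : Rep B y θ₁ u₁) (r2 : Rep B y θ₂ u₂) :
    ∃ s : ℝ, ∀ t, u₂ t = u₁ (t + s) := by
  have hM := h.Mpos
  have hyp : ∀ θ, 0 < y θ := fun θ => by linarith [hy.low θ]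
  have hyb : ∀ θ, 0 < y θ + B θ := fun θ => by
    linarith [hy.low θ, (abs_le.1 (h.bB θ)).1]
  have hcg : Continuous (fun θ => y θ / (y θ + B θ)) :=
    hy.cont.div (hy.cont.add h.cB) (fun θ => (hyb θ).ne')
  obtain ⟨τ, hτdef⟩ : ∃ τ : ℝ → ℝ, τ = fun x => ∫ s in (0:ℝ)..x, y s / (y s + B s) := ⟨_, rfl⟩
  have hτ : ∀ x, HasDerivAt τ (y x / (y x + B x)) x := by
    rw [hτdef]
    exact fun x => intervalIntegral.integral_hasDerivAt_right (hcg.intervalIntegrable _ _)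
      hcg.aestronglyMeasurable.stronglyMeasurableAtFilter hcg.continuousAt
  have hinj : Function.Injective τ := (strictMono_of_deriv_pos fun x => by
    rw [(hτ x).deriv]; exact div_pos (hyp x) (hyb x)).injective
  have key : ∀ {θ : ℝ → ℝ} {u : ℝ → ℝ × ℝ}, Rep B y θ u → ∀ t, τ (θ t) = t + τ (θ 0) := by
    intro θ u r t
    have hd : ∀ t, HasDerivAt (fun t => τ (θ t) - t) 0 t := by
      intro t
      refine (((hτ (θ t)).comp t (r.dθ t)).sub (hasDerivAt_id t)).congr_deriv ?_
      have := (hyp (θ t)).ne'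
      have := (hyb (θ t)).ne'
      field_simp
      ring
    have := is_const_of_deriv_eq_zero (fun t => (hd t).differentiableAt) (fun t => (hd t).deriv) t 0
    linarith
  obtain ⟨s, hs⟩ := r1.surj (θ₂ 0)
  refine ⟨s, fun t => ?_⟩
  have : θ₂ t = θ₁ (t + s) := by
    apply hinj
    rw [key r2 t, key r1 (t + s), ← hs, key r1 s]
    ring
  rw [r1.rep, r2.rep, this]

lemma exists_polar (p : ℝ × ℝ) (hp : p ≠ 0) : ∃ r θ, 0 < r ∧ p = (r * cos θ, r * sin θ) := by
  refine ⟨‖(⟨p.1, p.2⟩ : ℂ)‖, Complex.arg ⟨p.1, p.2⟩, ?_, ?_⟩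
  · rw [norm_pos_iff]
    intro h
    apply hp
    have h1 := congrArg Complex.re h
    have h2 := congrArg Complex.im h
    simp only [Complex.zero_re, Complex.zero_im] at h1 h2
    exact Prod.ext h1 h2
  · rw [Complex.norm_mul_cos_arg, Complex.norm_mul_sin_arg]

/-- Components of derivatives. -/
lemma hasDerivAt_fst {u : ℝ → ℝ × ℝ} {d : ℝ × ℝ} {t : ℝ} (h : HasDerivAt u d t) :
    HasDerivAt (fun t => (u t).1) d.1 t :=
  (ContinuousLinearMap.fst ℝ ℝ ℝ).hasFDerivAt.comp_hasDerivAt t h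

lemma hasDerivAt_snd {u : ℝ → ℝ × ℝ} {d : ℝ × ℝ} {t : ℝ} (h : HasDerivAt u d t) :
    HasDerivAt (fun t => (u t).2) d.2 t :=
  (ContinuousLinearMap.snd ℝ ℝ ℝ).hasFDerivAt.comp_hasDerivAt t h

lemma ne_zero_of_per {G : ℝ → ℝ × ℝ → ℝ × ℝ} (h : Ang A B M σ) (hG : Pol A B G) {μ δ : ℝ}
    {u : ℝ → ℝ × ℝ} (hu : IsPeriodicSolution2 (G μ) u)
    (hδ : ∀ t, Real.sqrt ((u t).1 ^ 2 + (u t).2 ^ 2) ≤ δ) (t : ℝ) : u t ≠ 0 := by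
  have hM := h.Mpos
  obtain ⟨K, hK⟩ : ∃ K, K = 2 * (|μ| + M * δ) := ⟨_, rfl⟩
  obtain ⟨ρ, hρ⟩ : ∃ ρ : ℝ → ℝ, ρ = fun t => (u t).1 ^ 2 + (u t).2 ^ 2 := ⟨_, rfl⟩
  obtain ⟨ρ', hρ'⟩ : ∃ ρ' : ℝ → ℝ, ρ' = fun t => 2 * (u t).1 * (G μ (u t)).1 +
    2 * (u t).2 * (G μ (u t)).2 := ⟨_, rfl⟩
  have hd : ∀ t, HasDerivAt ρ (ρ' t) t := by
    intro t
    rw [hρ, hρ']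
    refine (((hasDerivAt_fst (hu.1 t)).pow 2).add ((hasDerivAt_snd (hu.1 t)).pow 2)).congr_deriv ?_
    simp
  have hb : ∀ t, |ρ' t| ≤ K * ρ t := by
    intro t
    by_cases h0 : u t = 0
    · rw [hρ', hρ]; simp [h0]
    obtain ⟨r, θ, hr, e⟩ := exists_polar (u t) h0
    have hrδ : r ≤ δ := by
      have := hδ t
      rw [e] at this
      simp only at this
      have e2 : (r * cos θ) ^ 2 + (r * sin θ) ^ 2 = r ^ 2 := by
        linear_combination r ^ 2 * sin_sq_add_cos_sq θ
      rwa [e2, Real.sqrt_sq hr.le] at this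
    have e1 : ρ' t = 2 * (μ + r * A θ) * r ^ 2 := by
      rw [hρ']
      simp only
      rw [e, hG.pol μ r θ hr]
      simp only
      linear_combination (2 * r ^ 2 * μ + 2 * r ^ 3 * A θ) * sin_sq_add_cos_sq θ
    have e2 : ρ t = r ^ 2 := by
      rw [hρ]
      simp only
      rw [e]
      simp only
      linear_combination r ^ 2 * sin_sq_add_cos_sq θ
    rw [e1, e2, abs_mul, abs_of_pos (by positivity : 0 < r ^ 2), hK, abs_mul, abs_two]
    have : |μ + r * A θ| ≤ |μ| + M * δ := by
      refine (abs_add_le _ _).trans (add_le_add le_rfl ?_)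
      rw [abs_mul, abs_of_pos hr, mul_comm]
      exact mul_le_mul (h.bA θ) hrδ hr.le hM.le
    gcongr
  have hexp : ∀ c : ℝ, ∀ t, HasDerivAt (fun t => ρ t * Real.exp (c * t))
      ((ρ' t + c * ρ t) * Real.exp (c * t)) t := by
    intro c t
    refine ((hd t).mul ((hasDerivAt_id t).const_mul c).exp).congr_deriv ?_
    simp only [id]
    ring
  have hmono : Monotone (fun t => ρ t * Real.exp (K * t)) := by
    apply monotone_of_deriv_nonneg (fun t => (hexp K t).differentiableAt)
    intro t
    rw [(hexp K t).deriv]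
    exact mul_nonneg (by linarith [(abs_le.1 (hb t)).1]) (Real.exp_pos _).le
  have hanti : Antitone (fun t => ρ t * Real.exp (-K * t)) := by
    apply antitone_of_deriv_nonpos (fun t => (hexp (-K) t).differentiableAt)
    intro t
    rw [(hexp (-K) t).deriv]
    exact mul_nonpos_of_nonpos_of_nonneg (by linarith [(abs_le.1 (hb t)).2]) (Real.exp_pos _).le
  intro h0
  have hρ0 : ρ t = 0 := by rw [hρ]; simp [h0]
  have hall : ∀ s, u s = 0 := by
    intro s
    have hs : ρ s ≤ 0 := by
      rcases le_total s t with hst | hst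
      · have := hmono hst
        simp only [hρ0, zero_mul] at this
        exact nonpos_of_mul_nonpos_left this (Real.exp_pos _)
      · have := hanti hst
        simp only [hρ0, zero_mul] at this
        exact nonpos_of_mul_nonpos_left this (Real.exp_pos _)
    rw [hρ] at hs
    simp only at hs
    have a1 : (u s).1 ^ 2 = 0 := by nlinarith [sq_nonneg (u s).1, sq_nonneg (u s).2]
    have a2 : (u s).2 ^ 2 = 0 := by nlinarith [sq_nonneg (u s).1, sq_nonneg (u s).2]
    exact Prod.ext (pow_eq_zero_iff (two_ne_zero) |>.1 a1) (pow_eq_zero_iff (two_ne_zero) |>.1 a2)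
  exact hu.2.2 fun s => by rw [hall s, hall 0]

/-- Polar lift of a nonvanishing solution. -/
lemma polar_lift {G : ℝ → ℝ × ℝ → ℝ × ℝ} (hG : Pol A B G) {μ : ℝ}
    {u : ℝ → ℝ × ℝ} (hu : IsSolution2 (G μ) u) (h0 : ∀ t, u t ≠ 0) :
    ∃ x θ : ℝ → ℝ, (∀ t, u t = (Real.exp (x t) * cos (θ t), Real.exp (x t) * sin (θ t))) ∧
      (∀ t, HasDerivAt x (μ + Real.exp (x t) * A (θ t)) t) ∧
      (∀ t, HasDerivAt θ (1 + Real.exp (x t) * B (θ t)) t) := by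
  have hcu : Continuous u := continuous_iff_continuousAt.2 fun t => (hu t).continuousAt
  obtain ⟨z, hz⟩ : ∃ z : ℝ → ℂ, z = fun t => ((u t).1 : ℂ) + ((u t).2 : ℂ) * Complex.I :=
    ⟨_, rfl⟩
  obtain ⟨z', hz'⟩ : ∃ z' : ℝ → ℂ, z' = fun t =>
    ((G μ (u t)).1 : ℂ) + ((G μ (u t)).2 : ℂ) * Complex.I := ⟨_, rfl⟩
  have hdz : ∀ t, HasDerivAt z (z' t) t := by
    intro t
    rw [hz, hz']
    exact (hasDerivAt_fst (hu t)).ofReal_comp.add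
      ((hasDerivAt_snd (hu t)).ofReal_comp.mul_const Complex.I)
  have hzc : Continuous z := continuous_iff_continuousAt.2 fun t => (hdz t).continuousAt
  have hGc := hG.cG μ
  have hz'c : Continuous z' := by
    rw [hz']
    fun_prop
  have hz0 : ∀ t, z t ≠ 0 := by
    intro t e
    apply h0 t
    rw [hz] at e
    have h1 := congrArg Complex.re e
    have h2 := congrArg Complex.im e
    simp at h1 h2
    exact Prod.ext h1 h2
  have hq : Continuous (fun t => z' t / z t) := hz'c.div hzc hz0
  obtain ⟨Lg, hL⟩ : ∃ Lg : ℝ → ℂ, Lg = fun t => Complex.log (z 0) + ∫ s in (0:ℝ)..t, z' s / z s :=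
    ⟨_, rfl⟩
  have hdL : ∀ t, HasDerivAt Lg (z' t / z t) t := by
    intro t
    rw [hL]
    exact (intervalIntegral.integral_hasDerivAt_right (hq.intervalIntegrable _ _)
      hq.aestronglyMeasurable.stronglyMeasurableAtFilter hq.continuousAt).const_add _
  have hzL : ∀ t, z t = Complex.exp (Lg t) := by
    intro t
    have hd : ∀ t, HasDerivAt (fun t => z t * Complex.exp (-Lg t)) 0 t := by
      intro t
      refine ((hdz t).mul (hdL t).neg.cexp).congr_deriv ?_
      have := hz0 t
      simp only [Pi.neg_apply]
      field_simp
      ring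
    have := is_const_of_deriv_eq_zero (fun t => (hd t).differentiableAt) (fun t => (hd t).deriv) t 0
    have e0 : Lg 0 = Complex.log (z 0) := by rw [hL]; simp
    rw [e0, Complex.exp_neg, Complex.exp_neg, Complex.exp_log (hz0 0),
      mul_inv_cancel₀ (hz0 0)] at this
    exact (mul_inv_eq_one₀ (Complex.exp_ne_zero _)).1 this
  have hrep : ∀ t, u t = (Real.exp (Lg t).re * cos (Lg t).im, Real.exp (Lg t).re * sin (Lg t).im) := by
    intro t
    have e := hzL t
    have h1 := congrArg Complex.re e
    have h2 := congrArg Complex.im e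
    rw [Complex.exp_re, hz] at h1
    rw [Complex.exp_im, hz] at h2
    simp at h1 h2
    exact Prod.ext h1 h2
  have hquot : ∀ t, z' t / z t = ((μ + Real.exp (Lg t).re * A (Lg t).im : ℝ) : ℂ) +
      ((1 + Real.exp (Lg t).re * B (Lg t).im : ℝ) : ℂ) * Complex.I := by
    intro t
    rw [div_eq_iff (hz0 t), hz', hz]
    simp only
    rw [hrep t, hG.pol μ _ _ (Real.exp_pos _)]
    apply Complex.ext
    · simp only [Complex.add_re, Complex.mul_re, Complex.add_im, Complex.mul_im, Complex.ofReal_re,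
        Complex.ofReal_im, Complex.I_re, Complex.I_im]
      ring
    · simp only [Complex.add_re, Complex.mul_re, Complex.add_im, Complex.mul_im, Complex.ofReal_re,
        Complex.ofReal_im, Complex.I_re, Complex.I_im]
      ring
  refine ⟨fun t => (Lg t).re, fun t => (Lg t).im, hrep, fun t => ?_, fun t => ?_⟩
  · have := Complex.reCLM.hasFDerivAt.comp_hasDerivAt t (hdL t)
    refine this.congr_deriv ?_
    rw [hquot t]
    simp only [Complex.reCLM_apply, Complex.imCLM_apply, Complex.add_re, Complex.mul_re,
      Complex.add_im, Complex.mul_im, Complex.ofReal_re, Complex.ofReal_im, Complex.I_re,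
      Complex.I_im]
    ring
  · have := Complex.imCLM.hasFDerivAt.comp_hasDerivAt t (hdL t)
    refine this.congr_deriv ?_
    rw [hquot t]
    simp only [Complex.reCLM_apply, Complex.imCLM_apply, Complex.add_re, Complex.mul_re,
      Complex.add_im, Complex.mul_im, Complex.ofReal_re, Complex.ofReal_im, Complex.I_re,
      Complex.I_im]
    ring

lemma lift {G : ℝ → ℝ × ℝ → ℝ × ℝ} (h : Ang A B M σ) (hG : Pol A B G) {μ N : ℝ}
    (hN : 2 * M ≤ N) {u : ℝ → ℝ × ℝ} (hu : IsPeriodicSolution2 (G μ) u) (ha : ampl2 u < N⁻¹) :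
    ∃ y θ, PSol A B μ N y ∧ Rep B y θ u := by
  have hM := h.Mpos
  have hpi := Real.pi_pos
  have hNp : 0 < N := by linarith
  have hδ : ∀ t, Real.sqrt ((u t).1 ^ 2 + (u t).2 ^ 2) ≤ N⁻¹ := fun t =>
    (norm_le_ampl hu t).trans ha.le
  obtain ⟨x, θ, hrep, hdx, hdθ⟩ := polar_lift hG hu.1 (ne_zero_of_per h hG hu hδ)
  have hxN : ∀ t, Real.exp (x t) ≤ N⁻¹ := by
    intro t
    have := hδ t
    rw [hrep t] at this
    simp only at this
    have e2 : (Real.exp (x t) * cos (θ t)) ^ 2 + (Real.exp (x t) * sin (θ t)) ^ 2 =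
        Real.exp (x t) ^ 2 := by
      linear_combination Real.exp (x t) ^ 2 * sin_sq_add_cos_sq (θ t)
    rwa [e2, Real.sqrt_sq (Real.exp_pos _).le] at this
  have hgl : ∀ t, (1 / 2 : ℝ) ≤ 1 + Real.exp (x t) * B (θ t) := by
    intro t
    have h1 : |Real.exp (x t) * B (θ t)| ≤ N⁻¹ * M := by
      rw [abs_mul, abs_of_pos (Real.exp_pos _)]
      exact mul_le_mul (hxN t) (h.bB _) (abs_nonneg _) (by positivity)
    have h2 : N⁻¹ * M ≤ 1 / 2 := by
      rw [inv_mul_eq_div, div_le_div_iff₀ hNp (by norm_num)]; linarith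
    linarith [(abs_le.1 h1).1]
  obtain ⟨τ, h1, h2, h3⟩ := exists_inverse (by norm_num) hgl hdθ
  obtain ⟨y, hy⟩ : ∃ y : ℝ → ℝ, y = fun φ => Real.exp (-x (τ φ)) := ⟨_, rfl⟩
  have hyθ : ∀ t, y (θ t) = Real.exp (-x t) := fun t => by rw [hy]; simp only; rw [h2]
  have hyinv : ∀ t, (y (θ t))⁻¹ = Real.exp (x t) := fun t => by
    rw [hyθ, Real.exp_neg, inv_inv]
  have hder : ∀ φ, HasDerivAt y (Hf A B μ φ (y φ)) φ := by
    intro φ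
    have := ((hdx (τ φ)).comp φ (h3 φ)).neg.exp
    have e : y = fun φ => Real.exp ((-(x ∘ τ)) φ) := by rw [hy]; rfl
    rw [e]
    refine this.congr_deriv ?_
    simp only [Pi.neg_apply, Function.comp]
    rw [h1]
    unfold Hf
    have hp := hgl (τ φ)
    rw [h1] at hp
    rw [Real.exp_neg]
    have hE := Real.exp_pos (x (τ φ))
    generalize Real.exp (x (τ φ)) = E at *
    have hne : 1 + E * B φ ≠ 0 := by linarith
    have hne2 : E⁻¹ + B φ ≠ 0 := by
      intro hc
      apply hne
      have : E * (E⁻¹ + B φ) = 1 + E * B φ := by field_simp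
      rw [← this, hc, mul_zero]
    field_simp
  have hlow : ∀ φ, N ≤ y φ := by
    intro φ
    rw [hy]
    simp only
    rw [Real.exp_neg]
    exact (le_inv_comm₀ hNp (Real.exp_pos _)).2 (hxN _)
  -- periodicity
  obtain ⟨T, hT, hper⟩ := hu.2.1
  have hsm : StrictMono θ := strictMono_of_deriv_pos fun t => by
    rw [(hdθ t).deriv]; linarith [hgl t]
  have hcs : x T = x 0 ∧ ∃ k : ℕ, 0 < k ∧ θ T = θ 0 + k * (2 * π) := by
    have e := hper 0
    rw [zero_add, hrep T, hrep 0] at e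
    have e1 := congrArg Prod.fst e
    have e2 := congrArg Prod.snd e
    simp only at e1 e2
    have hxx : Real.exp (x T) = Real.exp (x 0) := by
      have s1 : Real.exp (x T) ^ 2 = Real.exp (x 0) ^ 2 := by
        have a1 : (Real.exp (x T) * cos (θ T)) ^ 2 + (Real.exp (x T) * sin (θ T)) ^ 2 =
          Real.exp (x T) ^ 2 := by
          linear_combination Real.exp (x T) ^ 2 * sin_sq_add_cos_sq (θ T)
        have a2 : (Real.exp (x 0) * cos (θ 0)) ^ 2 + (Real.exp (x 0) * sin (θ 0)) ^ 2 =
          Real.exp (x 0) ^ 2 := by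
          linear_combination Real.exp (x 0) ^ 2 * sin_sq_add_cos_sq (θ 0)
        rw [← a1, ← a2, e1, e2]
      exact (pow_left_inj₀ (Real.exp_pos _).le (Real.exp_pos _).le two_ne_zero).1 s1
    refine ⟨Real.exp_injective hxx, ?_⟩
    rw [hxx] at e1 e2
    have c1 := mul_left_cancel₀ (Real.exp_pos _).ne' e1
    have c2 := mul_left_cancel₀ (Real.exp_pos _).ne' e2
    have c3 : ((θ T : ℝ) : Real.Angle) = ((θ 0 : ℝ) : Real.Angle) :=
      Real.Angle.cos_sin_inj c1 c2
    obtain ⟨k, hk⟩ := Real.Angle.angle_eq_iff_two_pi_dvd_sub.1 c3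
    have hpos : θ 0 < θ T := hsm hT
    have hkp : 0 < k := by
      have : (0:ℝ) < k := by
        by_contra hc
        have : 2 * π * k ≤ 0 := mul_nonpos_of_nonneg_of_nonpos (by positivity) (not_lt.1 hc)
        linarith
      exact_mod_cast this
    lift k to ℕ using hkp.le
    refine ⟨k, by exact_mod_cast hkp, ?_⟩
    push_cast at hk
    linarith
  obtain ⟨hxT, k, hk, hθT⟩ := hcs
  have hyk : y (θ 0 + k * (2 * π)) = y (θ 0) := by
    rw [← hθT, hyθ, hyθ, hxT]
  have hder2 : ∀ φ, HasDerivAt (fun φ => y (φ + 2 * π)) (Hf A B μ φ (y (φ + 2 * π))) φ := by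
    intro φ
    refine ((hder (φ + 2 * π)).comp_add_const φ (2 * π)).congr_deriv ?_
    unfold Hf
    rw [h.pA, h.pB]
  obtain ⟨-, hdiff⟩ := diff_eq h hN hder hder2 hlow (fun φ => hlow _)
  have hzero : y (0 + 2 * π) - y 0 = 0 := by
    have tele : ∀ n : ℕ, y (θ 0 + n * (2 * π)) - y (θ 0) =
        ∑ i ∈ Finset.range n, (y (θ 0 + i * (2 * π) + 2 * π) - y (θ 0 + i * (2 * π))) := by
      intro n
      have := Finset.sum_range_sub (fun i : ℕ => y (θ 0 + i * (2 * π))) n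
      simp only [Nat.cast_zero, zero_mul, add_zero] at this
      rw [← this]
      apply Finset.sum_congr rfl
      intro i _
      congr 2
      push_cast
      ring
    have t := tele k
    rw [hyk, sub_self] at t
    rw [Finset.sum_congr rfl (fun (i : ℕ) _ => hdiff (θ 0 + i * (2 * π)))] at t
    rw [← Finset.mul_sum] at t
    have hs : 0 < ∑ i ∈ Finset.range k, Real.exp (∫ s in (0:ℝ)..(θ 0 + i * (2 * π)),
        Qf A B μ y (fun φ => y (φ + 2 * π)) s) :=
      Finset.sum_pos (fun i _ => Real.exp_pos _) (Finset.nonempty_range_iff.2 hk.ne')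
    exact (mul_eq_zero.1 t.symm).resolve_right hs.ne'
  have hyper : Function.Periodic y (2 * π) := by
    intro φ
    have := hdiff φ
    rw [hzero, zero_mul] at this
    linarith
  refine ⟨y, θ, ⟨hder, hyper, hlow⟩, fun t => ?_, fun t => ?_, fun φ => ⟨_, h1 φ⟩⟩
  · rw [hyinv, hrep t]
  · refine (hdθ t).congr_deriv ?_
    rw [div_eq_mul_inv, hyinv]
    ring

lemma ampl_est {μ Y K : ℝ} (hσ : σ ≠ 0) (hY : 0 < Y) (hK : 0 < K) (hμ : 0 < μ * σ)
    (h1 : |σ - 2 * π * μ * Y ^ 2| ≤ K / Y) (h2 : |σ - 2 * π * μ * Y ^ 2| ≤ |σ| / 2) :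
    |Y⁻¹ - Real.sqrt (2 * π * μ / σ)| ≤ K / |σ| * Y⁻¹ ^ 2 ∧ Y⁻¹ ^ 2 ≤ 4 * π / |σ| * |μ| := by
  have hpi := Real.pi_pos
  have hs : 0 < |σ| := abs_pos.2 hσ
  obtain ⟨q, hq⟩ : ∃ q, q = 2 * π * μ / σ := ⟨_, rfl⟩
  have hqa : q = 2 * π / |σ| * |μ| := by
    have hms : μ / σ = |μ| / |σ| := by
      rw [← abs_div, abs_of_pos]
      have : μ / σ = μ * σ / σ ^ 2 := by field_simp
      rw [this]; positivity
    rw [hq, mul_div_assoc, hms]; ring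
  have hqp : 0 ≤ q := by rw [hqa]; positivity
  have e : σ - 2 * π * μ * Y ^ 2 = σ * (1 - q * Y ^ 2) := by rw [hq]; field_simp
  rw [e, abs_mul] at h1 h2
  have h3 : |1 - q * Y ^ 2| ≤ 1 / 2 := by
    by_contra hc
    nlinarith [not_le.1 hc]
  have h4 : |1 - q * Y ^ 2| ≤ K / |σ| * Y⁻¹ := by
    rw [div_mul_eq_mul_div, le_div_iff₀ hs, ← div_eq_mul_inv]; linarith
  obtain ⟨r, hr⟩ : ∃ r, r = Y⁻¹ := ⟨_, rfl⟩
  have hrp : 0 < r := by rw [hr]; positivity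
  have hrY : r * Y = 1 := by rw [hr]; field_simp
  rw [← hq, ← hr]
  rw [← hr] at h4
  have e2 : r ^ 2 - q = r ^ 2 * (1 - q * Y ^ 2) := by
    linear_combination q * (r * Y + 1) * hrY
  constructor
  · have hsq := Real.sq_sqrt hqp
    have hsn := Real.sqrt_nonneg q
    generalize Real.sqrt q = r0 at *
    have e3 : (r - r0) * (r + r0) = r ^ 2 * (1 - q * Y ^ 2) := by rw [← e2, ← hsq]; ring
    have e4 : |r - r0| * (r + r0) ≤ r ^ 2 * (K / |σ| * r) := by
      have : |r - r0| * (r + r0) = r ^ 2 * |1 - q * Y ^ 2| := by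
        rw [← abs_of_pos (by positivity : 0 < r + r0), ← abs_mul, e3, abs_mul, 
          abs_of_pos (by positivity : 0 < r ^ 2)]
      rw [this]
      exact mul_le_mul_of_nonneg_left h4 (by positivity)
    have e5 : |r - r0| * r ≤ K / |σ| * r ^ 2 * r := by
      nlinarith [mul_nonneg (abs_nonneg (r - r0)) hsn]
    exact le_of_mul_le_mul_right e5 hrp
  · have : r ^ 2 * (1 - q * Y ^ 2) ≤ r ^ 2 * (1 / 2) :=
      mul_le_mul_of_nonneg_left (le_trans (le_abs_self _) h3) (by positivity)
    have e6 : 4 * π / |σ| * |μ| = 2 * q := by rw [hqa]; ring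
    rw [e6]; linarith

theorem core {G : ℝ → ℝ × ℝ → ℝ × ℝ} (h : Ang A B M σ) (hG : Pol A B G) :
    ∃ ε > 0, ∃ δ > 0, ∃ C > 0, ∀ μ : ℝ, |μ| < ε →
      ((0 < μ * σ →
        ∃ u : ℝ → ℝ × ℝ, IsPeriodicSolution2 (G μ) u ∧
          0 < ampl2 u ∧ ampl2 u < δ ∧
          |ampl2 u - Real.sqrt (2 * π * μ / σ)| ≤ C * |μ|) ∧
       (∀ u₁ u₂ : ℝ → ℝ × ℝ,
          IsPeriodicSolution2 (G μ) u₁ → IsPeriodicSolution2 (G μ) u₂ →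
          ampl2 u₁ < δ → ampl2 u₂ < δ →
          ∃ s : ℝ, ∀ t, u₂ t = u₁ (t + s)) ∧
       (μ * σ < 0 →
        ¬ ∃ u : ℝ → ℝ × ℝ, IsPeriodicSolution2 (G μ) u ∧ ampl2 u < δ)) := by
  have hpi := Real.pi_pos
  have hM := h.Mpos
  have hs : 0 < |σ| := abs_pos.2 h.σne
  obtain ⟨N, K, hK, hN, hN1, hest, huniq⟩ := per_unique h
  have hMN : 2 * M ≤ N := by nlinarith [mul_pos hpi hM]
  have hRN : 2 * (8 * π * M) ≤ N := by linarith
  obtain ⟨ε, hε, hex⟩ := exists_per h (2 * N)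
  have hNp : 0 < N := by linarith
  obtain ⟨R, hR⟩ : ∃ R, R = 8 * π * M := ⟨_, rfl⟩
  have hRp : 0 < R := by rw [hR]; positivity
  refine ⟨ε, hε, N⁻¹, by positivity, (K / |σ| + 2 * R) * (4 * π / |σ|), by positivity,
    fun μ hμ => ⟨fun hpos => ?_, fun u₁ u₂ hu1 hu2 ha1 ha2 => ?_, ?_⟩⟩
  · obtain ⟨y, hy2⟩ := hex μ hpos hμ
    have hy : PSol A B μ N y := ⟨hy2.der, hy2.per, fun θ => by linarith [hy2.low θ]⟩
    obtain ⟨u, θ, hu, hrep⟩ := build h hG hMN hy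
    have hyp : ∀ x, 0 < y x := fun x => by linarith [hy.low x]
    have hnorm := hrep.norm_eq hyp
    have hpos1 : 0 < ampl2 u := lt_of_lt_of_le (by rw [hnorm 0]; exact inv_pos.2 (hyp _))
      (norm_le_ampl hu 0)
    have hle : ampl2 u ≤ (2 * N)⁻¹ := by
      unfold ampl2
      refine ciSup_le fun t => ?_
      rw [hnorm t]
      exact inv_anti₀ (by positivity) (hy2.low _)
    refine ⟨u, hu, hpos1, lt_of_le_of_lt hle (inv_strictAnti₀ hNp (by linarith)), ?_⟩
    obtain ⟨h1, h2⟩ := hest μ y hy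
    obtain ⟨f1, f2⟩ := ampl_est h.σne (hyp 0) hK hpos h1 h2
    have hosc := PSol.osc h hMN hy
    rw [← hR] at hosc
    have hinv : ∀ x, |(y x)⁻¹ - (y 0)⁻¹| ≤ 2 * R * (y 0)⁻¹ ^ 2 := by
      intro x
      have hx := hyp x
      have h0 := hyp 0
      have hh : y 0 / 2 ≤ y x := by
        have := (abs_le.1 (hosc x)).1
        have := hy.low 0
        linarith
      have e : (y x)⁻¹ - (y 0)⁻¹ = -(y x - y 0) * ((y x)⁻¹ * (y 0)⁻¹) := by
        field_simp; ring
      rw [e, abs_mul, abs_neg, abs_of_pos (by positivity : 0 < (y x)⁻¹ * (y 0)⁻¹)]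
      have h5 : (y x)⁻¹ ≤ 2 * (y 0)⁻¹ := by
        have := inv_anti₀ (by positivity) hh
        rwa [inv_div, div_eq_mul_inv] at this
      calc |y x - y 0| * ((y x)⁻¹ * (y 0)⁻¹) ≤ R * ((2 * (y 0)⁻¹) * (y 0)⁻¹) := by
            apply mul_le_mul (hosc x) _ (by positivity) hRp.le
            exact mul_le_mul_of_nonneg_right h5 (by positivity)
        _ = _ := by ring
    have hA : |ampl2 u - (y 0)⁻¹| ≤ 2 * R * (y 0)⁻¹ ^ 2 := by
      rw [abs_le]
      constructor
      · have a1 := norm_le_ampl hu 0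
        rw [hnorm 0] at a1
        linarith [(abs_le.1 (hinv (θ 0))).1]
      · have : ampl2 u ≤ (y 0)⁻¹ + 2 * R * (y 0)⁻¹ ^ 2 := by
          unfold ampl2
          refine ciSup_le fun t => ?_
          rw [hnorm t]
          linarith [(abs_le.1 (hinv (θ t))).2]
        linarith
    calc |ampl2 u - Real.sqrt (2 * π * μ / σ)|
        ≤ |ampl2 u - (y 0)⁻¹| + |(y 0)⁻¹ - Real.sqrt (2 * π * μ / σ)| := abs_sub_le _ _ _
      _ ≤ (K / |σ| + 2 * R) * (y 0)⁻¹ ^ 2 := by linarith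
      _ ≤ (K / |σ| + 2 * R) * (4 * π / |σ| * |μ|) :=
          mul_le_mul_of_nonneg_left f2 (by positivity)
      _ = _ := by ring
  · obtain ⟨y1, θ1, p1, r1⟩ := lift h hG hMN hu1 ha1
    obtain ⟨y2, θ2, p2, r2⟩ := lift h hG hMN hu2 ha2
    have e := huniq μ y1 y2 p1 p2
    subst e
    exact Rep.unique h hMN p1 r1 r2
  · rintro hneg ⟨u, hu, ha⟩
    obtain ⟨y, θ, p, -⟩ := lift h hG hMN hu ha
    have := same_sign h.σne (by linarith [p.low 0] : 0 < y 0) (hest μ y p).2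
    linarith

lemma quarter {g : ℝ → ℝ} (hg : Continuous g) :
    ∫ θ in (0:ℝ)..(2 * π), g θ = ∫ θ in (0:ℝ)..(π / 2),
      (g θ + g (θ + π / 2) + g (θ + π) + g (θ + 3 * π / 2)) := by
  have ii : ∀ a b, IntervalIntegrable g MeasureTheory.volume a b := fun a b => hg.intervalIntegrable a b
  have i0 : IntervalIntegrable (fun θ => g θ) MeasureTheory.volume 0 (π / 2) := ii _ _
  have i1 : IntervalIntegrable (fun θ => g (θ + π / 2)) MeasureTheory.volume 0 (π / 2) :=
    (by fun_prop : Continuous fun θ => g (θ + π / 2)).intervalIntegrable _ _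
  have i2 : IntervalIntegrable (fun θ => g (θ + π)) MeasureTheory.volume 0 (π / 2) :=
    (by fun_prop : Continuous fun θ => g (θ + π)).intervalIntegrable _ _
  have i3 : IntervalIntegrable (fun θ => g (θ + 3 * π / 2)) MeasureTheory.volume 0 (π / 2) :=
    (by fun_prop : Continuous fun θ => g (θ + 3 * π / 2)).intervalIntegrable _ _
  rw [intervalIntegral.integral_add ((i0.add i1).add i2) i3,
    intervalIntegral.integral_add (i0.add i1) i2, intervalIntegral.integral_add i0 i1,
    intervalIntegral.integral_comp_add_right, intervalIntegral.integral_comp_add_right,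
    intervalIntegral.integral_comp_add_right]
  have e1 : π / 2 + π / 2 = π := by ring
  have e2 : π / 2 + π = 3 * π / 2 := by ring
  have e3 : π / 2 + 3 * π / 2 = 2 * π := by ring
  rw [e1, e2, e3, zero_add, zero_add, zero_add,
    intervalIntegral.integral_add_adjacent_intervals (ii _ _) (ii _ _),
    intervalIntegral.integral_add_adjacent_intervals (ii _ _) (ii _ _),
    intervalIntegral.integral_add_adjacent_intervals (ii _ _) (ii _ _)]

/-- Cubic trigonometric polynomials on a quarter period. -/
lemma cubic_int (k0 k1 k2 k3 : ℝ) :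
    ∫ θ in (0:ℝ)..(π / 2), (k0 * cos θ ^ 3 + k1 * (cos θ ^ 2 * sin θ) + k2 * (cos θ * sin θ ^ 2)
      + k3 * sin θ ^ 3) = 2 / 3 * k0 + 1 / 3 * k1 + 1 / 3 * k2 + 2 / 3 * k3 := by
  have hd : ∀ θ ∈ uIcc (0:ℝ) (π / 2), HasDerivAt (fun θ => k0 * (sin θ - sin θ ^ 3 / 3)
      + k1 * (-cos θ ^ 3 / 3) + k2 * (sin θ ^ 3 / 3) + k3 * (-cos θ + cos θ ^ 3 / 3))
      (k0 * cos θ ^ 3 + k1 * (cos θ ^ 2 * sin θ) + k2 * (cos θ * sin θ ^ 2)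
      + k3 * sin θ ^ 3) θ := by
    intro θ _
    have hs := hasDerivAt_sin θ
    have hc := hasDerivAt_cos θ
    have hs3 := hs.pow 3
    have hc3 := hc.pow 3
    refine (((((hs.sub (hs3.div_const 3)).const_mul k0).add ((hc3.neg.div_const 3).const_mul k1)).add
      ((hs3.div_const 3).const_mul k2)).add ((hc.neg.add (hc3.div_const 3)).const_mul k3)).congr_deriv ?_
    have e := sin_sq_add_cos_sq θ
    push_cast
    linear_combination (k0 * cos θ * (-1) - k3 * sin θ) * e
  rw [intervalIntegral.integral_eq_sub_of_hasDerivAt hd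
    (Continuous.intervalIntegrable (by fun_prop) _ _)]
  simp
  ring

/-- Sextic trigonometric polynomials on a quarter period. -/
lemma sextic_int (k0 k1 k2 k3 k4 k5 k6 : ℝ) :
    ∫ θ in (0:ℝ)..(π / 2), (k0 * cos θ ^ 6 + k1 * (cos θ ^ 5 * sin θ) + k2 * (cos θ ^ 4 * sin θ ^ 2)
      + k3 * (cos θ ^ 3 * sin θ ^ 3) + k4 * (cos θ ^ 2 * sin θ ^ 4) + k5 * (cos θ * sin θ ^ 5)
      + k6 * sin θ ^ 6) = π / 32 * (5 * k0 + k2 + k4 + 5 * k6) + 1 / 6 * k1 + 1 / 12 * k3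
      + 1 / 6 * k5 := by
  have hd : ∀ θ ∈ uIcc (0:ℝ) (π / 2), HasDerivAt (fun θ =>
      k0 * (5 / 16 * θ + cos θ ^ 5 * sin θ / 6 + 5 / 24 * (cos θ ^ 3 * sin θ)
        + 5 / 16 * (cos θ * sin θ))
      + k1 * (-cos θ ^ 6 / 6)
      + k2 * (θ / 16 - cos θ ^ 5 * sin θ / 6 + 1 / 24 * (cos θ ^ 3 * sin θ)
        + 1 / 16 * (cos θ * sin θ))
      + k3 * (sin θ ^ 4 / 4 - sin θ ^ 6 / 6)
      + k4 * (θ / 16 + sin θ ^ 5 * cos θ / 6 - 1 / 24 * (sin θ ^ 3 * cos θ)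
        - 1 / 16 * (cos θ * sin θ))
      + k5 * (sin θ ^ 6 / 6)
      + k6 * (5 / 16 * θ - sin θ ^ 5 * cos θ / 6 - 5 / 24 * (sin θ ^ 3 * cos θ)
        - 5 / 16 * (cos θ * sin θ)))
      (k0 * cos θ ^ 6 + k1 * (cos θ ^ 5 * sin θ) + k2 * (cos θ ^ 4 * sin θ ^ 2)
      + k3 * (cos θ ^ 3 * sin θ ^ 3) + k4 * (cos θ ^ 2 * sin θ ^ 4) + k5 * (cos θ * sin θ ^ 5)
      + k6 * sin θ ^ 6) θ := by
    intro θ _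
    have hs := hasDerivAt_sin θ
    have hc := hasDerivAt_cos θ
    have hi := hasDerivAt_id' θ
    have s4 := hs.pow 4
    have s6 := hs.pow 6
    have c6 := hc.pow 6
    have m1 := hc.mul hs
    have m3 := (hc.pow 3).mul hs
    have m5 := (hc.pow 5).mul hs
    have n3 := (hs.pow 3).mul hc
    have n5 := (hs.pow 5).mul hc
    refine ((((((((((hi.const_mul (5 / 16)).add (m5.div_const 6)).add (m3.const_mul (5 / 24))).add
      (m1.const_mul (5 / 16))).const_mul k0).add ((c6.neg.div_const 6).const_mul k1)).add
      (((((hi.div_const 16).sub (m5.div_const 6)).add (m3.const_mul (1 / 24))).add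
      (m1.const_mul (1 / 16))).const_mul k2)).add
      (((s4.div_const 4).sub (s6.div_const 6)).const_mul k3)).add
      (((((hi.div_const 16).add (n5.div_const 6)).sub (n3.const_mul (1 / 24))).sub
      (m1.const_mul (1 / 16))).const_mul k4)).add ((s6.div_const 6).const_mul k5)).add
      (((((hi.const_mul (5 / 16)).sub (n5.div_const 6)).sub (n3.const_mul (5 / 24))).sub
      (m1.const_mul (5 / 16))).const_mul k6) |>.congr_deriv ?_
    have e : sin θ ^ 2 = 1 - cos θ ^ 2 := by linarith [sin_sq_add_cos_sq θ]
    have e3 : sin θ ^ 3 = sin θ * (1 - cos θ ^ 2) := by rw [← e]; ring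
    have e4 : sin θ ^ 4 = (1 - cos θ ^ 2) ^ 2 := by rw [← e]; ring
    have e5 : sin θ ^ 5 = sin θ * (1 - cos θ ^ 2) ^ 2 := by rw [← e]; ring
    have e6 : sin θ ^ 6 = (1 - cos θ ^ 2) ^ 3 := by rw [← e]; ring
    push_cast
    simp only [Pi.pow_apply]
    ring_nf
    simp only [e, e3, e4, e5, e6]
    ring
  rw [intervalIntegral.integral_eq_sub_of_hasDerivAt hd
    (Continuous.intervalIntegrable (by fun_prop) _ _)]
  simp
  ring

/-- Radial angular coefficient. -/
noncomputable def Af (a11 a12 a21 a22 b11 b12 b21 b22 θ : ℝ) : ℝ :=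
  cos θ * (a11 * cos θ * |cos θ| + a12 * cos θ * |sin θ| + a21 * sin θ * |cos θ|
    + a22 * sin θ * |sin θ|)
  + sin θ * (b11 * cos θ * |cos θ| + b12 * cos θ * |sin θ| + b21 * sin θ * |cos θ|
    + b22 * sin θ * |sin θ|)

/-- Azimuthal angular coefficient. -/
noncomputable def Bf (a11 a12 a21 a22 b11 b12 b21 b22 θ : ℝ) : ℝ :=
  cos θ * (b11 * cos θ * |cos θ| + b12 * cos θ * |sin θ| + b21 * sin θ * |cos θ|
    + b22 * sin θ * |sin θ|)
  - sin θ * (a11 * cos θ * |cos θ| + a12 * cos θ * |sin θ| + a21 * sin θ * |cos θ|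
    + a22 * sin θ * |sin θ|)

section
variable (a11 a12 a21 a22 b11 b12 b21 b22 : ℝ)

lemma Af_cont : Continuous (Af a11 a12 a21 a22 b11 b12 b21 b22) := by
  unfold Af; fun_prop

lemma Bf_cont : Continuous (Bf a11 a12 a21 a22 b11 b12 b21 b22) := by
  unfold Bf; fun_prop

lemma shift3 (θ : ℝ) : cos (θ + 3 * π / 2) = sin θ ∧ sin (θ + 3 * π / 2) = -cos θ := by
  have e : θ + 3 * π / 2 = (θ + π / 2) + π := by ring
  rw [e, cos_add_pi, sin_add_pi, cos_add_pi_div_two, sin_add_pi_div_two, neg_neg]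
  exact ⟨rfl, rfl⟩

lemma Af_int (h0 : 2 * a11 + a12 + b21 + 2 * b22 = 0) :
    ∫ θ in (0:ℝ)..(2 * π), Af a11 a12 a21 a22 b11 b12 b21 b22 θ = 0 := by
  rw [quarter (Af_cont _ _ _ _ _ _ _ _)]
  have := cubic_int (2 * a11 + 2 * b22) (2 * (a12 + b21 + a21 - a22 + b11 - b12)) (2 * (a12 + b21 - a21 + a22 - b11 + b12))
    (2 * a11 + 2 * b22)
  rw [intervalIntegral.integral_congr (g := fun θ => (2 * a11 + 2 * b22) * cos θ ^ 3
    + (2 * (a12 + b21 + a21 - a22 + b11 - b12)) * (cos θ ^ 2 * sin θ)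
    + (2 * (a12 + b21 - a21 + a22 - b11 + b12)) * (cos θ * sin θ ^ 2)
    + (2 * a11 + 2 * b22) * sin θ ^ 3), this]
  · linear_combination 4 / 3 * h0
  · intro θ hθ
    rw [uIcc_of_le (by positivity)] at hθ
    have hs : 0 ≤ sin θ := sin_nonneg_of_nonneg_of_le_pi hθ.1 (by linarith [hθ.2, Real.pi_pos])
    have hc : 0 ≤ cos θ := cos_nonneg_of_neg_pi_div_two_le_of_le
      (by linarith [hθ.1, Real.pi_pos]) hθ.2
    simp only [Af, cos_add_pi, sin_add_pi, cos_add_pi_div_two, sin_add_pi_div_two,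
      (shift3 θ).1, (shift3 θ).2, abs_neg, abs_of_nonneg hs, abs_of_nonneg hc]
    ring

lemma AB_int :
    ∫ θ in (0:ℝ)..(2 * π), Af a11 a12 a21 a22 b11 b12 b21 b22 θ *
      Bf a11 a12 a21 a22 b11 b12 b21 b22 θ =
      1 / 3 * (b12 * a11 - b21 * a22 - a21 * b22 + a12 * b11
        - 2 * a11 * a22 - 2 * a12 * a21 + 2 * b12 * b21 + 2 * b11 * b22)
      + π / 4 * (b12 * b22 - a12 * a22 - a11 * a21 + b21 * b11
        + 2 * a11 * b11 - 2 * b22 * a22) := by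
  rw [quarter (g := fun θ => Af a11 a12 a21 a22 b11 b12 b21 b22 θ *
    Bf a11 a12 a21 a22 b11 b12 b21 b22 θ)
    ((Af_cont a11 a12 a21 a22 b11 b12 b21 b22).mul (Bf_cont a11 a12 a21 a22 b11 b12 b21 b22))]
  have := sextic_int
    (2 * (a11 * b11 + b22 * (-a22)))
    (2 * (a11 * (b12 + b21 - a11) + (a12 + a21 + b11) * b11 + b22 * (a12 - a21 - b22) + (b21 - b12 - a22) * (-a22)))
    (2 * (a11 * (b22 - a12 - a21) + (a12 + a21 + b11) * (b12 + b21 - a11) + (a22 + b12 + b21) * b11 + b22 * (a11 - b21 + b12) + (b21 - b12 - a22) * (a12 - a21 - b22) + (a12 - a21 - b11) * (-a22)))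
    (2 * (a11 * (-a22) + (a12 + a21 + b11) * (b22 - a12 - a21) + (a22 + b12 + b21) * (b12 + b21 - a11) + b22 * b11 + b22 * b11 + (b21 - b12 - a22) * (a11 - b21 + b12) + (a12 - a21 - b11) * (a12 - a21 - b22) + a11 * (-a22)))
    (2 * ((a12 + a21 + b11) * (-a22) + (a22 + b12 + b21) * (b22 - a12 - a21) + b22 * (b12 + b21 - a11) + (b21 - b12 - a22) * b11 + (a12 - a21 - b11) * (a11 - b21 + b12) + a11 * (a12 - a21 - b22)))
    (2 * ((a22 + b12 + b21) * (-a22) + b22 * (b22 - a12 - a21) + (a12 - a21 - b11) * b11 + a11 * (a11 - b21 + b12)))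
    (2 * (b22 * (-a22) + a11 * b11))
  rw [intervalIntegral.integral_congr (g := fun θ =>
    (2 * (a11 * b11 + b22 * (-a22))) * cos θ ^ 6
    + (2 * (a11 * (b12 + b21 - a11) + (a12 + a21 + b11) * b11 + b22 * (a12 - a21 - b22) + (b21 - b12 - a22) * (-a22))) * (cos θ ^ 5 * sin θ)
    + (2 * (a11 * (b22 - a12 - a21) + (a12 + a21 + b11) * (b12 + b21 - a11) + (a22 + b12 + b21) * b11 + b22 * (a11 - b21 + b12) + (b21 - b12 - a22) * (a12 - a21 - b22) + (a12 - a21 - b11) * (-a22))) * (cos θ ^ 4 * sin θ ^ 2)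
    + (2 * (a11 * (-a22) + (a12 + a21 + b11) * (b22 - a12 - a21) + (a22 + b12 + b21) * (b12 + b21 - a11) + b22 * b11 + b22 * b11 + (b21 - b12 - a22) * (a11 - b21 + b12) + (a12 - a21 - b11) * (a12 - a21 - b22) + a11 * (-a22))) * (cos θ ^ 3 * sin θ ^ 3)
    + (2 * ((a12 + a21 + b11) * (-a22) + (a22 + b12 + b21) * (b22 - a12 - a21) + b22 * (b12 + b21 - a11) + (b21 - b12 - a22) * b11 + (a12 - a21 - b11) * (a11 - b21 + b12) + a11 * (a12 - a21 - b22))) * (cos θ ^ 2 * sin θ ^ 4)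
    + (2 * ((a22 + b12 + b21) * (-a22) + b22 * (b22 - a12 - a21) + (a12 - a21 - b11) * b11 + a11 * (a11 - b21 + b12))) * (cos θ * sin θ ^ 5)
    + (2 * (b22 * (-a22) + a11 * b11)) * sin θ ^ 6), this]
  · ring
  · intro θ hθ
    rw [uIcc_of_le (by positivity)] at hθ
    have hs : 0 ≤ sin θ := sin_nonneg_of_nonneg_of_le_pi hθ.1 (by linarith [hθ.2, Real.pi_pos])
    have hc : 0 ≤ cos θ := cos_nonneg_of_neg_pi_div_two_le_of_le
      (by linarith [hθ.1, Real.pi_pos]) hθ.2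
    simp only [Af, Bf, cos_add_pi, sin_add_pi, cos_add_pi_div_two, sin_add_pi_div_two,
      (shift3 θ).1, (shift3 θ).2, abs_neg, abs_of_nonneg hs, abs_of_nonneg hc]
    ring

lemma Af_per : Function.Periodic (Af a11 a12 a21 a22 b11 b12 b21 b22) (2 * π) := fun θ => by
  simp only [Af, cos_add_two_pi, sin_add_two_pi]

lemma Bf_per : Function.Periodic (Bf a11 a12 a21 a22 b11 b12 b21 b22) (2 * π) := fun θ => by
  simp only [Bf, cos_add_two_pi, sin_add_two_pi]

end

lemma exists_bd {g : ℝ → ℝ} (hc : Continuous g) (hp : Function.Periodic g (2 * π)) :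
    ∃ m, ∀ θ, |g θ| ≤ m := by
  obtain ⟨m, hm⟩ := (hp.compact_of_continuous (by positivity) hc).isBounded.exists_norm_le
  exact ⟨m, fun θ => by simpa using hm _ (mem_range_self θ)⟩

lemma rescale {F : ℝ × ℝ → ℝ × ℝ} {u : ℝ → ℝ × ℝ} {k : ℝ} (hk : k ≠ 0)
    (hu : IsPeriodicSolution2 F u) :
    IsPeriodicSolution2 (fun p => k • F p) (fun t => u (k * t)) := by
  obtain ⟨hs, ⟨T, hT, hper⟩, hn⟩ := hu
  refine ⟨fun t => ?_, ⟨T / |k|, div_pos hT (abs_pos.2 hk), fun t => ?_⟩, fun hc => hn fun t => ?_⟩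
  · exact (hs (k * t)).scomp t (by simpa using (hasDerivAt_id' t).const_mul k)
  · simp only
    rcases lt_or_gt_of_ne hk with h | h
    · rw [abs_of_neg h, ← hper (k * (t + T / -k))]
      congr 1
      field_simp
      ring
    · rw [abs_of_pos h, ← hper (k * t)]
      congr 1
      field_simp
  · have := hc (t / k)
    simp only [mul_zero] at this
    rwa [mul_div_cancel₀ _ hk] at this

lemma ampl_rescale (u : ℝ → ℝ × ℝ) {k : ℝ} (hk : k ≠ 0) : ampl2 (fun t => u (k * t)) = ampl2 u := by
  unfold ampl2
  exact (mul_left_surjective₀ hk).iSup_comp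
    (g := fun t => Real.sqrt ((u t).1 ^ 2 + (u t).2 ^ 2))

end DegHopf

/-- Degenerate Hopf bifurcation for the planar system (P) with second-order
modulus nonlinearities in the case `σ_# = 0`, `σ₂ ≠ 0`: for all small `μ ≠ 0` with
`μωσ₂ > 0` there is a nonconstant periodic solution of amplitude
`√(2πωμ/σ₂) + O(μ)`, unique up to time translation among small periodic solutions, and
for `μωσ₂ < 0` there is none; the bifurcation is subcritical iff `ωσ₂ < 0`. -/
theorem stmt6 (ω : ℝ) (hω : ω ≠ 0)
    (a11 a12 a21 a22 b11 b12 b21 b22 : ℝ)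
    (hσ0 : 2 * a11 + a12 + b21 + 2 * b22 = 0)
    (σ₂ : ℝ)
    (hσ₂def : σ₂ = 1 / 3 * (b12 * a11 - b21 * a22 - a21 * b22 + a12 * b11
        - 2 * a11 * a22 - 2 * a12 * a21 + 2 * b12 * b21 + 2 * b11 * b22)
      + π / 4 * (b12 * b22 - a12 * a22 - a11 * a21 + b21 * b11
        + 2 * a11 * b11 - 2 * b22 * a22))
    (hσ₂ : σ₂ ≠ 0)
    (F : ℝ → ℝ × ℝ → ℝ × ℝ)
    (hF : ∀ μ p, F μ p =
      (μ * p.1 - ω * p.2 +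
        (a11 * p.1 * |p.1| + a12 * p.1 * |p.2| + a21 * p.2 * |p.1| + a22 * p.2 * |p.2|),
       ω * p.1 + μ * p.2 +
        (b11 * p.1 * |p.1| + b12 * p.1 * |p.2| + b21 * p.2 * |p.1| + b22 * p.2 * |p.2|))) :
    ∃ ε > 0, ∃ δ > 0, ∃ C > 0, ∀ μ : ℝ, 0 < |μ| → |μ| < ε →
      ((0 < μ * ω * σ₂ →
        ∃ u : ℝ → ℝ × ℝ, IsPeriodicSolution2 (F μ) u ∧
          0 < ampl2 u ∧ ampl2 u < δ ∧
          |ampl2 u - Real.sqrt (2 * π * ω * μ / σ₂)| ≤ C * |μ|) ∧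
       (∀ u₁ u₂ : ℝ → ℝ × ℝ,
          IsPeriodicSolution2 (F μ) u₁ → IsPeriodicSolution2 (F μ) u₂ →
          ampl2 u₁ < δ → ampl2 u₂ < δ →
          ∃ s : ℝ, ∀ t, u₂ t = u₁ (t + s)) ∧
       (μ * ω * σ₂ < 0 →
        ¬ ∃ u : ℝ → ℝ × ℝ, IsPeriodicSolution2 (F μ) u ∧ ampl2 u < δ)) := by
  have hA := DegHopf.Af_cont (a11 / ω) (a12 / ω) (a21 / ω) (a22 / ω) (b11 / ω) (b12 / ω) (b21 / ω) (b22 / ω)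
  have hB := DegHopf.Bf_cont (a11 / ω) (a12 / ω) (a21 / ω) (a22 / ω) (b11 / ω) (b12 / ω) (b21 / ω)
    (b22 / ω)
  have pA := DegHopf.Af_per (a11 / ω) (a12 / ω) (a21 / ω) (a22 / ω) (b11 / ω) (b12 / ω) (b21 / ω)
    (b22 / ω)
  have pB := DegHopf.Bf_per (a11 / ω) (a12 / ω) (a21 / ω) (a22 / ω) (b11 / ω) (b12 / ω) (b21 / ω)
    (b22 / ω)
  have iA := DegHopf.Af_int (a11 / ω) (a12 / ω) (a21 / ω) (a22 / ω) (b11 / ω) (b12 / ω) (b21 / ω)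
    (b22 / ω) (by linear_combination hσ0 / ω)
  have iAB := DegHopf.AB_int (a11 / ω) (a12 / ω) (a21 / ω) (a22 / ω) (b11 / ω) (b12 / ω) (b21 / ω)
    (b22 / ω)
  obtain ⟨m1, hm1⟩ := DegHopf.exists_bd hA pA
  obtain ⟨m2, hm2⟩ := DegHopf.exists_bd hB pB
  have hm1p := (abs_nonneg _).trans (hm1 0)
  have hm2p := (abs_nonneg _).trans (hm2 0)
  have hang : DegHopf.Ang
      (DegHopf.Af (a11 / ω) (a12 / ω) (a21 / ω) (a22 / ω) (b11 / ω) (b12 / ω) (b21 / ω) (b22 / ω))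
      (DegHopf.Bf (a11 / ω) (a12 / ω) (a21 / ω) (a22 / ω) (b11 / ω) (b12 / ω) (b21 / ω) (b22 / ω))
      (m1 + m2 + 1) (σ₂ / ω ^ 2) := by
    refine ⟨hA, hB, pA, pB, by linarith, fun θ => by linarith [hm1 θ], fun θ => by linarith [hm2 θ],
      iA, ?_, by positivity⟩
    rw [iAB, hσ₂def]
    field_simp
  have hpol : DegHopf.Pol
      (DegHopf.Af (a11 / ω) (a12 / ω) (a21 / ω) (a22 / ω) (b11 / ω) (b12 / ω) (b21 / ω) (b22 / ω))
      (DegHopf.Bf (a11 / ω) (a12 / ω) (a21 / ω) (a22 / ω) (b11 / ω) (b12 / ω) (b21 / ω) (b22 / ω))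
      (fun ν p => ω⁻¹ • F (ω * ν) p) := by
    refine ⟨fun ν => ?_, fun ν r θ hr => ?_⟩
    · have : F (ω * ν) = fun p => F (ω * ν) p := rfl
      simp only [hF]
      fun_prop
    · rw [hF]
      simp only [abs_mul, abs_of_pos hr, DegHopf.Af, DegHopf.Bf, Prod.smul_mk, smul_eq_mul]
      have e := sin_sq_add_cos_sq θ
      have e' : sin θ ^ 2 = 1 - cos θ ^ 2 := by linarith
      generalize |cos θ| = ac
      generalize |sin θ| = as
      generalize cos θ = c at *
      generalize sin θ = s at *
      apply Prod.ext
      · simp only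
        field_simp
        linear_combination (-r * (a11 * c * ac + a12 * c * as + a21 * s * ac + a22 * s * as)) * e
      · simp only
        field_simp
        linear_combination (-r * (b11 * c * ac + b12 * c * as + b21 * s * ac + b22 * s * as)) * e
  obtain ⟨ε, hε, δ, hδ, C, hC, H⟩ := DegHopf.core hang hpol
  have hω' : 0 < |ω| := abs_pos.2 hω
  have key1 : ∀ μ u, IsPeriodicSolution2 (F μ) u →
      IsPeriodicSolution2 (fun p => ω⁻¹ • F (ω * (μ / ω)) p) (fun t => u (ω⁻¹ * t)) := by
    intro μ u hu
    rw [mul_div_cancel₀ _ hω]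
    exact DegHopf.rescale (inv_ne_zero hω) hu
  refine ⟨|ω| * ε, by positivity, δ, hδ, C / |ω|, by positivity, fun μ _ hμ => ?_⟩
  have hμ' : |μ / ω| < ε := by rw [abs_div, div_lt_iff₀ hω']; linarith
  obtain ⟨H1, H2, H3⟩ := H (μ / ω) hμ'
  have hsg : μ / ω * (σ₂ / ω ^ 2) = μ * ω * σ₂ * (ω ^ 4)⁻¹ := by field_simp
  have h4 : 0 < (ω ^ 4)⁻¹ := by positivity
  refine ⟨fun hp => ?_, fun u₁ u₂ hu1 hu2 ha1 ha2 => ?_, ?_⟩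
  · obtain ⟨u, hu, hu0, hud, hest⟩ := H1 (by rw [hsg]; exact mul_pos hp h4)
    refine ⟨fun t => u (ω * t), ?_, ?_, ?_, ?_⟩
    · have := DegHopf.rescale hω hu
      simpa only [smul_smul, mul_inv_cancel₀ hω, one_smul, mul_div_cancel₀ _ hω] using this
    · rwa [DegHopf.ampl_rescale _ hω]
    · rwa [DegHopf.ampl_rescale _ hω]
    · rw [DegHopf.ampl_rescale _ hω]
      have e1 : 2 * π * ω * μ / σ₂ = 2 * π * (μ / ω) / (σ₂ / ω ^ 2) := by field_simp
      rw [e1]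
      refine hest.trans (le_of_eq ?_)
      rw [abs_div]
      ring
  · obtain ⟨s, hs⟩ := H2 _ _ (key1 μ u₁ hu1) (key1 μ u₂ hu2)
      (by rwa [DegHopf.ampl_rescale _ (inv_ne_zero hω)])
      (by rwa [DegHopf.ampl_rescale _ (inv_ne_zero hω)])
    refine ⟨ω⁻¹ * s, fun t => ?_⟩
    have := hs (ω * t)
    rwa [mul_add, inv_mul_cancel_left₀ hω] at this
  · rintro hn ⟨u, hu, ha⟩
    refine H3 (by rw [hsg]; exact mul_neg_of_neg_of_pos hn h4) ⟨_, key1 μ u hu, ?_⟩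
    rwa [DegHopf.ampl_rescale _ (inv_ne_zero hω)]
end

section
/- Consider the planar system (Pg): v' = μv − ωw + f(v,w;α), w' = ωv + μw + g(v,w;β) with generalized-slope non-smooth nonlinearities, and assume σ̃_# := a₁₁(α₁₊ − α₁₋) + (1/2)a₁₂(α₂₊ − α₂₋) + (1/2)b₂₁(β₃₊ − β₃₋) + b₂₂(β₄₊ − β₄₋) ≠ 0. Then there exist ε, δ, C > 0 such that for every μ with 0 < |μ| < ε: (i) if μ·σ̃_# < 0, the system (Pg) has a nonconstant periodic solution (v,w) : ℝ → ℝ² with 0 < sup_t √(v(t)² + w(t)²) < δ and |sup_t √(v(t)² + w(t)²) + 3πμ/(2σ̃_#)| ≤ C·μ²; any two nonconstant periodic solutions with supremum norm less than δ coincide up to a time translation; (ii) if μ·σ̃_# > 0, there is no nonconstant periodic solution with supremum norm less than δ. The bifurcation is subcritical if σ̃_# > 0 and supercritical if σ̃_# < 0. -/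
open Real Set

/-- The generalized absolute value `[x]_{p₋}^{p₊}`: slope `p₊` for `x ≥ 0`, slope `p₋` for `x < 0`. -/
noncomputable def genAbs (pm pp x : ℝ) : ℝ := if 0 ≤ x then pp * x else pm * x

theorem aux_crit_max (h h' : ℝ → ℝ) (T : ℝ) (hT : 0 < T) (hd : ∀ t, HasDerivAt h (h' t) t)
    (hp : ∀ t, h (t + T) = h t) : ∃ t, (∀ s, h s ≤ h t) ∧ h' t = 0 := by
  have hc : Continuous h := continuous_iff_continuousAt.2 fun t => (hd t).continuousAt
  obtain ⟨t, ht, hmax⟩ := (isCompact_Icc (a := (0:ℝ)) (b := T)).exists_isMaxOn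
    ⟨0, left_mem_Icc.2 hT.le⟩ hc.continuousOn
  have hper : Function.Periodic h T := hp
  have hall : ∀ s, h s ≤ h t := by
    intro s
    obtain ⟨y, hy, hys⟩ := hper.exists_mem_Ico₀ hT s
    rw [hys]
    exact hmax (Ico_subset_Icc_self hy)
  refine ⟨t, hall, ?_⟩
  have : IsLocalMax h t := Filter.Eventually.of_forall hall
  exact this.hasDerivAt_eq_zero (hd t)

theorem aux_crit_min (h h' : ℝ → ℝ) (T : ℝ) (hT : 0 < T) (hd : ∀ t, HasDerivAt h (h' t) t)
    (hp : ∀ t, h (t + T) = h t) : ∃ t, (∀ s, h t ≤ h s) ∧ h' t = 0 := by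
  obtain ⟨t, h1, h2⟩ := aux_crit_max (fun t => - h t) (fun t => - h' t) T hT
    (fun t => (hd t).neg) (fun t => by simp [hp])
  exact ⟨t, fun s => by simpa using h1 s, by simpa using h2⟩

theorem aux_per_integral (g : ℝ → ℝ) (P : ℝ) (hg : Continuous g) (hper : ∀ x, g (x + P) = g x) (x : ℝ) :
    ∫ s in (0:ℝ)..(x + P), g s = (∫ s in (0:ℝ)..x, g s) + ∫ s in (0:ℝ)..P, g s := by
  have h : Function.Periodic g P := hper
  have := h.intervalIntegral_add_eq_add 0 x (fun a b => hg.intervalIntegrable a b)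
  simpa using this

theorem aux_integral_deriv (g : ℝ → ℝ) (hg : Continuous g) (x : ℝ) :
    HasDerivAt (fun x => ∫ s in (0:ℝ)..x, g s) (g x) x :=
  intervalIntegral.integral_hasDerivAt_right (hg.intervalIntegrable _ _)
    (hg.stronglyMeasurableAtFilter _ _) hg.continuousAt

theorem aux_bdd_per (g : ℝ → ℝ) (P : ℝ) (hP : 0 < P) (hg : Continuous g)
    (hper : ∀ x, g (x + P) = g x) : ∃ M, ∀ x, |g x| ≤ M := by
  obtain ⟨M, hM⟩ := (isCompact_Icc (a := (0:ℝ)) (b := P)).exists_bound_of_continuousOn hg.continuousOn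
  refine ⟨M, fun x => ?_⟩
  have h : Function.Periodic g P := hper
  obtain ⟨y, hy, hys⟩ := h.exists_mem_Ico₀ hP x
  rw [hys]
  exact hM y (Ico_subset_Icc_self hy)

/-- Periodic solutions of a scalar periodic ODE with sign conditions. -/
theorem aux_per_solution (P : ℝ) (hP : 0 < P) (H : ℝ → ℝ → ℝ)
    (hc : Continuous (fun p : ℝ × ℝ => H p.1 p.2)) (hper : ∀ θ y, H (θ + P) y = H θ y)
    (K L : ℝ) (hK : ∀ θ x y, |H θ x - H θ y| ≤ K * |x - y|) (hL : ∀ θ y, |H θ y| ≤ L)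
    (s lo hi : ℝ) (hhi : ∀ θ y, hi ≤ y → 0 < s * H θ y) (hlo : ∀ θ y, y ≤ lo → s * H θ y < 0) :
    ∃ y : ℝ → ℝ, (∀ θ, HasDerivAt y (H θ (y θ)) θ) ∧ (∀ θ, y (θ + P) = y θ) ∧
      ∀ θ, lo ≤ y θ ∧ y θ ≤ hi := by
  have hL0 : 0 ≤ L := (abs_nonneg _).trans (hL 0 0)
  obtain ⟨R, hRdef⟩ : ∃ R, R = |lo| + |hi| + L * P := ⟨_, rfl⟩
  have hLP : 0 ≤ L * P := by positivity
  have hR0 : 0 ≤ R := by rw [hRdef]; positivity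
  have hPL : IsPicardLindelof H (tmin := 0) (tmax := P) ⟨0, left_mem_Icc.2 hP.le⟩ (0:ℝ)
      (R + L * P).toNNReal R.toNNReal L.toNNReal K.toNNReal := by
    refine ⟨fun t _ => ?_, fun x _ => ?_, fun t _ x _ => ?_, ?_⟩
    · apply LipschitzOnWith.of_dist_le_mul
      intro x _ y _
      rw [Real.dist_eq, Real.dist_eq]
      exact (hK t x y).trans (mul_le_mul_of_nonneg_right (Real.le_coe_toNNReal K) (abs_nonneg _))
    · exact (hc.comp (continuous_id.prodMk continuous_const)).continuousOn
    · exact (hL t x).trans (Real.le_coe_toNNReal L)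
    · rw [Real.coe_toNNReal _ hL0, Real.coe_toNNReal _ hR0, Real.coe_toNNReal _ (by positivity)]
      simp [hP.le]
  obtain ⟨α, hα, L', hL'⟩ := hPL.exists_forall_mem_closedBall_eq_hasDerivWithinAt_lipschitzOnWith
  rw [Real.coe_toNNReal _ hR0, Real.closedBall_eq_Icc, zero_sub, zero_add] at hα hL'
  simp only at hα
  have hcont : ∀ x ∈ Icc (-R) R, ContinuousOn (α x) (Icc 0 P) :=
    fun x hx => HasDerivWithinAt.continuousOn (hα x hx).2
  have hder : ∀ x ∈ Icc (-R) R, ∀ t ∈ Ioo 0 P, HasDerivAt (α x) (H t (α x t)) t :=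
    fun x hx t ht => ((hα x hx).2 t (Ioo_subset_Icc_self ht)).hasDerivAt (Icc_mem_nhds ht.1 ht.2)
  have hdist : ∀ x ∈ Icc (-R) R, ∀ t ∈ Icc 0 P, |α x t - x| ≤ L * P := by
    intro x hx t ht
    have := (convex_Icc (0:ℝ) P).norm_image_sub_le_of_norm_hasDerivWithin_le (C := L)
      (hα x hx).2 (fun t _ => hL t _) (left_mem_Icc.2 hP.le) ht
    rw [(hα x hx).1, Real.norm_eq_abs, Real.norm_eq_abs, sub_zero, abs_of_nonneg ht.1] at this
    exact this.trans (mul_le_mul_of_nonneg_left ht.2 hL0)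
  have hmvt : ∀ x ∈ Icc (-R) R, ∃ c ∈ Ioo 0 P, α x P - x = P * H c (α x c) := by
    intro x hx
    obtain ⟨c, hc1, hc2⟩ := exists_hasDerivAt_eq_slope (α x) (fun t => H t (α x t)) hP
      (hcont x hx) (hder x hx)
    refine ⟨c, hc1, ?_⟩
    rw [(hα x hx).1] at hc2
    simp only [sub_zero] at hc2
    rw [hc2]; field_simp
  have hRm : R ∈ Icc (-R) R := ⟨by linarith, le_rfl⟩
  have hRm' : -R ∈ Icc (-R) R := ⟨le_rfl, by linarith⟩
  have h1 : 0 ≤ s * (α R P - R) := by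
    obtain ⟨c, hc1, hc2⟩ := hmvt R hRm
    have h3 := hhi c (α R c) (by
      have := abs_le.1 (hdist R hRm c (Ioo_subset_Icc_self hc1))
      linarith [le_abs_self hi, abs_nonneg lo])
    rw [hc2]
    nlinarith [mul_pos hP h3]
  have h2 : s * (α (-R) P - (-R)) ≤ 0 := by
    obtain ⟨c, hc1, hc2⟩ := hmvt (-R) hRm'
    have h3 := hlo c (α (-R) c) (by
      have := abs_le.1 (hdist (-R) hRm' c (Ioo_subset_Icc_self hc1))
      linarith [neg_abs_le lo, abs_nonneg hi])
    rw [hc2]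
    nlinarith [mul_pos hP (neg_pos.2 h3)]
  have hgc : ContinuousOn (fun x => s * (α x P - x)) (Icc (-R) R) := by
    have := (hL' P (right_mem_Icc.2 hP.le)).continuousOn
    exact continuousOn_const.mul (this.sub continuousOn_id)
  have hs0 : s ≠ 0 := by
    rintro rfl
    simpa using hhi 0 hi le_rfl
  obtain ⟨x, hx, hx0⟩ := intermediate_value_Icc (by linarith : -R ≤ R) hgc ⟨h2, h1⟩
  have hx1 : α x P = x := by
    have : α x P - x = 0 := by simpa [hs0] using hx0
    linarith
  have : Fact (0 < P) := ⟨hP⟩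
  obtain ⟨y, hydef⟩ : ∃ y : ℝ → ℝ, y = fun t : ℝ => AddCircle.liftIco P 0 (α x) (t : AddCircle P) := ⟨_, rfl⟩
  have hyc : Continuous y := by
    rw [hydef]
    refine (AddCircle.liftIco_continuous ?_ ?_).comp (AddCircle.continuous_mk' P)
    · rw [zero_add, hx1, (hα x hx).1]
    · rw [zero_add]; exact hcont x hx
  have hyper : ∀ θ, y (θ + P) = y θ := by
    intro θ; rw [hydef]; simp
  have hyeq : ∀ t ∈ Icc 0 P, y t = α x t := by
    intro t ht
    rcases eq_or_lt_of_le ht.2 with h | h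
    · rw [h, hx1]
      have := hyper 0
      rw [zero_add] at this
      rw [this, hydef]
      simp only
      rw [AddCircle.liftIco_coe_apply (by simp [hP]), (hα x hx).1]
    · rw [hydef]
      simp only
      rw [AddCircle.liftIco_coe_apply (by rw [zero_add]; exact ⟨ht.1, h⟩)]
  have hGc : Continuous (fun t => H t (y t)) := hc.comp (continuous_id.prodMk hyc)
  have hint : ∀ t ∈ Icc 0 P, y t = x + ∫ τ in (0:ℝ)..t, H τ (y τ) := by
    intro t ht
    have := intervalIntegral.integral_eq_sub_of_hasDerivAt_of_le ht.1 (f := α x)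
      (f' := fun t => H t (y t)) ((hcont x hx).mono (Icc_subset_Icc_right ht.2))
      (fun τ hτ => by
        have h1 : τ ∈ Ioo 0 P := ⟨hτ.1, hτ.2.trans_le ht.2⟩
        rw [hyeq τ (Ioo_subset_Icc_self h1)]
        exact hder x hx τ h1) (hGc.intervalIntegrable _ _)
    rw [this, hyeq t ht, (hα x hx).1]; ring
  have hint0 : ∫ τ in (0:ℝ)..P, H τ (y τ) = 0 := by
    have h1 := hint P (right_mem_Icc.2 hP.le)
    rw [hyeq P (right_mem_Icc.2 hP.le), hx1] at h1
    linarith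
  have hall : ∀ t, y t = x + ∫ τ in (0:ℝ)..t, H τ (y τ) := by
    intro t
    have hq : Function.Periodic (fun t => y t - (x + ∫ τ in (0:ℝ)..t, H τ (y τ))) P := by
      intro t
      simp only
      rw [hyper, aux_per_integral (fun τ => H τ (y τ)) P hGc (fun τ => by rw [hyper, hper]) t, hint0,
        add_zero]
    obtain ⟨r, hr, hr'⟩ := hq.exists_mem_Ico₀ hP t
    have := hint r (Ico_subset_Icc_self hr)
    linarith
  have hyd : ∀ θ, HasDerivAt y (H θ (y θ)) θ := by
    intro θ
    have h1 := (aux_integral_deriv _ hGc θ).const_add x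
    exact h1.congr_of_eventuallyEq (Filter.Eventually.of_forall hall)
  refine ⟨y, hyd, hyper, fun θ => ⟨?_, ?_⟩⟩
  · obtain ⟨t, ht1, ht2⟩ := aux_crit_min y _ P hP hyd hyper
    by_contra hcon
    have := hlo t (y t) (by linarith [ht1 θ])
    rw [ht2] at this; simp at this
  · obtain ⟨t, ht1, ht2⟩ := aux_crit_max y _ P hP hyd hyper
    by_contra hcon
    have := hhi t (y t) (by linarith [ht1 θ])
    rw [ht2] at this; simp at this

/-- Angle lift. -/
theorem aux_polar_lift (p q m : ℝ → ℝ) (hm : Continuous m)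
    (hp : ∀ t, HasDerivAt p (-(m t * q t)) t) (hq : ∀ t, HasDerivAt q (m t * p t) t)
    (h1 : ∀ t, p t ^ 2 + q t ^ 2 = 1) :
    ∃ φ : ℝ → ℝ, (∀ t, HasDerivAt φ (m t) t) ∧ (∀ t, p t = cos (φ t)) ∧ ∀ t, q t = sin (φ t) := by
  obtain ⟨φ0, hc0, hs0⟩ : ∃ φ0, p 0 = cos φ0 ∧ q 0 = sin φ0 := by
    have hn : ‖(⟨p 0, q 0⟩ : ℂ)‖ = 1 := by
      have : ‖(⟨p 0, q 0⟩ : ℂ)‖ ^ 2 = 1 := by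
        rw [← Complex.normSq_eq_norm_sq, Complex.normSq_mk]; nlinarith [h1 0]
      nlinarith [norm_nonneg (⟨p 0, q 0⟩ : ℂ)]
    refine ⟨Complex.arg ⟨p 0, q 0⟩, ?_, ?_⟩
    · have := Complex.norm_mul_cos_arg ⟨p 0, q 0⟩
      rw [hn, one_mul] at this; exact this.symm
    · have := Complex.norm_mul_sin_arg ⟨p 0, q 0⟩
      rw [hn, one_mul] at this; exact this.symm
  obtain ⟨φ, hφ⟩ : ∃ φ : ℝ → ℝ, φ = fun t => φ0 + ∫ s in (0:ℝ)..t, m s := ⟨_, rfl⟩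
  have hφd : ∀ t, HasDerivAt φ (m t) t := fun t => by
    rw [hφ]; exact (aux_integral_deriv m hm t).const_add φ0
  have hφ0 : φ 0 = φ0 := by rw [hφ]; simp
  have e1 : ∀ t, p t * cos (φ t) + q t * sin (φ t) = 1 := by
    intro t
    have hd : ∀ t, HasDerivAt (fun t => p t * cos (φ t) + q t * sin (φ t)) 0 t := fun t => by
      exact (((hp t).mul (hφd t).cos).add ((hq t).mul (hφd t).sin)).congr_deriv (by ring)
    have := is_const_of_deriv_eq_zero (fun t => (hd t).differentiableAt) (fun t => (hd t).deriv) t 0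
    rw [this, hφ0, hc0, hs0]; nlinarith [cos_sq_add_sin_sq φ0]
  have e2 : ∀ t, q t * cos (φ t) - p t * sin (φ t) = 0 := by
    intro t
    have hd : ∀ t, HasDerivAt (fun t => q t * cos (φ t) - p t * sin (φ t)) 0 t := fun t => by
      exact (((hq t).mul (hφd t).cos).sub ((hp t).mul (hφd t).sin)).congr_deriv (by ring)
    have := is_const_of_deriv_eq_zero (fun t => (hd t).differentiableAt) (fun t => (hd t).deriv) t 0
    rw [this, hφ0, hc0, hs0]; ring
  refine ⟨φ, hφd, fun t => ?_, fun t => ?_⟩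
  · have := cos_sq_add_sin_sq (φ t)
    linear_combination (cos (φ t)) * e1 t - sin (φ t) * e2 t - p t * this
  · have := cos_sq_add_sin_sq (φ t)
    linear_combination (sin (φ t)) * e1 t + cos (φ t) * e2 t - q t * this

theorem aux_nonvanish (h h' : ℝ → ℝ) (K : ℝ) (hd : ∀ t, HasDerivAt h (h' t) t) (h0 : ∀ t, 0 ≤ h t)
    (hb : ∀ t, |h' t| ≤ K * h t) (t₀ : ℝ) (ht : h t₀ = 0) (t : ℝ) : h t = 0 := by
  have hm : Monotone (fun t => h t * exp (K * t)) := by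
    apply monotone_of_hasDerivAt_nonneg (f' := fun t => h' t * exp (K * t) + h t * (exp (K * t) * (K * 1)))
    · intro t; exact (hd t).mul (((hasDerivAt_id t).const_mul K).exp)
    · intro t
      have := (abs_le.1 (hb t)).1
      have e := exp_pos (K * t)
      have : 0 ≤ (h' t + K * h t) * exp (K * t) := mul_nonneg (by linarith) e.le
      simp only [Pi.zero_apply]; linarith
  have ha : Antitone (fun t => h t * exp (-K * t)) := by
    apply antitone_of_hasDerivAt_nonpos (f' := fun t => h' t * exp (-K * t) + h t * (exp (-K * t) * (-K * 1)))
    · intro t; exact (hd t).mul (((hasDerivAt_id t).const_mul (-K)).exp)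
    · intro t
      have := (abs_le.1 (hb t)).2
      have e := exp_pos (-K * t)
      have : 0 ≤ (K * h t - h' t) * exp (-K * t) := mul_nonneg (by linarith) e.le
      simp only [Pi.zero_apply]; linarith
  rcases le_total t t₀ with hle | hle
  · have := hm hle
    simp only [ht, zero_mul] at this
    have e := exp_pos (K * t)
    have := h0 t
    nlinarith
  · have := ha hle
    simp only [ht, zero_mul] at this
    have e := exp_pos (-K * t)
    have := h0 t
    nlinarith

theorem aux_G_diff (ω μ Ab E B ρ₁ ρ₂ : ℝ) (h1 : ρ₁ ≠ 0) (h2 : ρ₂ ≠ 0)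
    (hD1 : ω + B / ρ₁ ≠ 0) (hD2 : ω + B / ρ₂ ≠ 0) :
    (-μ * ρ₁ - Ab + E / ρ₁) / (ω + B / ρ₁) - (-μ * ρ₂ - Ab + E / ρ₂) / (ω + B / ρ₂)
      = (ρ₁ - ρ₂) * (-μ * ω - μ * B * (1 / ρ₁ + 1 / ρ₂) - (Ab * B + E * ω) * (1 / ρ₁ * (1 / ρ₂)))
        / ((ω + B / ρ₁) * (ω + B / ρ₂)) := by
  rw [div_sub_div _ _ hD1 hD2]
  congr 1
  field_simp
  ring

theorem aux_D_bound (ω B ρ M c : ℝ) (hc : 0 < c) (hρ : c / 2 ≤ ρ) (hB : |B| ≤ M)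
    (hM : 2 * M / c ≤ |ω| / 2) : |B / ρ| ≤ |ω| / 2 ∧ |ω| / 2 ≤ |ω + B / ρ| := by
  have hρ0 : 0 < ρ := by linarith
  have hM0 : 0 ≤ M := (abs_nonneg _).trans hB
  have h1 : |B / ρ| ≤ |ω| / 2 := by
    rw [abs_div, abs_of_pos hρ0]
    refine le_trans ?_ hM
    rw [div_le_div_iff₀ hρ0 hc]
    nlinarith
  refine ⟨h1, ?_⟩
  have := abs_sub_abs_le_abs_sub ω (-(B / ρ))
  rw [abs_neg, sub_neg_eq_add] at this
  linarith

theorem aux_inv_bound (ρ c : ℝ) (hc : 0 < c) (hρ : c / 2 ≤ ρ) : 0 < 1 / ρ ∧ 1 / ρ ≤ 2 / c := by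
  have hρ0 : 0 < ρ := by linarith
  refine ⟨by positivity, ?_⟩
  rw [div_le_div_iff₀ hρ0 hc]; linarith

theorem aux_J_bound (ω μ Ab E B q₁ q₂ M k : ℝ) (h1 : 0 < q₁) (h2 : 0 < q₂) (h1' : q₁ ≤ k)
    (h2' : q₂ ≤ k) (hB : |B| ≤ M) (hE : |E| ≤ M) :
    |μ * B * (q₁ + q₂) + (Ab * B + E * ω) * (q₁ * q₂)|
      ≤ |μ| * M * (2 * k) + (|Ab| * M + M * |ω|) * (k * k) := by
  have hM0 : 0 ≤ M := (abs_nonneg _).trans hB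
  refine (abs_add_le _ _).trans (add_le_add ?_ ?_)
  · rw [abs_mul, abs_mul, abs_of_pos (by linarith : 0 < q₁ + q₂)]
    gcongr
    linarith
  · rw [abs_mul, abs_of_pos (mul_pos h1 h2)]
    have hk : 0 ≤ k := by linarith
    gcongr
    refine (abs_add_le _ _).trans ?_
    rw [abs_mul, abs_mul]
    gcongr

theorem aux_exist_z (ω μ Ab c K M : ℝ) (hω : ω ≠ 0) (hμ : μ ≠ 0) (hc : 0 < c)
    (hAb : Ab = -μ * c) (B E a : ℝ → ℝ)
    (hBc : Continuous B) (hEc : Continuous E) (hac : Continuous a) (P : ℝ) (hP : 0 < P)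
    (hBp : ∀ x, B (x + P) = B x) (hEp : ∀ x, E (x + P) = E x) (hap : ∀ x, a (x + P) = a x)
    (hB : ∀ x, |B x| ≤ M) (hE : ∀ x, |E x| ≤ M) (ha : ∀ x, |a x| ≤ M)
    (hK : K + M ≤ c / 2) (hK0 : 0 ≤ K) (hMc : 2 * M / c ≤ |ω| / 2) (hMK : 2 * M / c < |μ| * (K - M)) :
    ∃ z : ℝ → ℝ, (∀ θ, HasDerivAt z ((-μ * (z θ - a θ) - Ab + E θ / (z θ - a θ)) /
      (ω + B θ / (z θ - a θ))) θ) ∧ (∀ θ, z (θ + P) = z θ) ∧ ∀ θ, |z θ - c| ≤ K := by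
  have hM0 : 0 ≤ M := (abs_nonneg _).trans (hB 0)
  obtain ⟨cl, hcl⟩ : ∃ cl : ℝ → ℝ, cl = fun y => max (c - K) (min (c + K) y) := ⟨_, rfl⟩
  have hcl1 : ∀ y, c - K ≤ cl y ∧ cl y ≤ c + K := by
    intro y; rw [hcl]
    exact ⟨le_max_left _ _, max_le (by linarith) (min_le_left _ _)⟩
  have hcl2 : ∀ y, c - K ≤ y → y ≤ c + K → cl y = y := by
    intro y h1 h2; rw [hcl]; simp [h1, h2]
  have hcl3 : ∀ y, c + K ≤ y → cl y = c + K := by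
    intro y h1; rw [hcl]; simp only; rw [min_eq_left h1, max_eq_right (by linarith)]
  have hcl4 : ∀ y, y ≤ c - K → cl y = c - K := by
    intro y h1; rw [hcl]; simp only; rw [min_eq_right (by linarith), max_eq_left (by linarith)]
  have hclc : Continuous cl := by rw [hcl]; fun_prop
  have hcll : ∀ x y, |cl x - cl y| ≤ |x - y| := by
    intro x y; rw [hcl]
    refine (abs_max_sub_max_le_max _ _ _ _).trans ?_
    refine max_le (by simp) ((abs_min_sub_min_le_max _ _ _ _).trans (max_le (by simp) le_rfl))
  have hρ : ∀ θ y, c / 2 ≤ cl y - a θ := by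
    intro θ y; linarith [(hcl1 y).1, (abs_le.1 (ha θ)).2]
  have hρ0 : ∀ θ y, 0 < cl y - a θ := fun θ y => by linarith [hρ θ y]
  have hD : ∀ θ y, |ω| / 2 ≤ |ω + B θ / (cl y - a θ)| := fun θ y =>
    (aux_D_bound ω (B θ) _ M c hc (hρ θ y) (hB θ) hMc).2
  have hω0 : 0 < |ω| := abs_pos.2 hω
  have hD0 : ∀ θ y, ω + B θ / (cl y - a θ) ≠ 0 := fun θ y => by
    rw [← abs_pos]; linarith [hD θ y]
  have hEρ : ∀ θ y, |E θ / (cl y - a θ)| ≤ 2 * M / c := fun θ y => by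
    rw [abs_div, abs_of_pos (hρ0 θ y), div_le_div_iff₀ (hρ0 θ y) hc]
    nlinarith [hE θ, hρ θ y]
  have hωD : ∀ θ y, 0 < ω / (ω + B θ / (cl y - a θ)) := fun θ y => by
    have h1 := (aux_D_bound ω (B θ) _ M c hc (hρ θ y) (hB θ) hMc).1
    have h2 : 0 < ω * (ω + B θ / (cl y - a θ)) := by
      have h3 : |ω * (B θ / (cl y - a θ))| ≤ |ω| * (|ω| / 2) := by rw [abs_mul]; gcongr
      have h4 := (abs_le.1 h3).1
      have h5 : |ω| * |ω| = ω * ω := abs_mul_abs_self ω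
      nlinarith
    have h6 : ω / (ω + B θ / (cl y - a θ)) =
        ω * (ω + B θ / (cl y - a θ)) / (ω + B θ / (cl y - a θ)) ^ 2 := by
      have := hD0 θ y
      field_simp
    rw [h6]
    have := hD0 θ y
    positivity
  obtain ⟨z, hz1, hz2, hz3⟩ := aux_per_solution P hP
    (fun θ y => (-μ * (cl y - a θ) - Ab + E θ / (cl y - a θ)) / (ω + B θ / (cl y - a θ)))
    (by
      have h1 : Continuous fun p : ℝ × ℝ => cl p.2 - a p.1 := by fun_prop
      refine Continuous.div ?_ ?_ (fun p => hD0 _ _)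
      · exact (((continuous_const.mul h1).sub continuous_const).add
          (Continuous.div (by fun_prop) h1 (fun p => (hρ0 _ _).ne')))
      · exact continuous_const.add (Continuous.div (by fun_prop) h1 (fun p => (hρ0 _ _).ne')))
    (fun θ y => by rw [hap, hEp, hBp])
    ((|μ| * |ω| + (|μ| * M * (2 * (2 / c)) + (|Ab| * M + M * |ω|) * ((2 / c) * (2 / c))))
      / ((|ω| / 2) * (|ω| / 2)))
    ((|μ| * (K + M) + 2 * M / c) / (|ω| / 2))
    (by
      intro θ x y
      rw [aux_G_diff _ _ _ _ _ _ _ (hρ0 θ x).ne' (hρ0 θ y).ne' (hD0 θ x) (hD0 θ y)]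
      have i1 := aux_inv_bound _ c hc (hρ θ x)
      have i2 := aux_inv_bound _ c hc (hρ θ y)
      have hJ := aux_J_bound ω μ Ab (E θ) (B θ) _ _ M (2 / c) i1.1 i2.1 i1.2 i2.2 (hB θ) (hE θ)
      rw [abs_div, abs_mul, abs_mul]
      have e1 : |cl x - a θ - (cl y - a θ)| ≤ |x - y| := by
        rw [show cl x - a θ - (cl y - a θ) = cl x - cl y by ring]; exact hcll x y
      have e2 : |-μ * ω - μ * B θ * (1 / (cl x - a θ) + 1 / (cl y - a θ)) -
          (Ab * B θ + E θ * ω) * (1 / (cl x - a θ) * (1 / (cl y - a θ)))| ≤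
          |μ| * |ω| + (|μ| * M * (2 * (2 / c)) + (|Ab| * M + M * |ω|) * ((2 / c) * (2 / c))) := by
        rw [sub_sub]
        refine (abs_sub _ _).trans (add_le_add ?_ hJ)
        rw [abs_mul, abs_neg]
      have d1 := hD θ x
      have d2 := hD θ y
      refine le_of_le_of_eq (b := |x - y| * (|μ| * |ω| + (|μ| * M * (2 * (2 / c)) +
        (|Ab| * M + M * |ω|) * ((2 / c) * (2 / c)))) / ((|ω| / 2) * (|ω| / 2))) ?_ (by ring)
      gcongr)
    (by
      intro θ y
      rw [abs_div]
      have d1 := hD θ y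
      have : |-μ * (cl y - a θ) - Ab + E θ / (cl y - a θ)| ≤ |μ| * (K + M) + 2 * M / c := by
        refine (abs_add_le _ _).trans (add_le_add ?_ (hEρ θ y))
        rw [hAb, show -μ * (cl y - a θ) - -μ * c = -μ * (cl y - a θ - c) by ring, abs_mul, abs_neg]
        gcongr
        rw [abs_le]
        have := abs_le.1 (ha θ)
        constructor <;> linarith [hcl1 y]
      gcongr)
    (-μ * ω) (c - K) (c + K)
    (by
      intro θ y hy
      rw [show -μ * ω * ((-μ * (cl y - a θ) - Ab + E θ / (cl y - a θ)) / (ω + B θ / (cl y - a θ)))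
        = -μ * (-μ * (cl y - a θ) - Ab + E θ / (cl y - a θ)) * (ω / (ω + B θ / (cl y - a θ))) by ring]
      refine mul_pos ?_ (hωD θ y)
      have h1 : |μ * (E θ / (cl y - a θ))| ≤ |μ| * (2 * M / c) := by
        rw [abs_mul]; gcongr; exact hEρ θ y
      have h2 := (abs_le.1 h1).2
      have h3 := mul_lt_mul_of_pos_left hMK (abs_pos.2 hμ)
      have h4 : |μ| * |μ| = μ * μ := abs_mul_abs_self μ
      have h5 := (abs_le.1 (ha θ)).2
      have h6 : 0 ≤ μ * μ * (M - a θ) := mul_nonneg (mul_self_nonneg _) (by linarith)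
      have h7 : |μ| * (|μ| * (K - M)) = μ * μ * (K - M) := by rw [← mul_assoc, h4]
      have h8 : -μ * (-μ * (cl y - a θ) - Ab + E θ / (cl y - a θ)) =
        μ * μ * (K - a θ) - μ * (E θ / (cl y - a θ)) := by
          rw [hAb]; rw [show cl y = c + K from hcl3 y hy]; ring
      rw [h8]; nlinarith)
    (by
      intro θ y hy
      rw [show -μ * ω * ((-μ * (cl y - a θ) - Ab + E θ / (cl y - a θ)) / (ω + B θ / (cl y - a θ)))
        = -μ * (-μ * (cl y - a θ) - Ab + E θ / (cl y - a θ)) * (ω / (ω + B θ / (cl y - a θ))) by ring]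
      refine mul_neg_of_neg_of_pos ?_ (hωD θ y)
      have h1 : |μ * (E θ / (cl y - a θ))| ≤ |μ| * (2 * M / c) := by
        rw [abs_mul]; gcongr; exact hEρ θ y
      have h2 := (abs_le.1 h1).1
      have h3 := mul_lt_mul_of_pos_left hMK (abs_pos.2 hμ)
      have h4 : |μ| * |μ| = μ * μ := abs_mul_abs_self μ
      have h5 := (abs_le.1 (ha θ)).1
      have h6 : 0 ≤ μ * μ * (M + a θ) := mul_nonneg (mul_self_nonneg _) (by linarith)
      have h7 : |μ| * (|μ| * (K - M)) = μ * μ * (K - M) := by rw [← mul_assoc, h4]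
      have h8 : -μ * (-μ * (cl y - a θ) - Ab + E θ / (cl y - a θ)) =
        μ * μ * (-K - a θ) - μ * (E θ / (cl y - a θ)) := by
          rw [hAb]; rw [show cl y = c - K from hcl4 y hy]; ring
      rw [h8]; nlinarith)
  refine ⟨z, fun θ => ?_, hz2, fun θ => abs_le.2 ⟨by linarith [(hz3 θ).1], by linarith [(hz3 θ).2]⟩⟩
  have := hz1 θ
  rwa [hcl2 (z θ) (hz3 θ).1 (hz3 θ).2] at this

/-- Inverse of the time map. -/
theorem aux_angle_ode (ω : ℝ) (hω : ω ≠ 0) (G : ℝ → ℝ) (hG : Continuous G) (P : ℝ) (hP : 0 < P)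
    (hGp : ∀ x, G (x + P) = G x) (hG1 : ∀ x, 0 < ω / G x) :
    ∃ (τ φ : ℝ → ℝ), (∀ x, HasDerivAt τ (1 / G x) x) ∧ Function.Injective τ ∧
      (∀ t, HasDerivAt φ (G (φ t)) t) ∧ Function.Surjective φ ∧
      ∃ T > 0, (∀ t, φ (t + T) = φ t + P) ∨ (∀ t, φ (t + T) = φ t - P) := by
  have hG0 : ∀ x, G x ≠ 0 := fun x h => by have := hG1 x; simp [h] at this
  have hgc : Continuous (fun x => ω / G x) := continuous_const.div hG hG0
  obtain ⟨ψ, hψ⟩ : ∃ ψ : ℝ → ℝ, ψ = fun x => ∫ s in (0:ℝ)..x, ω / G s := ⟨_, rfl⟩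
  have hψd : ∀ x, HasDerivAt ψ (ω / G x) x := fun x => by
    rw [hψ]; exact aux_integral_deriv _ hgc x
  have hmono : StrictMono ψ := strictMono_of_hasDerivAt_pos hψd hG1
  have hψc : Continuous ψ := continuous_iff_continuousAt.2 fun t => (hψd t).continuousAt
  have hψ0 : ψ 0 = 0 := by rw [hψ]; simp
  have hψP : 0 < ψ P := by rw [← hψ0]; exact hmono hP
  have hψp : ∀ x, ψ (x + P) = ψ x + ψ P := fun x => by
    rw [hψ]; exact aux_per_integral _ P hgc (fun x => by rw [hGp]) x
  have hψn : ∀ n : ℕ, ∀ x, ψ (x + n * P) = ψ x + n * ψ P := by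
    intro n
    induction n with
    | zero => simp
    | succ n ih => intro x; push_cast; rw [show x + (n + 1) * P = (x + n * P) + P by ring, hψp, ih]; ring
  have hsurj : Function.Surjective ψ := by
    intro y
    obtain ⟨n, hn⟩ := exists_nat_gt (|y| / ψ P)
    rw [div_lt_iff₀ hψP] at hn
    have h1 := hψn n 0
    have h2 := hψn n (-(n * P))
    simp only [zero_add, hψ0, neg_add_cancel] at h1 h2
    have h3 : ψ (-(n * P)) ≤ y := by linarith [neg_abs_le y]
    have h4 : y ≤ ψ (n * P) := by linarith [le_abs_self y]
    exact mem_range_of_exists_le_of_exists_ge hψc ⟨_, h3⟩ ⟨_, h4⟩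
  obtain ⟨e, he⟩ : ∃ e : ℝ ≃o ℝ, ∀ x, e x = ψ x :=
    ⟨hmono.orderIsoOfSurjective ψ hsurj, fun x => rfl⟩
  have hec : Continuous e.symm := e.symm.continuous
  have hed : ∀ y, HasDerivAt e.symm (G (e.symm y) / ω) y := by
    intro y
    have := HasDerivAt.of_local_left_inverse (f := ψ) (g := e.symm) (a := y) hec.continuousAt
      (hψd (e.symm y)) (hG1 _).ne' (Filter.Eventually.of_forall fun x => by rw [← he]; simp)
    exact this.congr_deriv (by rw [inv_div])
  have hep : ∀ y, e.symm (y + ψ P) = e.symm y + P := by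
    intro y
    rw [OrderIso.symm_apply_eq, he, hψp, ← he (e.symm y)]; simp
  refine ⟨fun x => ψ x / ω, fun t => e.symm (ω * t), ?_, ?_, ?_, ?_, ψ P / |ω|, ?_, ?_⟩
  · intro x
    refine ((hψd x).div_const ω).congr_deriv ?_
    have := hG0 x
    field_simp
  · intro x y hxy
    simp only at hxy
    rw [div_left_inj' hω] at hxy
    exact hmono.injective hxy
  · intro t
    have := (hed (ω * t)).comp t ((hasDerivAt_id t).const_mul ω)
    refine this.congr_deriv ?_
    field_simp
  · intro y
    refine ⟨e y / ω, ?_⟩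
    simp only
    rw [mul_div_cancel₀ _ hω]; simp
  · exact div_pos hψP (abs_pos.2 hω)
  · rcases lt_or_gt_of_ne hω with h | h
    · right
      intro t
      simp only
      have h1 := hep (ω * (t + ψ P / |ω|))
      rw [show ω * (t + ψ P / |ω|) + ψ P = ω * t by rw [abs_of_neg h]; field_simp; ring] at h1
      linarith
    · left
      intro t
      simp only
      rw [← hep, show ω * (t + ψ P / |ω|) = ω * t + ψ P by rw [abs_of_pos h]; field_simp]

theorem aux_planar_polar (ω μ : ℝ) (f g : ℝ → ℝ → ℝ)
    (hf : Continuous (fun p : ℝ × ℝ => f p.1 p.2)) (hg : Continuous (fun p : ℝ × ℝ => g p.1 p.2))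
    (hfh : ∀ r x y, 0 ≤ r → f (r * x) (r * y) = r ^ 2 * f x y)
    (hgh : ∀ r x y, 0 ≤ r → g (r * x) (r * y) = r ^ 2 * g x y)
    (F : ℝ × ℝ → ℝ × ℝ)
    (hF : ∀ p, F p = (μ * p.1 - ω * p.2 + f p.1 p.2, ω * p.1 + μ * p.2 + g p.1 p.2))
    (A B : ℝ → ℝ)
    (hA : ∀ θ, A θ = cos θ * f (cos θ) (sin θ) + sin θ * g (cos θ) (sin θ))
    (hB : ∀ θ, B θ = cos θ * g (cos θ) (sin θ) - sin θ * f (cos θ) (sin θ))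
    (M : ℝ) (hAM : ∀ θ, |A θ| ≤ M)
    (u : ℝ → ℝ × ℝ) (hu : IsPeriodicSolution2 F u) :
    ∃ (ρ φ : ℝ → ℝ) (T : ℝ), 0 < T ∧ (∀ t, 0 < ρ t) ∧
      (∀ t, HasDerivAt ρ (-μ * ρ t - A (φ t)) t) ∧
      (∀ t, HasDerivAt φ (ω + B (φ t) / ρ t) t) ∧
      (∀ t, u t = (cos (φ t) / ρ t, sin (φ t) / ρ t)) ∧ (∀ t, ρ (t + T) = ρ t) ∧
      (∀ t, ∃ k : ℤ, φ (t + T) = φ t + k * (2 * π)) := by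
  obtain ⟨hsol, ⟨T, hT, hTp⟩, hnc⟩ := hu
  obtain ⟨v, hv⟩ : ∃ v : ℝ → ℝ, v = fun t => (u t).1 := ⟨_, rfl⟩
  obtain ⟨w, hw⟩ : ∃ w : ℝ → ℝ, w = fun t => (u t).2 := ⟨_, rfl⟩
  have huvw : ∀ t, u t = (v t, w t) := fun t => by rw [hv, hw]
  have hvd : ∀ t, HasDerivAt v (μ * v t - ω * w t + f (v t) (w t)) t := fun t => by
    have h1 : HasDerivAt v (F (u t)).1 t := by
      rw [hv]; exact hasFDerivAt_fst.comp_hasDerivAt t (hsol t)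
    refine h1.congr_deriv ?_
    rw [hF, huvw]
  have hwd : ∀ t, HasDerivAt w (ω * v t + μ * w t + g (v t) (w t)) t := fun t => by
    have h1 : HasDerivAt w (F (u t)).2 t := by
      rw [hw]; exact hasFDerivAt_snd.comp_hasDerivAt t (hsol t)
    refine h1.congr_deriv ?_
    rw [hF, huvw]
  have hvp : ∀ t, v (t + T) = v t := fun t => by rw [hv]; simp only [hTp]
  have hwp : ∀ t, w (t + T) = w t := fun t => by rw [hw]; simp only [hTp]
  have hvc : Continuous v := continuous_iff_continuousAt.2 fun t => (hvd t).continuousAt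
  have hwc : Continuous w := continuous_iff_continuousAt.2 fun t => (hwd t).continuousAt
  obtain ⟨h, hh⟩ : ∃ h : ℝ → ℝ, h = fun t => v t ^ 2 + w t ^ 2 := ⟨_, rfl⟩
  have hh0 : ∀ t, 0 ≤ h t := fun t => by rw [hh]; positivity
  have hhe : ∀ t, h t = v t ^ 2 + w t ^ 2 := fun t => by rw [hh]
  have hhc : Continuous h := by rw [hh]; fun_prop
  have hhd : ∀ t, HasDerivAt h (2 * μ * h t + 2 * (v t * f (v t) (w t) + w t * g (v t) (w t))) t := by
    intro t
    have h1 := ((hvd t).pow 2).add ((hwd t).pow 2)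
    have h2 := h1.congr_of_eventuallyEq (f₁ := h) (Filter.Eventually.of_forall fun s => hhe s)
    refine h2.congr_deriv ?_
    rw [hhe]
    push_cast
    ring
  have hcub : ∀ t, |v t * f (v t) (w t) + w t * g (v t) (w t)| ≤ M * √(h t) * h t := by
    intro t
    obtain ⟨θ, h1, h2⟩ : ∃ θ, v t = √(h t) * cos θ ∧ w t = √(h t) * sin θ := by
      have hn : ‖(⟨v t, w t⟩ : ℂ)‖ = √(h t) := by
        rw [Complex.norm_eq_sqrt_sq_add_sq, hhe]
      refine ⟨Complex.arg ⟨v t, w t⟩, ?_, ?_⟩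
      · have := Complex.norm_mul_cos_arg ⟨v t, w t⟩
        rw [hn] at this; exact this.symm
      · have := Complex.norm_mul_sin_arg ⟨v t, w t⟩
        rw [hn] at this; exact this.symm
    have h3 : v t * f (v t) (w t) + w t * g (v t) (w t) = A θ * √(h t) * h t := by
      rw [h1, h2, hfh _ _ _ (sqrt_nonneg _), hgh _ _ _ (sqrt_nonneg _), hA]
      linear_combination (√(h t) * (cos θ * f (cos θ) (sin θ) + sin θ * g (cos θ) (sin θ))) *
        (Real.sq_sqrt (hh0 t))
    rw [h3, abs_mul, abs_mul, abs_of_nonneg (sqrt_nonneg _), abs_of_nonneg (hh0 t)]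
    have := hAM θ
    have := hh0 t
    gcongr
  obtain ⟨R, hR⟩ := aux_bdd_per (fun t => √(h t)) T hT (by fun_prop) (fun t => by rw [hhe, hhe, hvp, hwp])
  have hM0 : 0 ≤ M := (abs_nonneg _).trans (hAM 0)
  have hpos : ∀ t, 0 < h t := by
    intro t₀
    by_contra hcon
    have h00 : h t₀ = 0 := le_antisymm (not_lt.1 hcon) (hh0 _)
    have hz := aux_nonvanish h _ (2 * |μ| + 2 * (M * R)) hhd hh0 (by
      intro t
      have e1 := hcub t
      have e2 : √(h t) ≤ R := (le_abs_self _).trans (hR t)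
      have e3 : M * √(h t) * h t ≤ M * R * h t := by have := hh0 t; gcongr
      refine (abs_add_le _ _).trans ?_
      rw [abs_mul, abs_mul, abs_mul, abs_of_nonneg (hh0 t), abs_two]
      linarith) t₀ h00
    apply hnc
    have hu0 : ∀ t, u t = 0 := by
      intro t
      have := hz t
      rw [hhe] at this
      have h1 : v t = 0 := by nlinarith [sq_nonneg (v t), sq_nonneg (w t)]
      have h2 : w t = 0 := by nlinarith [sq_nonneg (v t), sq_nonneg (w t)]
      rw [huvw, h1, h2]; rfl
    intro t; rw [hu0, hu0]
  obtain ⟨r, hr⟩ : ∃ r : ℝ → ℝ, r = fun t => √(h t) := ⟨_, rfl⟩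
  have hre : ∀ t, r t = √(h t) := fun t => by rw [hr]
  have hr0 : ∀ t, 0 < r t := fun t => by rw [hre]; exact sqrt_pos.2 (hpos t)
  have hr2 : ∀ t, r t ^ 2 = v t ^ 2 + w t ^ 2 := fun t => by rw [hre, sq_sqrt (hh0 t), hhe]
  obtain ⟨p, hp⟩ : ∃ p : ℝ → ℝ, p = fun t => v t / r t := ⟨_, rfl⟩
  obtain ⟨q, hq⟩ : ∃ q : ℝ → ℝ, q = fun t => w t / r t := ⟨_, rfl⟩
  have hvp' : ∀ t, v t = r t * p t := fun t => by rw [hp]; have := (hr0 t).ne'; field_simp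
  have hwq' : ∀ t, w t = r t * q t := fun t => by rw [hq]; have := (hr0 t).ne'; field_simp
  have hpq : ∀ t, p t ^ 2 + q t ^ 2 = 1 := fun t => by
    have h1 := hr2 t
    rw [hvp', hwq'] at h1
    have h2 : r t ^ 2 * (p t ^ 2 + q t ^ 2 - 1) = 0 := by linear_combination -h1
    have h3 : r t ^ 2 ≠ 0 := pow_ne_zero _ (hr0 t).ne'
    have := (mul_eq_zero.1 h2).resolve_left h3
    linarith
  have hfr : ∀ t, f (v t) (w t) = r t ^ 2 * f (p t) (q t) := fun t => by
    rw [hvp', hwq', hfh _ _ _ (hr0 t).le]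
  have hgr : ∀ t, g (v t) (w t) = r t ^ 2 * g (p t) (q t) := fun t => by
    rw [hvp', hwq', hgh _ _ _ (hr0 t).le]
  have hrd : ∀ t, HasDerivAt r (μ * r t + r t ^ 2 * (p t * f (p t) (q t) + q t * g (p t) (q t))) t := by
    intro t
    have h1 := ((hhd t).sqrt (hpos t).ne').congr_of_eventuallyEq (f₁ := r)
      (Filter.Eventually.of_forall fun s => hre s)
    refine h1.congr_deriv ?_
    rw [← hre, hhe, ← hr2, hfr, hgr, hvp', hwq']
    have := (hr0 t).ne'
    field_simp
  have hpd : ∀ t, HasDerivAt p (-((ω + r t * (p t * g (p t) (q t) - q t * f (p t) (q t))) * q t)) t := by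
    intro t
    have h1 := ((hvd t).div (hrd t) (hr0 t).ne').congr_of_eventuallyEq (f₁ := p)
      (Filter.Eventually.of_forall fun s => by rw [hp]; rfl)
    refine h1.congr_deriv ?_
    rw [hfr, hvp', hwq']
    have h2 := (hr0 t).ne'
    rw [div_eq_iff (pow_ne_zero _ h2)]
    linear_combination (-(r t) ^ 3 * f (p t) (q t)) * hpq t
  have hqd : ∀ t, HasDerivAt q ((ω + r t * (p t * g (p t) (q t) - q t * f (p t) (q t))) * p t) t := by
    intro t
    have h1 := ((hwd t).div (hrd t) (hr0 t).ne').congr_of_eventuallyEq (f₁ := q)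
      (Filter.Eventually.of_forall fun s => by rw [hq]; rfl)
    refine h1.congr_deriv ?_
    rw [hgr, hvp', hwq']
    have h2 := (hr0 t).ne'
    rw [div_eq_iff (pow_ne_zero _ h2)]
    linear_combination (-(r t) ^ 3 * g (p t) (q t)) * hpq t
  have hpc : Continuous p := continuous_iff_continuousAt.2 fun t => (hpd t).continuousAt
  have hqc : Continuous q := continuous_iff_continuousAt.2 fun t => (hqd t).continuousAt
  have hrc : Continuous r := continuous_iff_continuousAt.2 fun t => (hrd t).continuousAt
  have hfc : Continuous fun t => f (p t) (q t) := hf.comp (hpc.prodMk hqc)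
  have hgc : Continuous fun t => g (p t) (q t) := hg.comp (hpc.prodMk hqc)
  obtain ⟨φ, hφd, hφc, hφs⟩ := aux_polar_lift p q
    (fun t => ω + r t * (p t * g (p t) (q t) - q t * f (p t) (q t))) (by fun_prop) hpd hqd hpq
  have hrp : ∀ t, r (t + T) = r t := fun t => by rw [hre, hre, hhe, hhe, hvp, hwp]
  refine ⟨fun t => 1 / r t, φ, T, hT, fun t => one_div_pos.2 (hr0 t), ?_, ?_, ?_, ?_, ?_⟩
  · intro t
    have h1 := (hrd t).inv (hr0 t).ne'
    have h2 := h1.congr_of_eventuallyEq (f₁ := fun t => 1 / r t)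
      (Filter.Eventually.of_forall fun s => by simp only [one_div]; rfl)
    refine h2.congr_deriv ?_
    rw [hA, ← hφc, ← hφs]
    have := (hr0 t).ne'
    field_simp
    ring
  · intro t
    refine (hφd t).congr_deriv ?_
    rw [hB, ← hφc, ← hφs]
    have := (hr0 t).ne'
    field_simp
  · intro t
    rw [huvw, ← hφc, ← hφs]
    simp only [div_div_eq_mul_div, div_one]
    rw [hvp' t, hwq' t, mul_comm, mul_comm (r t)]
  · intro t; simp only [hrp]
  · intro t
    have h1 : cos (φ (t + T)) = cos (φ t) := by
      rw [← hφc, ← hφc, hp]; simp only [hvp, hrp]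
    have h2 : sin (φ (t + T)) = sin (φ t) := by
      rw [← hφs, ← hφs, hq]; simp only [hwp, hrp]
    have h3 := Real.Angle.cos_sin_inj h1 h2
    obtain ⟨k, hk⟩ := Real.Angle.angle_eq_iff_two_pi_dvd_sub.1 h3
    exact ⟨k, by linarith⟩

theorem aux_norm_polar (x ρ : ℝ) (hρ : 0 < ρ) : √((cos x / ρ) ^ 2 + (sin x / ρ) ^ 2) = 1 / ρ := by
  rw [show (cos x / ρ) ^ 2 + (sin x / ρ) ^ 2 = (1 / ρ) ^ 2 by
    rw [div_pow, div_pow, ← add_div, cos_sq_add_sin_sq, div_pow, one_pow]]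
  exact sqrt_sq (by positivity)

/-- The planar solution built from a solution of the polar system. -/
theorem aux_polar_planar (ω μ : ℝ) (f g : ℝ → ℝ → ℝ)
    (hfh : ∀ r x y, 0 ≤ r → f (r * x) (r * y) = r ^ 2 * f x y)
    (hgh : ∀ r x y, 0 ≤ r → g (r * x) (r * y) = r ^ 2 * g x y)
    (F : ℝ × ℝ → ℝ × ℝ)
    (hF : ∀ p, F p = (μ * p.1 - ω * p.2 + f p.1 p.2, ω * p.1 + μ * p.2 + g p.1 p.2))
    (A B : ℝ → ℝ)
    (hA : ∀ θ, A θ = cos θ * f (cos θ) (sin θ) + sin θ * g (cos θ) (sin θ))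
    (hB : ∀ θ, B θ = cos θ * g (cos θ) (sin θ) - sin θ * f (cos θ) (sin θ))
    (ρ φ : ℝ → ℝ) (hρ0 : ∀ t, 0 < ρ t) (hρ : ∀ t, HasDerivAt ρ (-μ * ρ t - A (φ t)) t)
    (hφ : ∀ t, HasDerivAt φ (ω + B (φ t) / ρ t) t) :
    IsSolution2 F (fun t => (cos (φ t) / ρ t, sin (φ t) / ρ t)) := by
  intro t
  have h1 := (hφ t).cos.div (hρ t) (hρ0 t).ne'
  have h2 := (hφ t).sin.div (hρ t) (hρ0 t).ne'
  refine (h1.prodMk h2).congr_deriv ?_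
  have e1 : cos (φ t) / ρ t = (1 / ρ t) * cos (φ t) := by ring
  have e2 : sin (φ t) / ρ t = (1 / ρ t) * sin (φ t) := by ring
  have h0 : 0 ≤ 1 / ρ t := one_div_nonneg.2 (hρ0 t).le
  have hne := (hρ0 t).ne'
  have hcs := cos_sq_add_sin_sq (φ t)
  rw [hF]
  simp only
  rw [e1, e2, hfh _ _ _ h0, hgh _ _ _ h0, hA, hB]
  refine Prod.ext ?_ ?_
  · simp only
    rw [div_eq_iff (pow_ne_zero _ hne)]
    field_simp
    linear_combination f (cos (φ t)) (sin (φ t)) * hcs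
  · simp only
    rw [div_eq_iff (pow_ne_zero _ hne)]
    field_simp
    linear_combination g (cos (φ t)) (sin (φ t)) * hcs

theorem genAbs_eq_abs (pm pp x : ℝ) : genAbs pm pp x = (pp + pm) / 2 * x + (pp - pm) / 2 * |x| := by
  unfold genAbs
  split_ifs with h
  · rw [abs_of_nonneg h]; ring
  · rw [abs_of_neg (not_le.1 h)]; ring

theorem genAbs_smul (pm pp r x : ℝ) (hr : 0 ≤ r) : genAbs pm pp (r * x) = r * genAbs pm pp x := by
  rw [genAbs_eq_abs, genAbs_eq_abs, abs_mul, abs_of_nonneg hr]; ring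

theorem genAbs_nn (pm pp x : ℝ) (hx : 0 ≤ x) : genAbs pm pp x = pp * x := by
  unfold genAbs; rw [if_pos hx]

theorem genAbs_np (pm pp x : ℝ) (hx : 0 ≤ x) : genAbs pm pp (-x) = pm * (-x) := by
  rw [genAbs_eq_abs, abs_neg, abs_of_nonneg hx]; ring

theorem aux_quarter (h : ℝ → ℝ) (hc : Continuous h) :
    ∫ x in (0:ℝ)..(2 * π), h x = ∫ x in (0:ℝ)..(π / 2),
      (h x + h (x + π / 2) + h (x + π) + h (x + 3 * π / 2)) := by
  have hi : ∀ a b : ℝ, IntervalIntegrable h MeasureTheory.volume a b := fun a b => hc.intervalIntegrable a b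
  have hs : ∀ d a b: ℝ, IntervalIntegrable (fun x => h (x + d)) MeasureTheory.volume a b :=
    fun d a b => (hc.comp (by fun_prop)).intervalIntegrable a b
  rw [intervalIntegral.integral_add (((hi _ _).add (hs _ _ _)).add (hs _ _ _)) (hs _ _ _),
    intervalIntegral.integral_add ((hi _ _).add (hs _ _ _)) (hs _ _ _),
    intervalIntegral.integral_add (hi _ _) (hs _ _ _)]
  simp only [intervalIntegral.integral_comp_add_right]
  rw [show (0:ℝ) + π / 2 = π / 2 by ring, show π / 2 + π / 2 = π by ring, zero_add,
    show π / 2 + π = 3 * π / 2 by ring, show 0 + 3 * π / 2 = 3 * π / 2 by ring,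
    show π / 2 + 3 * π / 2 = 2 * π by ring,
    intervalIntegral.integral_add_adjacent_intervals (hi _ _) (hi _ _),
    intervalIntegral.integral_add_adjacent_intervals (hi _ _) (hi _ _),
    intervalIntegral.integral_add_adjacent_intervals (hi _ _) (hi _ _)]

theorem aux_trig_integral (p q r : ℝ) :
    ∫ x in (0:ℝ)..(π / 2), (p * (cos x ^ 3 + sin x ^ 3) + q * (cos x ^ 2 * sin x + cos x * sin x ^ 2)
      + r * (cos x ^ 2 * sin x - cos x * sin x ^ 2)) = 4 / 3 * p + 2 / 3 * q := by
  rw [intervalIntegral.integral_eq_sub_of_hasDerivAt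
    (f := fun x => p * ((sin x - sin x ^ 3 / 3) + (-cos x + cos x ^ 3 / 3))
      + q * (-cos x ^ 3 / 3 + sin x ^ 3 / 3) + r * (-cos x ^ 3 / 3 - sin x ^ 3 / 3))]
  · simp only [sin_pi_div_two, cos_pi_div_two, sin_zero, cos_zero]
    ring
  · intro x _
    have hs := hasDerivAt_sin x
    have hc := hasDerivAt_cos x
    have h1 := ((((hs.sub ((hs.pow 3).div_const 3)).add (hc.neg.add ((hc.pow 3).div_const 3))).const_mul p).add
      ((((hc.pow 3).neg.div_const 3).add ((hs.pow 3).div_const 3)).const_mul q)).add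
      ((((hc.pow 3).neg.div_const 3).sub ((hs.pow 3).div_const 3)).const_mul r)
    refine h1.congr_deriv ?_
    have := sin_sq_add_cos_sq x
    push_cast
    linear_combination (-p * (cos x + sin x)) * this
  · exact Continuous.intervalIntegrable (by fun_prop) _ _

theorem aux_mean (a11 a12 a21 a22 b11 b12 b21 b22 : ℝ)
    (α1m α1p α2m α2p α3m α3p α4m α4p β1m β1p β2m β2p β3m β3p β4m β4p : ℝ) (f g : ℝ → ℝ → ℝ)
    (hf : ∀ x y, f x y = a11 * x * genAbs α1m α1p x + a12 * x * genAbs α2m α2p y +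
         a21 * y * genAbs α3m α3p x + a22 * y * genAbs α4m α4p y)
    (hg : ∀ x y, g x y = b11 * x * genAbs β1m β1p x + b12 * x * genAbs β2m β2p y +
         b21 * y * genAbs β3m β3p x + b22 * y * genAbs β4m β4p y)
    (A : ℝ → ℝ) (hc : Continuous A)
    (hA : ∀ θ, A θ = cos θ * f (cos θ) (sin θ) + sin θ * g (cos θ) (sin θ)) :
    ∫ x in (0:ℝ)..(2 * π), A x = 4 / 3 * (a11 * (α1p - α1m) + 1 / 2 * a12 * (α2p - α2m)
        + 1 / 2 * b21 * (β3p - β3m) + b22 * (β4p - β4m)) := by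
  have h1 := aux_trig_integral (a11 * (α1p - α1m) + b22 * (β4p - β4m))
    (a12 * (α2p - α2m) + b21 * (β3p - β3m))
    (a21 * (α3p - α3m) - a22 * (α4p - α4m) + b11 * (β1p - β1m) - b12 * (β2p - β2m))
  rw [aux_quarter A hc]
  rw [show (4 / 3 * (a11 * (α1p - α1m) + 1 / 2 * a12 * (α2p - α2m)
        + 1 / 2 * b21 * (β3p - β3m) + b22 * (β4p - β4m)) : ℝ) =
      4 / 3 * (a11 * (α1p - α1m) + b22 * (β4p - β4m)) + 2 / 3 *
      (a12 * (α2p - α2m) + b21 * (β3p - β3m)) by ring, ← h1]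
  apply intervalIntegral.integral_congr
  intro x hx
  rw [uIcc_of_le (by positivity)] at hx
  have hcx : 0 ≤ cos x := cos_nonneg_of_mem_Icc ⟨by linarith [hx.1, pi_pos], hx.2⟩
  have hsx : 0 ≤ sin x := sin_nonneg_of_nonneg_of_le_pi hx.1 (by linarith [hx.2, pi_pos])
  have e1 : cos (x + 3 * π / 2) = sin x := by
    rw [show x + 3 * π / 2 = x + π / 2 + π by ring, cos_add_pi, cos_add_pi_div_two, neg_neg]
  have e2 : sin (x + 3 * π / 2) = - cos x := by
    rw [show x + 3 * π / 2 = x + π / 2 + π by ring, sin_add_pi, sin_add_pi_div_two]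
  simp only [hA, hf, hg, e1, e2, cos_add_pi, sin_add_pi, cos_add_pi_div_two, sin_add_pi_div_two,
    genAbs_nn _ _ _ hcx, genAbs_nn _ _ _ hsx, genAbs_np _ _ _ hcx, genAbs_np _ _ _ hsx]
  ring

theorem aux_crit_alg (μ Ab E ρ M : ℝ) (hAb : Ab ≠ 0) (hμ : μ ≠ 0) (hρ : 0 < ρ)
    (hE : |E| ≤ M) (hM : 1 / ρ * M ≤ |Ab| / 2) (h0 : -μ * ρ - Ab + E / ρ = 0) :
    μ * Ab < 0 ∧ |ρ - -Ab / μ| ≤ 2 * M / |Ab| := by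
  have hS : 0 < |Ab| := abs_pos.2 hAb
  have hm : 0 < |μ| := abs_pos.2 hμ
  have h1 : |E / ρ| ≤ 1 / ρ * M := by
    rw [abs_div, abs_of_pos hρ, div_eq_mul_one_div, mul_comm]
    gcongr
  have h2 : |E / ρ| ≤ |Ab| / 2 := h1.trans hM
  have hA2 : |Ab| * |Ab| = Ab * Ab := abs_mul_abs_self Ab
  have h3 : Ab * (E / ρ) ≤ Ab * Ab / 2 := by
    calc Ab * (E / ρ) ≤ |Ab * (E / ρ)| := le_abs_self _
      _ = |Ab| * |E / ρ| := abs_mul _ _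
      _ ≤ |Ab| * (|Ab| / 2) := by gcongr
      _ = _ := by rw [← hA2]; ring
  have h4 : μ * ρ = -Ab + E / ρ := by linarith
  have h5 : (μ * Ab) * ρ < 0 := by
    have : (μ * Ab) * ρ = -(Ab * Ab) + Ab * (E / ρ) := by linear_combination Ab * h4
    nlinarith [mul_pos hS hS]
  refine ⟨by by_contra hcon; nlinarith [not_lt.1 hcon], ?_⟩
  have h6 : μ * (ρ - -Ab / μ) = E / ρ := by
    field_simp
    field_simp at h4
    linarith
  have h7 : |μ| * |ρ - -Ab / μ| ≤ 1 / ρ * M := by rw [← abs_mul, h6]; exact h1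
  have h8 : |Ab| / 2 ≤ |μ| * ρ := by
    have : |μ| * ρ = |-Ab + E / ρ| := by rw [← h4, abs_mul, abs_of_pos hρ]
    rw [this]
    have := abs_sub_abs_le_abs_sub (-Ab) (-(E / ρ))
    rw [abs_neg, abs_neg, sub_neg_eq_add] at this
    linarith
  have hM0 : 0 ≤ M := (abs_nonneg _).trans hE
  have h9 : 1 / ρ ≤ 2 * |μ| / |Ab| := by
    rw [div_le_div_iff₀ hρ hS]; linarith
  have h10 : |μ| * |ρ - -Ab / μ| ≤ |μ| * (2 * M / |Ab|) := by
    calc _ ≤ 1 / ρ * M := h7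
      _ ≤ 2 * |μ| / |Ab| * M := by gcongr
      _ = _ := by ring
  exact le_of_mul_le_mul_left h10 hm

theorem aux_int_per (a : ℝ → ℝ) (P : ℝ) (h : ∀ x, a (x + P) = a x) (k : ℤ) (x : ℝ) :
    a (x + k * P) = a x := by
  have : Function.Periodic a P := h
  exact this.int_mul k x

theorem aux_polar_bound (ω μ Ab M : ℝ) (hω : ω ≠ 0) (hAb : Ab ≠ 0) (hμ : μ ≠ 0)
    (A B a : ℝ → ℝ) (had : ∀ θ, HasDerivAt a ((A θ - Ab) / ω) θ) (hap : ∀ θ, a (θ + 2 * π) = a θ)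
    (haM : ∀ θ, |a θ| ≤ M) (hEM : ∀ θ, |(A θ - Ab) * B θ / ω| ≤ M)
    (ρ φ : ℝ → ℝ) (T : ℝ) (hT : 0 < T) (hρ0 : ∀ t, 0 < ρ t)
    (hρ : ∀ t, HasDerivAt ρ (-μ * ρ t - A (φ t)) t)
    (hφ : ∀ t, HasDerivAt φ (ω + B (φ t) / ρ t) t) (hρT : ∀ t, ρ (t + T) = ρ t)
    (hφT : ∀ t, ∃ k : ℤ, φ (t + T) = φ t + k * (2 * π))
    (hsm : ∀ t, 1 / ρ t * M ≤ |Ab| / 2) :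
    μ * Ab < 0 ∧ ∀ t, |ρ t - -Ab / μ| ≤ 2 * M / |Ab| + 2 * M := by
  have hd : ∀ t, HasDerivAt (fun t => ρ t + a (φ t))
      (-μ * ρ t - Ab + (A (φ t) - Ab) * B (φ t) / ω / ρ t) t := by
    intro t
    refine ((hρ t).add ((had (φ t)).comp t (hφ t))).congr_deriv ?_
    have := (hρ0 t).ne'
    field_simp
    ring
  have hp : ∀ t, (fun t => ρ t + a (φ t)) (t + T) = (fun t => ρ t + a (φ t)) t := by
    intro t
    obtain ⟨k, hk⟩ := hφT t
    simp only [hρT, hk, aux_int_per a _ hap]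
  obtain ⟨t1, h1, h1'⟩ := aux_crit_max _ _ T hT hd hp
  obtain ⟨t2, h2, h2'⟩ := aux_crit_min _ _ T hT hd hp
  obtain ⟨e1, e1'⟩ := aux_crit_alg μ Ab _ _ M hAb hμ (hρ0 t1) (hEM (φ t1)) (hsm t1) h1'
  obtain ⟨-, e2'⟩ := aux_crit_alg μ Ab _ _ M hAb hμ (hρ0 t2) (hEM (φ t2)) (hsm t2) h2'
  refine ⟨e1, fun t => ?_⟩
  have k1 := h1 t
  have k2 := h2 t
  have b0 := abs_le.1 (haM (φ t))
  have b1 := abs_le.1 (haM (φ t1))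
  have b2 := abs_le.1 (haM (φ t2))
  have c1 := abs_le.1 e1'
  have c2 := abs_le.1 e2'
  rw [abs_le]
  constructor <;> linarith

theorem aux_zero_d (d k : ℝ → ℝ) (T : ℝ) (hT : 0 < T) (hd : ∀ t, HasDerivAt d (d t * k t) t)
    (hp : ∀ t, d (t + T) = d t) (hk : ∀ t, k t ≠ 0) : ∀ t, d t = 0 := by
  obtain ⟨t, h1, h2⟩ := aux_crit_max (fun t => d t ^ 2) _ T hT (fun t => (hd t).pow 2)
    (fun t => by simp only [hp])
  have h3 : d t = 0 := by
    have h4 : d t ^ 2 * (2 * k t) = 0 := by rw [← h2]; push_cast; ring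
    have := (mul_eq_zero.1 h4).resolve_right (mul_ne_zero two_ne_zero (hk t))
    exact pow_eq_zero_iff two_ne_zero |>.1 this
  intro s
  have := h1 s
  simp only [h3] at this
  nlinarith [sq_nonneg (d s)]

theorem aux_ident (ω μ Ab c M : ℝ) (hω : ω ≠ 0) (hc : 0 < c)
    (A B a z : ℝ → ℝ) (had : ∀ θ, HasDerivAt a ((A θ - Ab) / ω) θ)
    (hap : ∀ θ, a (θ + 2 * π) = a θ) (hzp : ∀ θ, z (θ + 2 * π) = z θ)
    (hBM : ∀ θ, |B θ| ≤ M) (hEM : ∀ θ, |(A θ - Ab) * B θ / ω| ≤ M)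
    (hMc : 2 * M / c ≤ |ω| / 2)
    (hz : ∀ θ, HasDerivAt z ((-μ * (z θ - a θ) - Ab + (A θ - Ab) * B θ / ω / (z θ - a θ)) /
      (ω + B θ / (z θ - a θ))) θ)
    (hz2 : ∀ θ, c / 2 ≤ z θ - a θ)
    (hJ : |μ| * M * (2 * (2 / c)) + (|Ab| * M + M * |ω|) * ((2 / c) * (2 / c)) < |μ| * |ω|)
    (ρ φ : ℝ → ℝ) (T : ℝ) (hT : 0 < T) 
    (hρ : ∀ t, HasDerivAt ρ (-μ * ρ t - A (φ t)) t)
    (hφ : ∀ t, HasDerivAt φ (ω + B (φ t) / ρ t) t) (hρT : ∀ t, ρ (t + T) = ρ t)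
    (hφT : ∀ t, ∃ k : ℤ, φ (t + T) = φ t + k * (2 * π))
    (hρ2 : ∀ t, c / 2 ≤ ρ t) : ∀ t, ρ t = z (φ t) - a (φ t) := by
  have hw : 0 < |ω| := abs_pos.2 hω
  have key : ∀ t, ρ t + a (φ t) - z (φ t) = 0 := by
    refine aux_zero_d (fun t => ρ t + a (φ t) - z (φ t))
      (fun t => (-μ * ω - μ * B (φ t) * (1 / ρ t + 1 / (z (φ t) - a (φ t))) -
        (Ab * B (φ t) + (A (φ t) - Ab) * B (φ t) / ω * ω) * (1 / ρ t * (1 / (z (φ t) - a (φ t)))))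
        / (ω + B (φ t) / (z (φ t) - a (φ t)))) T hT ?_ ?_ ?_
    · intro t
      have hr0 : ρ t ≠ 0 := (lt_of_lt_of_le (by positivity) (hρ2 t)).ne'
      have hs0 : z (φ t) - a (φ t) ≠ 0 := (lt_of_lt_of_le (by positivity) (hz2 (φ t))).ne'
      have hD1 : ω + B (φ t) / ρ t ≠ 0 := by
        have := (aux_D_bound ω _ _ M c hc (hρ2 t) (hBM (φ t)) hMc).2
        exact abs_pos.1 (lt_of_lt_of_le (by positivity) this)
      have hD2 : ω + B (φ t) / (z (φ t) - a (φ t)) ≠ 0 := by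
        have := (aux_D_bound ω _ _ M c hc (hz2 (φ t)) (hBM (φ t)) hMc).2
        exact abs_pos.1 (lt_of_lt_of_le (by positivity) this)
      have hG := aux_G_diff ω μ Ab ((A (φ t) - Ab) * B (φ t) / ω) (B (φ t)) (ρ t)
        (z (φ t) - a (φ t)) hr0 hs0 hD1 hD2
      refine (((hρ t).add ((had (φ t)).comp t (hφ t))).sub ((hz (φ t)).comp t (hφ t))).congr_deriv ?_
      have e1 : -μ * ρ t - A (φ t) + (A (φ t) - Ab) / ω * (ω + B (φ t) / ρ t)
          = (-μ * ρ t - Ab + (A (φ t) - Ab) * B (φ t) / ω / ρ t) / (ω + B (φ t) / ρ t) *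
            (ω + B (φ t) / ρ t) := by
        rw [div_mul_cancel₀ _ hD1]
        field_simp
        ring
      rw [e1, ← sub_mul, hG, ← sub_sub_eq_add_sub]
      have hh : ∀ x J D1 D2 : ℝ, D1 ≠ 0 → D2 ≠ 0 → x * J / (D1 * D2) * D1 = x * (J / D2) := by
        intro x J D1 D2 h1 h2
        field_simp
      exact hh _ _ _ _ hD1 hD2
    · intro t
      obtain ⟨k, hk⟩ := hφT t
      simp only [hρT, hk, aux_int_per a _ hap, aux_int_per z _ hzp]
    · intro t
      have hD2 : ω + B (φ t) / (z (φ t) - a (φ t)) ≠ 0 := by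
        have := (aux_D_bound ω _ _ M c hc (hz2 (φ t)) (hBM (φ t)) hMc).2
        exact abs_pos.1 (lt_of_lt_of_le (by positivity) this)
      refine div_ne_zero ?_ hD2
      intro h0
      obtain ⟨q1, q1'⟩ := aux_inv_bound _ c hc (hρ2 t)
      obtain ⟨q2, q2'⟩ := aux_inv_bound _ c hc (hz2 (φ t))
      have hb := aux_J_bound ω μ Ab ((A (φ t) - Ab) * B (φ t) / ω) (B (φ t)) _ _ M _ q1 q2 q1' q2'
        (hBM _) (hEM _)
      have h1 : μ * B (φ t) * (1 / ρ t + 1 / (z (φ t) - a (φ t))) +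
        (Ab * B (φ t) + (A (φ t) - Ab) * B (φ t) / ω * ω) * (1 / ρ t * (1 / (z (φ t) - a (φ t))))
        = -(μ * ω) := by linarith
      rw [h1, abs_neg, abs_mul] at hb
      linarith
  intro t
  linarith [key t]

theorem aux_const (S M w K δ : ℝ) (hS : 0 < S) (hM : 0 < M) (hw : 0 < w) (hK : 0 < K) (hδ : 0 < δ) :
    ∃ ε > 0, ∀ m, 0 < m → m < ε → ∀ c, c * m = S → K ≤ c / 2 ∧ 2 * M / c ≤ w / 2 ∧
      m * M * (2 * (2 / c)) + (S * M + M * w) * ((2 / c) * (2 / c)) < m * w ∧ 2 / c < δ := by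
  obtain ⟨Q, hQ⟩ : ∃ Q, Q = 4 * M / S + 4 * (S * M + M * w) / S ^ 2 := ⟨_, rfl⟩
  have hQ0 : 0 < Q := by rw [hQ]; positivity
  refine ⟨min (min (S / (2 * K)) (w * S / (4 * M))) (min (w / Q) (S * δ / 2)), by positivity, ?_⟩
  intro m hm hlt c hcm
  obtain ⟨h12, h34⟩ := lt_min_iff.1 hlt
  obtain ⟨h1, h2⟩ := lt_min_iff.1 h12
  obtain ⟨h3, h4⟩ := lt_min_iff.1 h34
  have hc : c = S / m := by rw [← hcm]; field_simp
  rw [lt_div_iff₀ (by positivity)] at h1 h2 h3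
  have e : 2 / c = 2 * m / S := by rw [hc]; field_simp
  have e' : 2 * M / c = 2 * M * m / S := by rw [hc]; field_simp
  rw [e, e']
  refine ⟨?_, ?_, ?_, ?_⟩
  · rw [hc, div_div, le_div_iff₀ (by positivity)]; linarith
  · rw [div_le_div_iff₀ hS two_pos]; linarith
  · have : m * M * (2 * (2 * m / S)) + (S * M + M * w) * ((2 * m / S) * (2 * m / S)) = m * (m * Q) := by
      rw [hQ]; field_simp; ring
    rw [this]
    gcongr
  · rw [div_lt_iff₀ hS]; linarith

theorem aux_ampl (ρ φ : ℝ → ℝ) (T : ℝ) (hT : 0 < T) (hρ0 : ∀ t, 0 < ρ t) (hρc : Continuous ρ)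
    (hρT : ∀ t, ρ (t + T) = ρ t) (u : ℝ → ℝ × ℝ)
    (hu : ∀ t, u t = (cos (φ t) / ρ t, sin (φ t) / ρ t)) :
    (∀ t, 1 / ρ t ≤ ampl2 u) ∧ ∀ q, (∀ t, 1 / ρ t ≤ q) → ampl2 u ≤ q := by
  have h1 : ampl2 u = ⨆ t : ℝ, 1 / ρ t := by
    unfold ampl2
    congr 1
    ext t
    rw [hu]
    exact aux_norm_polar _ _ (hρ0 t)
  obtain ⟨R, hR⟩ := aux_bdd_per (fun t => 1 / ρ t) T hT
    (continuous_const.div hρc fun t => (hρ0 t).ne') (fun t => by simp only [hρT])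
  have hb : BddAbove (Set.range fun t => 1 / ρ t) := by
    refine ⟨R, ?_⟩
    rintro _ ⟨t, rfl⟩
    exact (le_abs_self _).trans (hR t)
  rw [h1]
  exact ⟨fun t => le_ciSup hb t, fun q hq => ciSup_le hq⟩

theorem aux_translate (G τ φ₁ φ₂ : ℝ → ℝ) (hG : ∀ x, G x ≠ 0) (hτ : ∀ x, HasDerivAt τ (1 / G x) x)
    (hinj : Function.Injective τ) (h1 : ∀ t, HasDerivAt φ₁ (G (φ₁ t)) t)
    (h2 : ∀ t, HasDerivAt φ₂ (G (φ₂ t)) t) : ∃ s, ∀ t, φ₂ t = φ₁ (t + s) := by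
  have key : ∀ φ : ℝ → ℝ, (∀ t, HasDerivAt φ (G (φ t)) t) → ∃ k, ∀ t, τ (φ t) = t + k := by
    intro φ hφ
    have hd : ∀ t, HasDerivAt (fun t => τ (φ t) - t) 0 t := by
      intro t
      refine (((hτ (φ t)).comp t (hφ t)).sub (hasDerivAt_id t)).congr_deriv ?_
      have := hG (φ t)
      field_simp
      ring
    refine ⟨τ (φ 0) - 0, fun t => ?_⟩
    have := is_const_of_deriv_eq_zero (fun t => (hd t).differentiableAt) (fun t => (hd t).deriv) t 0
    linarith
  obtain ⟨k1, hk1⟩ := key φ₁ h1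
  obtain ⟨k2, hk2⟩ := key φ₂ h2
  refine ⟨k2 - k1, fun t => hinj ?_⟩
  rw [hk1, hk2]; ring

theorem aux_inv_dist (ρ c K S m : ℝ) (hc : 0 < c) (hm : 0 < m) (hS : 0 < S) (hcm : c * m = S)
    (hρ : c / 2 ≤ ρ) (h : |ρ - c| ≤ K) : |1 / ρ - 1 / c| ≤ 2 * K / S ^ 2 * m ^ 2 := by
  have hρ0 : 0 < ρ := by linarith
  have e : 1 / ρ - 1 / c = -(ρ - c) / (ρ * c) := by field_simp; ring
  rw [e, abs_div, abs_neg, abs_of_pos (mul_pos hρ0 hc)]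
  have hK : 0 ≤ K := (abs_nonneg _).trans h
  calc |ρ - c| / (ρ * c) ≤ K / (c / 2 * c) := by gcongr
    _ = _ := by rw [← hcm]; field_simp

theorem aux_core (ω : ℝ) (hω : ω ≠ 0) (f g : ℝ → ℝ → ℝ)
    (hf : Continuous (fun p : ℝ × ℝ => f p.1 p.2)) (hg : Continuous (fun p : ℝ × ℝ => g p.1 p.2))
    (hfh : ∀ r x y, 0 ≤ r → f (r * x) (r * y) = r ^ 2 * f x y)
    (hgh : ∀ r x y, 0 ≤ r → g (r * x) (r * y) = r ^ 2 * g x y)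
    (F : ℝ → ℝ × ℝ → ℝ × ℝ)
    (hF : ∀ μ p, F μ p = (μ * p.1 - ω * p.2 + f p.1 p.2, ω * p.1 + μ * p.2 + g p.1 p.2))
    (A B : ℝ → ℝ)
    (hA : ∀ θ, A θ = cos θ * f (cos θ) (sin θ) + sin θ * g (cos θ) (sin θ))
    (hB : ∀ θ, B θ = cos θ * g (cos θ) (sin θ) - sin θ * f (cos θ) (sin θ))
    (Ab : ℝ) (hAb : Ab ≠ 0) (hint : ∫ x in (0:ℝ)..(2 * π), A x = 2 * π * Ab) :
    ∃ ε > 0, ∃ δ > 0, ∃ C > 0, ∀ μ : ℝ, 0 < |μ| → |μ| < ε →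
      ((μ * Ab < 0 →
        ∃ u : ℝ → ℝ × ℝ, IsPeriodicSolution2 (F μ) u ∧
          0 < ampl2 u ∧ ampl2 u < δ ∧
          |ampl2 u + μ / Ab| ≤ C * μ ^ 2) ∧
       (∀ u₁ u₂ : ℝ → ℝ × ℝ,
          IsPeriodicSolution2 (F μ) u₁ → IsPeriodicSolution2 (F μ) u₂ →
          ampl2 u₁ < δ → ampl2 u₂ < δ →
          ∃ s : ℝ, ∀ t, u₂ t = u₁ (t + s)) ∧
       (0 < μ * Ab →
        ¬ ∃ u : ℝ → ℝ × ℝ, IsPeriodicSolution2 (F μ) u ∧ ampl2 u < δ)) := by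
  have hP : 0 < 2 * π := by positivity
  have hfc : Continuous fun t => f (cos t) (sin t) := hf.comp (continuous_cos.prodMk continuous_sin)
  have hgc : Continuous fun t => g (cos t) (sin t) := hg.comp (continuous_cos.prodMk continuous_sin)
  have hAc : Continuous A := by rw [funext hA]; fun_prop
  have hBc : Continuous B := by rw [funext hB]; fun_prop
  have hAp : ∀ x, A (x + 2 * π) = A x := fun x => by rw [hA, hA, cos_add_two_pi, sin_add_two_pi]
  have hBp : ∀ x, B (x + 2 * π) = B x := fun x => by rw [hB, hB, cos_add_two_pi, sin_add_two_pi]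
  obtain ⟨a, ha⟩ : ∃ a : ℝ → ℝ, a = fun x => ∫ s in (0:ℝ)..x, (A s - Ab) / ω := ⟨_, rfl⟩
  have hgc' : Continuous fun s => (A s - Ab) / ω := by fun_prop
  have had : ∀ θ, HasDerivAt a ((A θ - Ab) / ω) θ := fun θ => by
    rw [ha]; exact aux_integral_deriv _ hgc' θ
  have hap : ∀ θ, a (θ + 2 * π) = a θ := fun θ => by
    rw [ha]
    have h1 := aux_per_integral (fun s => (A s - Ab) / ω) (2 * π) hgc' (fun x => by simp only [hAp]) θ
    have h2 : ∫ s in (0:ℝ)..(2 * π), (A s - Ab) / ω = 0 := by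
      rw [intervalIntegral.integral_div, intervalIntegral.integral_sub (hAc.intervalIntegrable _ _)
        (continuous_const.intervalIntegrable _ _), hint, intervalIntegral.integral_const]
      simp
    rw [h2, add_zero] at h1
    exact h1
  have hac : Continuous a := continuous_iff_continuousAt.2 fun t => (had t).continuousAt
  have hEc : Continuous fun θ => (A θ - Ab) * B θ / ω := by fun_prop
  have hEp : ∀ x, (fun θ => (A θ - Ab) * B θ / ω) (x + 2 * π) = (fun θ => (A θ - Ab) * B θ / ω) x :=
    fun x => by simp only [hAp, hBp]
  obtain ⟨M1, hM1⟩ := aux_bdd_per A _ hP hAc hAp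
  obtain ⟨M2, hM2⟩ := aux_bdd_per B _ hP hBc hBp
  obtain ⟨M3, hM3⟩ := aux_bdd_per a _ hP hac hap
  obtain ⟨M4, hM4⟩ := aux_bdd_per _ _ hP hEc hEp
  obtain ⟨M, hMM⟩ : ∃ M, M = |M2| + |M3| + |M4| + 1 := ⟨_, rfl⟩
  have hM0 : 0 < M := by rw [hMM]; positivity
  have hBM : ∀ x, |B x| ≤ M := fun x => by
    linarith [hM2 x, le_abs_self M2, abs_nonneg M2, abs_nonneg M3, abs_nonneg M4]
  have haM : ∀ x, |a x| ≤ M := fun x => by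
    linarith [hM3 x, le_abs_self M3, abs_nonneg M2, abs_nonneg M3, abs_nonneg M4]
  have hEM : ∀ x, |(A x - Ab) * B x / ω| ≤ M := fun x => by
    have := hM4 x
    linarith [le_abs_self M4, abs_nonneg M2, abs_nonneg M3, abs_nonneg M4]
  have hS : 0 < |Ab| := abs_pos.2 hAb
  have hw : 0 < |ω| := abs_pos.2 hω
  obtain ⟨K, hK⟩ : ∃ K, K = 2 * M / |Ab| + M + 1 := ⟨_, rfl⟩
  have hK0 : 0 < K := by rw [hK]; positivity
  obtain ⟨δ, hδe⟩ : ∃ δ, δ = |Ab| / (2 * M) := ⟨_, rfl⟩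
  have hδ : 0 < δ := by rw [hδe]; positivity
  have hδM : ∀ x, x < δ → x * M ≤ |Ab| / 2 := fun x hx => by
    rw [hδe, lt_div_iff₀ (by positivity)] at hx
    linarith
  obtain ⟨ε, hε, hεc⟩ := aux_const |Ab| M |ω| (K + M) δ hS hM0 hw (by positivity) hδ
  refine ⟨ε, hε, δ, hδ, 2 * (K + M) / |Ab| ^ 2, by positivity, ?_⟩
  intro μ hm hme
  have hμ : μ ≠ 0 := abs_pos.1 hm
  -- polar form of a small periodic solution
  have hpol : ∀ u : ℝ → ℝ × ℝ, IsPeriodicSolution2 (F μ) u → ampl2 u < δ →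
      μ * Ab < 0 ∧ ∃ (ρ φ : ℝ → ℝ) (T : ℝ), 0 < T ∧ (∀ t, 0 < ρ t) ∧
      (∀ t, HasDerivAt ρ (-μ * ρ t - A (φ t)) t) ∧
      (∀ t, HasDerivAt φ (ω + B (φ t) / ρ t) t) ∧
      (∀ t, u t = (cos (φ t) / ρ t, sin (φ t) / ρ t)) ∧ (∀ t, ρ (t + T) = ρ t) ∧
      (∀ t, ∃ k : ℤ, φ (t + T) = φ t + k * (2 * π)) ∧ (∀ t, |ρ t - -Ab / μ| ≤ K + M) := by
    intro u hu hamp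
    obtain ⟨ρ, φ, T, hT, hρ0, hρ, hφ, huρ, hρT, hφT⟩ :=
      aux_planar_polar ω μ f g hf hg hfh hgh (F μ) (hF μ) A B hA hB M1 hM1 u hu
    have hρc : Continuous ρ := continuous_iff_continuousAt.2 fun t => (hρ t).continuousAt
    have h1 := (aux_ampl ρ φ T hT hρ0 hρc hρT u huρ).1
    obtain ⟨h2, h3⟩ := aux_polar_bound ω μ Ab M hω hAb hμ A B a had hap haM hEM ρ φ T hT hρ0 hρ hφ
      hρT hφT (fun t => hδM _ (lt_of_le_of_lt (h1 t) hamp))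
    refine ⟨h2, ρ, φ, T, hT, hρ0, hρ, hφ, huρ, hρT, hφT, fun t => (h3 t).trans ?_⟩
    rw [hK]; linarith
  by_cases hsg : μ * Ab < 0
  swap
  · refine ⟨fun h => absurd h hsg, fun u₁ u₂ h1 _ h3 _ => absurd (hpol u₁ h1 h3).1 hsg, ?_⟩
    rintro - ⟨u, h1, h2⟩
    exact hsg (hpol u h1 h2).1
  obtain ⟨c, hcd⟩ : ∃ c, c = -Ab / μ := ⟨_, rfl⟩
  have hc : 0 < c := by
    have : c = -(μ * Ab) / μ ^ 2 := by rw [hcd]; field_simp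
    rw [this]
    exact div_pos (by linarith) (by positivity)
  have hAbc : Ab = -μ * c := by rw [hcd]; field_simp
  have hcm : c * |μ| = |Ab| := by rw [hAbc, abs_mul, abs_neg, abs_of_pos hc, mul_comm]
  obtain ⟨hc1, hc2, hc3, hc4⟩ := hεc |μ| hm hme c hcm
  have hMK : 2 * M / c < |μ| * (K - M) := by
    have e1 : 2 * M / c = |μ| * (2 * M / |Ab|) := by rw [← hcm]; field_simp
    rw [e1, hK]
    gcongr
    linarith
  obtain ⟨z, hz, hzp, hzK⟩ := aux_exist_z ω μ Ab c K M hω hμ hc hAbc B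
    (fun θ => (A θ - Ab) * B θ / ω) a hBc hEc hac (2 * π) hP hBp hEp hap hBM hEM haM hc1 hK0.le hc2 hMK
  have hzr : ∀ θ, |z θ - a θ - c| ≤ K + M := fun θ => by
    have h1 := abs_le.1 (hzK θ)
    have h2 := abs_le.1 (haM θ)
    rw [abs_le]; constructor <;> linarith
  have hz2 : ∀ θ, c / 2 ≤ z θ - a θ := fun θ => by
    have h1 := abs_le.1 (hzr θ)
    linarith
  have hz0 : ∀ θ, 0 < z θ - a θ := fun θ => lt_of_lt_of_le (by positivity) (hz2 θ)
  have hzc : Continuous z := continuous_iff_continuousAt.2 fun t => (hz t).continuousAt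
  obtain ⟨G, hGd⟩ : ∃ G : ℝ → ℝ, ∀ θ, G θ = ω + B θ / (z θ - a θ) := ⟨_, fun _ => rfl⟩
  have hG0 : ∀ θ, G θ ≠ 0 := fun θ => by
    have := (aux_D_bound ω _ _ M c hc (hz2 θ) (hBM θ) hc2).2
    rw [hGd]
    exact abs_pos.1 (lt_of_lt_of_le (by positivity) this)
  have hGc : Continuous G := by
    rw [funext hGd]
    exact continuous_const.add (hBc.div (hzc.sub hac) fun θ => (hz0 θ).ne')
  have hGp : ∀ x, G (x + 2 * π) = G x := fun x => by rw [hGd, hGd, hBp, hzp, hap]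
  have hGpos : ∀ x, 0 < ω / G x := fun x => by
    have h1 := (aux_D_bound ω _ _ M c hc (hz2 x) (hBM x) hc2).1
    have h2 : ω / G x = ω * G x / (G x) ^ 2 := by have := hG0 x; field_simp
    rw [h2]
    refine div_pos ?_ (by have := hG0 x; positivity)
    rw [hGd]
    have h3 : |ω * (B x / (z x - a x))| ≤ |ω| * (|ω| / 2) := by
      rw [abs_mul]; gcongr
    have h4 := (abs_le.1 h3).1
    have h5 : |ω| * |ω| = ω * ω := abs_mul_abs_self ω
    nlinarith [mul_pos hw hw]
  obtain ⟨τ, φ, hτ, hτi, hφ, hφs, T, hT, hφT⟩ := aux_angle_ode ω hω G hGc (2 * π) hP hGp hGpos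
  refine ⟨fun _ => ?_, ?_, fun h => absurd hsg (not_lt.2 h.le)⟩
  · have hρ0 : ∀ t, 0 < z (φ t) - a (φ t) := fun t => hz0 _
    have hρd : ∀ t, HasDerivAt (fun t => z (φ t) - a (φ t)) (-μ * (z (φ t) - a (φ t)) - A (φ t)) t := by
      intro t
      refine (((hz (φ t)).comp t (hφ t)).sub ((had (φ t)).comp t (hφ t))).congr_deriv ?_
      have h1 := hG0 (φ t)
      rw [hGd] at h1 ⊢
      rw [div_mul_cancel₀ _ h1]
      have h2 := (hρ0 t).ne'
      field_simp
      ring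
    have hφd : ∀ t, HasDerivAt φ (ω + B (φ t) / (z (φ t) - a (φ t))) t := fun t => by
      rw [← hGd]; exact hφ t
    have hsol := aux_polar_planar ω μ f g hfh hgh (F μ) (hF μ) A B hA hB (fun t => z (φ t) - a (φ t)) φ
      hρ0 hρd hφd
    have hρc : Continuous (fun t => z (φ t) - a (φ t)) :=
      continuous_iff_continuousAt.2 fun t => (hρd t).continuousAt
    have hzp' : ∀ x, z (x - 2 * π) = z x := fun x => by rw [← hzp (x - 2 * π), sub_add_cancel]
    have hap' : ∀ x, a (x - 2 * π) = a x := fun x => by rw [← hap (x - 2 * π), sub_add_cancel]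
    have hρT : ∀ t, (fun t => z (φ t) - a (φ t)) (t + T) = (fun t => z (φ t) - a (φ t)) t := by
      intro t
      rcases hφT with h | h
      · simp only [h, hzp, hap]
      · simp only [h, hzp', hap']
    have hcT : ∀ t, cos (φ (t + T)) = cos (φ t) := by
      intro t
      rcases hφT with h | h
      · rw [h, cos_add_two_pi]
      · rw [h, cos_sub_two_pi]
    have hsT : ∀ t, sin (φ (t + T)) = sin (φ t) := by
      intro t
      rcases hφT with h | h
      · rw [h, sin_add_two_pi]
      · rw [h, sin_sub_two_pi]
    obtain ⟨am1, am2⟩ := aux_ampl _ φ T hT hρ0 hρc hρT _ (fun t => rfl)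
    have hid : ∀ t, |1 / (z (φ t) - a (φ t)) - 1 / c| ≤ 2 * (K + M) / |Ab| ^ 2 * |μ| ^ 2 := fun t =>
      aux_inv_dist _ c (K + M) |Ab| |μ| hc hm hS hcm (hz2 _) (hzr _)
    refine ⟨_, ⟨hsol, ⟨T, hT, ?_⟩, ?_⟩, ?_, ?_, ?_⟩
    · intro t
      have := hρT t
      simp only at this
      simp only [this, hcT, hsT]
    · intro hcon
      obtain ⟨t1, ht1⟩ := hφs 0
      obtain ⟨t2, ht2⟩ := hφs π
      have h1 := (hcon t1).trans (hcon t2).symm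
      have h2 := congrArg Prod.fst h1
      simp only [ht1, ht2, cos_zero, cos_pi] at h2
      have h3 : 0 < 1 / (z 0 - a 0) := one_div_pos.2 (hz0 _)
      have h4 : -1 / (z π - a π) < 0 := div_neg_of_neg_of_pos (by norm_num) (hz0 _)
      linarith
    · exact lt_of_lt_of_le (one_div_pos.2 (hρ0 0)) (am1 0)
    · refine lt_of_le_of_lt (am2 (2 / c) fun t => ?_) hc4
      exact (aux_inv_bound _ c hc (hz2 _)).2
    · have e : μ / Ab = -(1 / c) := by rw [hAbc]; field_simp
      rw [e, ← sub_eq_add_neg, ← sq_abs μ, abs_le]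
      constructor
      · have h1 := (abs_le.1 (hid 0)).1
        have h2 := am1 0
        linarith
      · have := am2 (1 / c + 2 * (K + M) / |Ab| ^ 2 * |μ| ^ 2) fun t => by
          linarith [(abs_le.1 (hid t)).2]
        linarith
  · intro u₁ u₂ h1 h2 h3 h4
    have hone : ∀ u : ℝ → ℝ × ℝ, IsPeriodicSolution2 (F μ) u → ampl2 u < δ → ∃ ψ : ℝ → ℝ,
        (∀ t, HasDerivAt ψ (G (ψ t)) t) ∧
        ∀ t, u t = (cos (ψ t) / (z (ψ t) - a (ψ t)), sin (ψ t) / (z (ψ t) - a (ψ t))) := by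
      intro u hu hamp
      obtain ⟨-, ρ, ψ, T', hT', hρ0, hρ, hψ, huρ, hρT, hψT, hρK⟩ := hpol u hu hamp
      have hρ2 : ∀ t, c / 2 ≤ ρ t := fun t => by
        have := hρK t
        rw [← hcd] at this
        linarith [(abs_le.1 this).1]
      have hid := aux_ident ω μ Ab c M hω hc A B a z had hap hzp hBM hEM hc2 hz hz2 hc3 ρ ψ T' hT'
        hρ hψ hρT hψT hρ2
      refine ⟨ψ, fun t => ?_, fun t => ?_⟩
      · rw [hGd, ← hid]; exact hψ t
      · rw [← hid]; exact huρ t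
    obtain ⟨ψ₁, k1, k1'⟩ := hone u₁ h1 h3
    obtain ⟨ψ₂, k2, k2'⟩ := hone u₂ h2 h4
    obtain ⟨s, hs⟩ := aux_translate G τ ψ₁ ψ₂ hG0 hτ hτi k1 k2
    exact ⟨s, fun t => by rw [k1', k2', hs]⟩

/-- Degenerate Hopf bifurcation for the planar system (Pg) with generalized-slope
second-order modulus nonlinearities: if
`σ̃_# = a₁₁(α₁₊−α₁₋) + ½a₁₂(α₂₊−α₂₋) + ½b₂₁(β₃₊−β₃₋) + b₂₂(β₄₊−β₄₋) ≠ 0`, then for small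
`μ ≠ 0` with `μσ̃_# < 0` there is a nonconstant periodic solution of amplitude
`−3πμ/(2σ̃_#) + O(μ²)`, unique up to time translation among small periodic solutions, and
for `μσ̃_# > 0` there is none. -/
theorem stmt7 (ω : ℝ) (hω : ω ≠ 0)
    (a11 a12 a21 a22 b11 b12 b21 b22 : ℝ)
    (α1m α1p α2m α2p α3m α3p α4m α4p β1m β1p β2m β2p β3m β3p β4m β4p : ℝ)
    (σt : ℝ)
    (hσdef : σt = a11 * (α1p - α1m) + 1 / 2 * a12 * (α2p - α2m)
        + 1 / 2 * b21 * (β3p - β3m) + b22 * (β4p - β4m))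
    (hσ : σt ≠ 0)
    (F : ℝ → ℝ × ℝ → ℝ × ℝ)
    (hF : ∀ μ p, F μ p =
      (μ * p.1 - ω * p.2 +
        (a11 * p.1 * genAbs α1m α1p p.1 + a12 * p.1 * genAbs α2m α2p p.2 +
         a21 * p.2 * genAbs α3m α3p p.1 + a22 * p.2 * genAbs α4m α4p p.2),
       ω * p.1 + μ * p.2 +
        (b11 * p.1 * genAbs β1m β1p p.1 + b12 * p.1 * genAbs β2m β2p p.2 +
         b21 * p.2 * genAbs β3m β3p p.1 + b22 * p.2 * genAbs β4m β4p p.2))) :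
    ∃ ε > 0, ∃ δ > 0, ∃ C > 0, ∀ μ : ℝ, 0 < |μ| → |μ| < ε →
      ((μ * σt < 0 →
        ∃ u : ℝ → ℝ × ℝ, IsPeriodicSolution2 (F μ) u ∧
          0 < ampl2 u ∧ ampl2 u < δ ∧
          |ampl2 u + 3 * π * μ / (2 * σt)| ≤ C * μ ^ 2) ∧
       (∀ u₁ u₂ : ℝ → ℝ × ℝ,
          IsPeriodicSolution2 (F μ) u₁ → IsPeriodicSolution2 (F μ) u₂ →
          ampl2 u₁ < δ → ampl2 u₂ < δ →
          ∃ s : ℝ, ∀ t, u₂ t = u₁ (t + s)) ∧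
       (0 < μ * σt →
        ¬ ∃ u : ℝ → ℝ × ℝ, IsPeriodicSolution2 (F μ) u ∧ ampl2 u < δ)) := by
  obtain ⟨f, hf⟩ : ∃ f : ℝ → ℝ → ℝ, ∀ x y, f x y = a11 * x * genAbs α1m α1p x +
      a12 * x * genAbs α2m α2p y + a21 * y * genAbs α3m α3p x + a22 * y * genAbs α4m α4p y :=
    ⟨_, fun _ _ => rfl⟩
  obtain ⟨g, hg⟩ : ∃ g : ℝ → ℝ → ℝ, ∀ x y, g x y = b11 * x * genAbs β1m β1p x +
      b12 * x * genAbs β2m β2p y + b21 * y * genAbs β3m β3p x + b22 * y * genAbs β4m β4p y :=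
    ⟨_, fun _ _ => rfl⟩
  have hfc : Continuous (fun p : ℝ × ℝ => f p.1 p.2) := by
    simp only [hf, genAbs_eq_abs]; fun_prop
  have hgc : Continuous (fun p : ℝ × ℝ => g p.1 p.2) := by
    simp only [hg, genAbs_eq_abs]; fun_prop
  have hfh : ∀ r x y, 0 ≤ r → f (r * x) (r * y) = r ^ 2 * f x y := by
    intro r x y hr
    simp only [hf, genAbs_smul _ _ _ _ hr]; ring
  have hgh : ∀ r x y, 0 ≤ r → g (r * x) (r * y) = r ^ 2 * g x y := by
    intro r x y hr
    simp only [hg, genAbs_smul _ _ _ _ hr]; ring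
  obtain ⟨A, hA⟩ : ∃ A : ℝ → ℝ, ∀ θ, A θ = cos θ * f (cos θ) (sin θ) + sin θ * g (cos θ) (sin θ) :=
    ⟨_, fun _ => rfl⟩
  obtain ⟨B, hB⟩ : ∃ B : ℝ → ℝ, ∀ θ, B θ = cos θ * g (cos θ) (sin θ) - sin θ * f (cos θ) (sin θ) :=
    ⟨_, fun _ => rfl⟩
  have hfc' : Continuous fun t => f (cos t) (sin t) := hfc.comp (continuous_cos.prodMk continuous_sin)
  have hgc' : Continuous fun t => g (cos t) (sin t) := hgc.comp (continuous_cos.prodMk continuous_sin)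
  have hAc : Continuous A := by rw [funext hA]; fun_prop
  have hmean := aux_mean a11 a12 a21 a22 b11 b12 b21 b22 α1m α1p α2m α2p α3m α3p α4m α4p
    β1m β1p β2m β2p β3m β3p β4m β4p f g hf hg A hAc hA
  rw [← hσdef] at hmean
  have hpi := pi_pos
  have hk : 0 < 2 / (3 * π) := by positivity
  obtain ⟨ε, hε, δ, hδ, C, hC, hmain⟩ := aux_core ω hω f g hfc hgc hfh hgh F
    (fun μ p => by rw [hF, hf, hg]) A B hA hB (2 / (3 * π) * σt) (mul_ne_zero hk.ne' hσ)
    (by rw [hmean]; field_simp; ring)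
  refine ⟨ε, hε, δ, hδ, C, hC, fun μ hm hme => ?_⟩
  obtain ⟨r1, r2, r3⟩ := hmain μ hm hme
  have e1 : μ * (2 / (3 * π) * σt) = 2 / (3 * π) * (μ * σt) := by ring
  have e2 : μ / (2 / (3 * π) * σt) = 3 * π * μ / (2 * σt) := by field_simp
  rw [e1, e2] at r1
  rw [e1] at r3
  exact ⟨fun h => r1 (mul_neg_of_pos_of_neg hk h), r2, fun h => r3 (mul_pos hk h)⟩
end
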